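/- arXiv:2106.14818 — 2 statements merged into one kernel-verified Lean document; each statement's English description precedes it below -/
import Mathlib

section
/- For every s ∈ (1/2,1) there exist a compact set A ⊂ [1,2] and a Borel probability measure ν on ℝ whose support equals A such that: (i) ν is Ahlfors s-regular; (ii) ν is a Salem measure, i.e. for every ε > 0 there is C_ε < ∞ such that |∫ e^{−2πiξy} dν(y)| ≤ C_ε (1+|ξ|)^{−(s−ε)/2} for all ξ ∈ ℝ; and (iii) the restricted maximal operator M_ν is bounded from L^2(ℝ) to L^2(ℝ). -/
open MeasureTheory Set

/-- The restricted maximal operator `M_ν f(x) = sup_{r ∈ [1,2]} ∫ |f(x+ry)| dν(y)`. -/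
noncomputable def restrictedMax (ν : Measure ℝ) (f : ℝ → ℝ) (x : ℝ) : ℝ :=
  ⨆ r : Icc (1 : ℝ) 2, ∫ y, |f (x + (r : ℝ) * y)| ∂ν

/-- The (topological) support of a measure on `ℝ`. -/
def msupport (ν : Measure ℝ) : Set ℝ :=
  {x | ∀ ε > 0, 0 < ν (Metric.ball x ε)}

/-- Ahlfors `s`-regularity of a measure on `ℝ`. -/
def IsAhlforsRegular (ν : Measure ℝ) (s : ℝ) : Prop :=
  ∃ C : ℝ, 1 ≤ C ∧ ∀ x ∈ msupport ν, ∀ r : ℝ, 0 < r → r ≤ 1 →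
    ENNReal.ofReal (C⁻¹ * r ^ s) ≤ ν (Icc (x - r) (x + r)) ∧
      ν (Icc (x - r) (x + r)) ≤ ENNReal.ofReal (C * r ^ s)

/-- `ν` is a Salem measure of dimension `s`: its Fourier transform decays like
`(1+|ξ|)^{-(s-ε)/2}` for every `ε > 0`. -/
def IsSalem (ν : Measure ℝ) (s : ℝ) : Prop :=
  ∀ ε : ℝ, 0 < ε → ∃ Cε : ℝ, 0 ≤ Cε ∧ ∀ ξ : ℝ,
    ‖∫ y, Complex.exp (-(2 * Real.pi * ξ * y) * Complex.I) ∂ν‖ ≤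
      Cε * (1 + |ξ|) ^ (-(s - ε) / 2)

/-- Hoeffding's lemma for a two-valued variable. -/
lemma exp_half_sub_add_exp_le {d c : ℝ} (h : |d| ≤ c) :
    Real.exp (d / 2) + Real.exp (-(d / 2)) ≤ 2 * Real.exp (c ^ 2 / 8) := by
  have h1 := Real.cosh_le_exp_half_sq (d / 2)
  rw [Real.cosh_eq] at h1
  have h2 : (d / 2) ^ 2 / 2 ≤ c ^ 2 / 8 := by
    have := sq_le_sq' (abs_le.1 h).1 (abs_le.1 h).2
    nlinarith
  have := Real.exp_le_exp.2 h2
  linarith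

lemma sum_cons_bool {m : ℕ} (f : (Fin (m + 1) → Bool) → ℝ) :
    ∑ ε, f ε = ∑ ε : Fin m → Bool, (f (Fin.cons true ε) + f (Fin.cons false ε)) := by
  rw [← (Fin.consEquiv (fun _ : Fin (m + 1) => Bool)).sum_comp, Fintype.sum_prod_type]
  simp [Fin.consEquiv, Finset.sum_add_distrib]

/-- The exponential moment form of McDiarmid's inequality on the discrete cube. -/
lemma sum_exp_bounded_difference {m : ℕ} (F : (Fin m → Bool) → ℝ) (c : Fin m → ℝ)
    (h : ∀ i ε, |F (Function.update ε i true) - F (Function.update ε i false)| ≤ c i) :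
    ∑ ε, Real.exp (F ε - (∑ ε', F ε') / 2 ^ m) ≤ 2 ^ m * Real.exp ((∑ i, c i ^ 2) / 8) := by
  induction m with
  | zero => simp
  | succ m ih =>
    set A : ℝ := (∑ ε' : Fin m → Bool, F (Fin.cons true ε')) / 2 ^ m with hA
    set B : ℝ := (∑ ε' : Fin m → Bool, F (Fin.cons false ε')) / 2 ^ m with hB
    have hmean : (∑ ε', F ε') / 2 ^ (m + 1) = (A + B) / 2 := by
      rw [sum_cons_bool, Finset.sum_add_distrib, hA, hB]; field_simp; ring
    have hAB : |A - B| ≤ c 0 := by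
      rw [hA, hB, ← sub_div, ← Finset.sum_sub_distrib, abs_div, abs_of_pos (by positivity : (0:ℝ) < 2 ^ m),
        div_le_iff₀ (by positivity)]
      refine (Finset.abs_sum_le_sum_abs _ _).trans ?_
      refine (Finset.sum_le_sum fun ε _ => ?_).trans (b := ∑ ε : Fin m → Bool, c 0) ?_
      · have := h 0 (Fin.cons true ε)
        simpa [Fin.update_cons_zero] using this
      · simp [mul_comm]
    have ht := ih (fun ε => F (Fin.cons true ε)) (fun i => c i.succ) (fun i ε => by
      have := h i.succ (Fin.cons true ε)
      simpa [← Fin.cons_update] using this)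
    have hf := ih (fun ε => F (Fin.cons false ε)) (fun i => c i.succ) (fun i ε => by
      have := h i.succ (Fin.cons false ε)
      simpa [← Fin.cons_update] using this)
    rw [← hA] at ht
    rw [← hB] at hf
    rw [sum_cons_bool, hmean, Finset.sum_add_distrib]
    have e1 : ∀ ε : Fin m → Bool, Real.exp (F (Fin.cons true ε) - (A + B) / 2) =
        Real.exp ((A - B) / 2) * Real.exp (F (Fin.cons true ε) - A) := fun ε => by
      rw [← Real.exp_add]; ring_nf
    have e2 : ∀ ε : Fin m → Bool, Real.exp (F (Fin.cons false ε) - (A + B) / 2) =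
        Real.exp (-((A - B) / 2)) * Real.exp (F (Fin.cons false ε) - B) := fun ε => by
      rw [← Real.exp_add]; ring_nf
    simp only [e1, e2, ← Finset.mul_sum]
    have e3 := exp_half_sub_add_exp_le hAB
    have e4 : Real.exp ((∑ i, c i ^ 2) / 8) =
        Real.exp (c 0 ^ 2 / 8) * Real.exp ((∑ i : Fin m, c i.succ ^ 2) / 8) := by
      rw [Fin.sum_univ_succ, add_div, Real.exp_add]
    set E : ℝ := 2 ^ m * Real.exp ((∑ i : Fin m, c i.succ ^ 2) / 8)
    calc _ ≤ Real.exp ((A - B) / 2) * E + Real.exp (-((A - B) / 2)) * E := by gcongr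
      _ = (Real.exp ((A - B) / 2) + Real.exp (-((A - B) / 2))) * E := by ring
      _ ≤ (2 * Real.exp (c 0 ^ 2 / 8)) * E := by
        gcongr
      _ = _ := by rw [e4, pow_succ]; ring

/-- A union bound: finitely many functions with bounded differences on the discrete cube can
simultaneously be made not much larger than their means. -/
lemma exists_signs_forall_le {m : ℕ} {ι : Type*} (G : Finset ι) (F : ι → (Fin m → Bool) → ℝ)
    (c : ι → Fin m → ℝ) (μ σ : ι → ℝ) {t : ℝ}
    (h : ∀ g ∈ G, ∀ i ε,
      |F g (Function.update ε i true) - F g (Function.update ε i false)| ≤ c g i)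
    (hσ : ∀ g ∈ G, 0 < σ g) (hc : ∀ g ∈ G, ∑ i, c g i ^ 2 ≤ σ g ^ 2)
    (hμ : ∀ g ∈ G, ∑ ε, F g ε ≤ 2 ^ m * μ g) (ht : 0 < t)
    (hG : (G.card : ℝ) < Real.exp (2 * t ^ 2)) :
    ∃ ε, ∀ g ∈ G, F g ε ≤ μ g + t * σ g := by
  by_contra! hcon
  choose g hg hlt using hcon
  have key : ∀ i ∈ G, ∑ ε, Real.exp (4 * t / σ i * (F i ε - μ i)) ≤ 2 ^ m * Real.exp (2 * t ^ 2) := by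
    intro i hi
    have hs := hσ i hi
    have h1 := sum_exp_bounded_difference (fun ε => 4 * t / σ i * F i ε)
      (fun k => 4 * t / σ i * c i k) (fun k ε => by
        rw [← mul_sub, abs_mul, abs_of_pos (by positivity : 0 < 4 * t / σ i)]
        exact mul_le_mul_of_nonneg_left (h i hi k ε) (by positivity))
    have h2 : (∑ k, (4 * t / σ i * c i k) ^ 2) / 8 ≤ 2 * t ^ 2 := by
      simp only [mul_pow, ← Finset.mul_sum]
      have := hc i hi
      calc _ ≤ (4 * t / σ i) ^ 2 * σ i ^ 2 / 8 := by gcongr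
        _ = 2 * t ^ 2 := by field_simp; norm_num
    refine le_trans (Finset.sum_le_sum fun ε _ => ?_) (h1.trans (by gcongr))
    rw [Real.exp_le_exp, ← Finset.mul_sum, mul_sub]
    have h3 : (∑ ε, F i ε) / 2 ^ m ≤ μ i := by
      rw [div_le_iff₀ (by positivity)]; linarith [hμ i hi]
    rw [mul_div_assoc (4 * t / σ i)]
    gcongr
  have k2 : ∀ ε, Real.exp (4 * t ^ 2) ≤ ∑ i ∈ G, Real.exp (4 * t / σ i * (F i ε - μ i)) := by
    intro ε
    refine le_trans ?_ (Finset.single_le_sum (f := fun i => Real.exp (4 * t / σ i * (F i ε - μ i)))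
      (fun i _ => (Real.exp_pos _).le) (hg ε))
    rw [Real.exp_le_exp]
    have hs := hσ _ (hg ε)
    rw [div_mul_eq_mul_div, le_div_iff₀ hs]
    nlinarith [hlt ε]
  have k3 : (2 : ℝ) ^ m * Real.exp (4 * t ^ 2) ≤ G.card * (2 ^ m * Real.exp (2 * t ^ 2)) := by
    calc (2 : ℝ) ^ m * Real.exp (4 * t ^ 2) = ∑ ε : Fin m → Bool, Real.exp (4 * t ^ 2) := by simp
      _ ≤ ∑ ε : Fin m → Bool, ∑ i ∈ G, Real.exp (4 * t / σ i * (F i ε - μ i)) :=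
        Finset.sum_le_sum fun ε _ => k2 ε
      _ = ∑ i ∈ G, ∑ ε : Fin m → Bool, Real.exp (4 * t / σ i * (F i ε - μ i)) := Finset.sum_comm
      _ ≤ ∑ i ∈ G, (2 ^ m * Real.exp (2 * t ^ 2)) := Finset.sum_le_sum key
      _ = _ := by simp
  have k4 : Real.exp (4 * t ^ 2) = Real.exp (2 * t ^ 2) * Real.exp (2 * t ^ 2) := by
    rw [← Real.exp_add]; ring_nf
  rw [k4] at k3
  have : (G.card : ℝ) * (2 ^ m * Real.exp (2 * t ^ 2)) <
      Real.exp (2 * t ^ 2) * (2 ^ m * Real.exp (2 * t ^ 2)) := by gcongr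
  linarith

/-- The sum of a function over the cube is unchanged by flipping one coordinate. -/
lemma sum_flip {m : ℕ} (f : (Fin m → Bool) → ℝ) (j : Fin m) :
    ∑ ε, f (Function.update ε j (!ε j)) = ∑ ε, f ε := by
  refine Fintype.sum_bijective (fun ε : Fin m → Bool => Function.update ε j (!ε j)) ?_ _ _
    (fun _ => rfl)
  refine Function.Involutive.bijective fun ε => ?_
  simp

lemma four_mul_sum_pair {m : ℕ} (W : Bool → Bool → ℝ) {j k : Fin m} (hjk : j ≠ k) :
    4 * ∑ ε : Fin m → Bool, W (ε j) (ε k) = 2 ^ m * ∑ e, ∑ e', W e e' := by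
  have h1 := sum_flip (fun ε : Fin m → Bool => W (ε j) (ε k)) j
  have h2 := sum_flip (fun ε : Fin m → Bool => W (ε j) (ε k)) k
  have h3 := sum_flip (fun ε : Fin m → Bool => W (ε j) (!ε k)) j
  simp only [Function.update_self, Function.update_of_ne hjk, Function.update_of_ne hjk.symm]
    at h1 h2 h3
  have h4 : ∀ ε : Fin m → Bool, W (ε j) (ε k) + W (!ε j) (ε k) + W (ε j) (!ε k) + W (!ε j) (!ε k)
      = ∑ e, ∑ e', W e e' := by
    intro ε
    simp only [Fintype.sum_bool]
    cases ε j <;> cases ε k <;> simp <;> ring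
  have h5 : ∑ ε : Fin m → Bool, (W (ε j) (ε k) + W (!ε j) (ε k) + W (ε j) (!ε k) + W (!ε j) (!ε k))
      = 2 ^ m * ∑ e, ∑ e', W e e' := by
    simp_rw [h4]; simp; ring
  simp only [Finset.sum_add_distrib] at h5
  linarith

/-- The off-diagonal part of a bilinear form evaluated at a choice of signs. -/
noncomputable def offDiagForm {m : ℕ} (W : Fin m → Fin m → Bool → Bool → ℝ) (ε : Fin m → Bool) : ℝ :=
  ∑ j, ∑ k, if j = k then 0 else W j k (ε j) (ε k)

lemma offDiagForm_mean {m : ℕ} (W : Fin m → Fin m → Bool → Bool → ℝ) (h0 : ∀ j k e e', 0 ≤ W j k e e') :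
    ∑ ε, offDiagForm W ε ≤ 2 ^ m * ((∑ j, ∑ k, ∑ e, ∑ e', W j k e e') / 4) := by
  unfold offDiagForm
  rw [Finset.sum_comm, Finset.sum_div, Finset.mul_sum]
  refine Finset.sum_le_sum fun j _ => ?_
  rw [Finset.sum_comm, Finset.sum_div, Finset.mul_sum]
  refine Finset.sum_le_sum fun k _ => ?_
  split_ifs with hjk
  · simp only [Finset.sum_const_zero]
    have : 0 ≤ ∑ e, ∑ e', W j k e e' :=
      Finset.sum_nonneg fun e _ => Finset.sum_nonneg fun e' _ => h0 j k e e'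
    positivity
  · have := four_mul_sum_pair (W j k) hjk
    linarith

lemma offDiagForm_diff {m : ℕ} (W : Fin m → Fin m → Bool → Bool → ℝ) (h0 : ∀ j k e e', 0 ≤ W j k e e')
    (i : Fin m) (ε : Fin m → Bool) :
    |offDiagForm W (Function.update ε i true) - offDiagForm W (Function.update ε i false)| ≤
      ∑ k, ((∑ e, ∑ e', W i k e e') + ∑ e, ∑ e', W k i e e') := by
  have hle : ∀ j k e e', W j k e e' ≤ ∑ e, ∑ e', W j k e e' := fun j k e e' =>
    (Finset.single_le_sum (f := fun e' => W j k e e') (fun e' _ => h0 j k e e')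
      (Finset.mem_univ e')).trans
    (Finset.single_le_sum (f := fun e => ∑ e', W j k e e')
      (fun e _ => Finset.sum_nonneg fun e' _ => h0 j k e e') (Finset.mem_univ e))
  set w : Fin m → Fin m → ℝ := fun j k => ∑ e, ∑ e', W j k e e'
  have hw : ∀ j k, 0 ≤ w j k := fun j k => (h0 j k true true).trans (hle j k true true)
  have hterm : ∀ j k, |(if j = k then 0 else W j k (Function.update ε i true j)
      (Function.update ε i true k)) - (if j = k then 0 else W j k (Function.update ε i false j)
      (Function.update ε i false k))| ≤
      (if j = i then w i k else 0) + (if k = i then w j i else 0) := by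
    intro j k
    have habs : ∀ e1 e2 e3 e4, |W j k e1 e2 - W j k e3 e4| ≤ w j k := fun e1 e2 e3 e4 =>
      abs_sub_le_of_nonneg_of_le (h0 _ _ _ _) (hle _ _ _ _) (h0 _ _ _ _) (hle _ _ _ _)
    by_cases hj : j = i
    · subst hj
      by_cases hk : k = j
      · subst hk; simp; linarith [hw k k]
      · simp only [Ne.symm hk, hk, if_false, if_true, add_zero]
        exact habs _ _ _ _
    · by_cases hk : k = i
      · subst hk
        simp only [hj, if_false, if_true, zero_add]
        exact habs _ _ _ _
      · simp [hj, hk]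
  unfold offDiagForm
  rw [← Finset.sum_sub_distrib]
  simp only [← Finset.sum_sub_distrib]
  calc _ ≤ ∑ j, ∑ k, ((if j = i then w i k else 0) + (if k = i then w j i else 0)) :=
        (Finset.abs_sum_le_sum_abs _ _).trans (Finset.sum_le_sum fun j _ =>
          (Finset.abs_sum_le_sum_abs _ _).trans (Finset.sum_le_sum fun k _ => hterm j k))
    _ = _ := by
      simp only [Finset.sum_add_distrib]
      congr 1
      · rw [Finset.sum_comm]; simp [w]
      · simp [w]

/-- The `i`-th dyadic interval of length `2⁻ⁿ` to the right of `1`. -/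
def cell (n i : ℕ) : Set ℝ := Ico (1 + (i : ℝ) / 2 ^ n) (1 + ((i : ℝ) + 1) / 2 ^ n)

/-- The indicator function of a dyadic interval. -/
noncomputable def cellInd (n i : ℕ) : ℝ → ℝ := (cell n i).indicator 1

lemma cellInd_nonneg (n i : ℕ) (y : ℝ) : 0 ≤ cellInd n i y :=
  indicator_nonneg (fun _ _ => zero_le_one) y

lemma cellInd_le_one (n i : ℕ) (y : ℝ) : cellInd n i y ≤ 1 :=
  indicator_le' (fun _ _ => le_rfl) (fun _ _ => zero_le_one) y

lemma measurable_cellInd (n i : ℕ) : Measurable (cellInd n i) :=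
  measurable_one.indicator measurableSet_Ico

lemma mem_cell_iff {n i : ℕ} {y : ℝ} : y ∈ cell n i ↔ (i : ℝ) ≤ (y - 1) * 2 ^ n ∧ (y - 1) * 2 ^ n < i + 1 := by
  have h : (0 : ℝ) < 2 ^ n := by positivity
  unfold cell
  rw [mem_Ico, ← le_sub_iff_add_le', ← sub_lt_iff_lt_add', div_le_iff₀ h, lt_div_iff₀ h]

lemma cell_unique {n i j : ℕ} {y : ℝ} (hi : y ∈ cell n i) (hj : y ∈ cell n j) : i = j := by
  rw [mem_cell_iff] at hi hj
  have h1 : i < j + 1 := by exact_mod_cast hi.1.trans_lt hj.2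
  have h2 : j < i + 1 := by exact_mod_cast hj.1.trans_lt hi.2
  omega

lemma cellInd_of_mem {n i : ℕ} {y : ℝ} (h : y ∈ cell n i) : cellInd n i y = 1 := by
  simp [cellInd, h]

lemma cellInd_of_notMem {n i : ℕ} {y : ℝ} (h : y ∉ cell n i) : cellInd n i y = 0 := by
  simp [cellInd, h]

lemma cellInd_split (n i : ℕ) (y : ℝ) :
    cellInd n i y = cellInd (n + 1) (2 * i) y + cellInd (n + 1) (2 * i + 1) y := by
  have hm : ∀ k, (y ∈ cell (n + 1) k ↔ (k : ℝ) ≤ 2 * ((y - 1) * 2 ^ n) ∧ 2 * ((y - 1) * 2 ^ n) < k + 1) := by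
    intro k; rw [mem_cell_iff, pow_succ]; ring_nf
  by_cases h : y ∈ cell n i
  · have h' := mem_cell_iff.1 h
    by_cases h2 : 2 * ((y - 1) * 2 ^ n) < 2 * i + 1
    · have h3 : y ∈ cell (n + 1) (2 * i) := by
        rw [hm]; push_cast; constructor <;> linarith
      have h4 : y ∉ cell (n + 1) (2 * i + 1) := by
        rw [hm]; push_cast; intro h; linarith
      rw [cellInd_of_mem h, cellInd_of_mem h3, cellInd_of_notMem h4, add_zero]
    · have h3 : y ∈ cell (n + 1) (2 * i + 1) := by
        rw [hm]; push_cast; constructor <;> linarith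
      have h4 : y ∉ cell (n + 1) (2 * i) := by
        rw [hm]; push_cast; intro h; linarith
      rw [cellInd_of_mem h, cellInd_of_mem h3, cellInd_of_notMem h4, zero_add]
  · have h3 : y ∉ cell (n + 1) (2 * i + 1) := by
      rw [hm]; push_cast; rintro ⟨h5, h6⟩; exact h (mem_cell_iff.2 ⟨by linarith, by linarith⟩)
    have h4 : y ∉ cell (n + 1) (2 * i) := by
      rw [hm]; push_cast; rintro ⟨h5, h6⟩; exact h (mem_cell_iff.2 ⟨by linarith, by linarith⟩)
    rw [cellInd_of_notMem h, cellInd_of_notMem h3, cellInd_of_notMem h4, add_zero]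

lemma sum_cellInd_le_one {ι : Type*} (s : Finset ι) (n : ℕ) {x : ι → ℕ} (hx : InjOn x s) (y : ℝ) :
    ∑ j ∈ s, cellInd n (x j) y ≤ 1 := by
  by_cases h : ∃ j ∈ s, y ∈ cell n (x j)
  · obtain ⟨j, hj, hy⟩ := h
    rw [Finset.sum_eq_single_of_mem j hj]
    · exact cellInd_le_one _ _ _
    · intro k hk hkj
      exact cellInd_of_notMem fun hk' => hkj (hx hk hj (cell_unique hk' hy))
  · push Not at h
    rw [Finset.sum_eq_zero fun j hj => cellInd_of_notMem (h j hj)]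
    exact zero_le_one

lemma integrable_cellInd (n i : ℕ) : Integrable (cellInd n i) := by
  unfold cellInd cell
  rw [integrable_indicator_iff measurableSet_Ico]
  exact integrableOn_const (C := (1 : ℝ)) (by simp)

lemma integral_cellInd (n i : ℕ) : ∫ y, cellInd n i y = 1 / 2 ^ n := by
  unfold cellInd cell
  rw [integral_indicator_one measurableSet_Ico, Real.volume_real_Ico_of_le]
  · ring
  · gcongr; linarith

/-- The length of the set of points of the `i`-th dyadic interval that the affine map
`y ↦ a y + b` sends into the `i'`-th one. -/
noncomputable def corr (n i i' : ℕ) (a b : ℝ) : ℝ := ∫ y, cellInd n i y * cellInd n i' (a * y + b)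

lemma integrable_corr (n i n' i' : ℕ) (a b : ℝ) :
    Integrable (fun y => cellInd n i y * cellInd n' i' (a * y + b)) := by
  refine (integrable_cellInd n i).mono' ?_ (ae_of_all _ fun y => ?_)
  · exact ((measurable_cellInd n i).mul
      ((measurable_cellInd n' i').comp (by fun_prop))).aestronglyMeasurable
  · rw [Real.norm_of_nonneg (mul_nonneg (cellInd_nonneg _ _ _) (cellInd_nonneg _ _ _))]
    exact mul_le_of_le_one_right (cellInd_nonneg _ _ _) (cellInd_le_one _ _ _)

lemma corr_nonneg (n i i' : ℕ) (a b : ℝ) : 0 ≤ corr n i i' a b :=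
  integral_nonneg fun _ => mul_nonneg (cellInd_nonneg _ _ _) (cellInd_nonneg _ _ _)

lemma corr_split (n i i' : ℕ) (a b : ℝ) :
    corr n i i' a b = (corr (n + 1) (2 * i + 1) (2 * i' + 1) a b + corr (n + 1) (2 * i + 1) (2 * i') a b)
      + (corr (n + 1) (2 * i) (2 * i' + 1) a b + corr (n + 1) (2 * i) (2 * i') a b) := by
  unfold corr
  rw [← integral_add (integrable_corr ..) (integrable_corr ..),
    ← integral_add (integrable_corr ..) (integrable_corr ..),
    ← integral_add (by exact (integrable_corr ..).add (integrable_corr ..))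
      (by exact (integrable_corr ..).add (integrable_corr ..))]
  congr 1; ext y
  rw [cellInd_split n i, cellInd_split n i']
  ring

lemma sum_corr_right_le {ι : Type*} (s : Finset ι) (n i : ℕ) {x : ι → ℕ} (hx : InjOn x s) (a b : ℝ) :
    ∑ k ∈ s, corr n i (x k) a b ≤ 1 / 2 ^ n := by
  unfold corr
  rw [← integral_finsetSum _ fun k _ => integrable_corr .., ← integral_cellInd n i]
  refine integral_mono (integrable_finsetSum _ fun k _ => integrable_corr ..)
    (integrable_cellInd n i) fun y => ?_
  simp only [← Finset.mul_sum]
  exact mul_le_of_le_one_right (cellInd_nonneg _ _ _) (sum_cellInd_le_one s n hx _)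

lemma sum_corr_left_le {ι : Type*} (s : Finset ι) (n i : ℕ) {x : ι → ℕ} (hx : InjOn x s) {a : ℝ}
    (ha : 1 / 2 ≤ a) (b : ℝ) :
    ∑ k ∈ s, corr n (x k) i a b ≤ 2 / 2 ^ n := by
  have ha0 : a ≠ 0 := by intro h; norm_num [h] at ha
  have hint : Integrable fun y => cellInd n i (a * y + b) :=
    ((integrable_cellInd n i).comp_add_right b).comp_mul_left' ha0
  have hval : ∫ y, cellInd n i (a * y + b) ≤ 2 / 2 ^ n := by
    rw [Measure.integral_comp_mul_left (fun z => cellInd n i (z + b)),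
      integral_add_right_eq_self (cellInd n i), integral_cellInd, abs_of_pos (by positivity), smul_eq_mul,
      ← mul_one_div 2]
    gcongr
    rw [inv_le_comm₀ (by positivity) (by positivity)]; linarith
  refine le_trans ?_ hval
  unfold corr
  rw [← integral_finsetSum _ fun k _ => integrable_corr ..]
  refine integral_mono (integrable_finsetSum _ fun k _ => integrable_corr ..) hint fun y => ?_
  simp only [← Finset.sum_mul]
  exact mul_le_of_le_one_left (cellInd_nonneg _ _ _) (sum_cellInd_le_one s n hx _)

lemma corr_eq_max (n i i' : ℕ) {a : ℝ} (ha : 0 < a) (b : ℝ) :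
    corr n i i' a b = max 0 (min (1 + ((i : ℝ) + 1) / 2 ^ n) ((1 + ((i' : ℝ) + 1) / 2 ^ n - b) / a) -
      max (1 + (i : ℝ) / 2 ^ n) ((1 + (i' : ℝ) / 2 ^ n - b) / a)) := by
  have : ∀ y, cellInd n i y * cellInd n i' (a * y + b) =
      (Ico (1 + (i : ℝ) / 2 ^ n) (1 + ((i : ℝ) + 1) / 2 ^ n) ∩
        Ico ((1 + (i' : ℝ) / 2 ^ n - b) / a) ((1 + ((i' : ℝ) + 1) / 2 ^ n - b) / a)).indicator 1 y := by
    intro y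
    rw [inter_indicator_one, Pi.mul_apply]
    congr 1
    unfold cellInd cell
    simp only [indicator, mem_Ico, div_le_iff₀ ha, lt_div_iff₀ ha, sub_le_iff_le_add, lt_sub_iff_add_lt,
      mul_comm a y, Pi.one_apply]
  unfold corr
  simp_rw [this]
  rw [integral_indicator_one (measurableSet_Ico.inter measurableSet_Ico), Ico_inter_Ico, Real.volume_real_Ico,
    max_comm]

lemma abs_corr_sub_le {n i i' : ℕ} (hi' : i' < 2 ^ n) {a b a' b' δ : ℝ} (ha : 1 / 2 ≤ a)
    (ha' : 1 / 2 ≤ a') (hb : |b| ≤ 4) (hδa : |a - a'| ≤ δ) (hδb : |b - b'| ≤ δ) :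
    |corr n i i' a b - corr n i i' a' b'| ≤ 52 * δ := by
  have hn : (0 : ℝ) < 2 ^ n := by positivity
  have key : ∀ q : ℝ, 1 ≤ q → q ≤ 2 → |(q - b) / a - (q - b') / a'| ≤ 26 * δ := by
    intro q hq1 hq2
    have e : (q - b) / a - (q - b') / a' = ((a' - a) * ((q - b) / a) + (b' - b)) / a' := by
      have : a ≠ 0 := by positivity
      have : a' ≠ 0 := by positivity
      field_simp; ring
    have hδ : 0 ≤ δ := (abs_nonneg _).trans hδa
    rw [e, abs_div, abs_of_pos (by positivity : 0 < a'), div_le_iff₀ (by positivity)]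
    have h1 : |(q - b) / a| ≤ 12 := by
      rw [abs_div, abs_of_pos (by positivity : 0 < a), div_le_iff₀ (by positivity)]
      have := abs_le.1 hb
      have : |q - b| ≤ 6 := abs_le.2 ⟨by linarith, by linarith⟩
      linarith
    calc |(a' - a) * ((q - b) / a) + (b' - b)| ≤ |a' - a| * |(q - b) / a| + |b' - b| := by
          rw [← abs_mul]; exact abs_add_le _ _
      _ ≤ δ * 12 + δ := by rw [abs_sub_comm a' a, abs_sub_comm b' b]; gcongr
      _ ≤ 26 * δ * a' := by nlinarith
  have hi'' : (i' : ℝ) + 1 ≤ 2 ^ n := by exact_mod_cast hi'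
  have hq0 : (i' : ℝ) / 2 ^ n ≤ 1 := by rw [div_le_one hn]; linarith
  have hq1 : ((i' : ℝ) + 1) / 2 ^ n ≤ 1 := by rw [div_le_one hn]; linarith
  have k1 := key (1 + (i' : ℝ) / 2 ^ n) (by simp; positivity) (by linarith)
  have k2 := key (1 + ((i' : ℝ) + 1) / 2 ^ n) (by simp; positivity) (by linarith)
  rw [corr_eq_max _ _ _ (by linarith), corr_eq_max _ _ _ (by linarith)]
  refine (abs_max_sub_max_le_max _ _ _ _).trans (max_le (by simp; linarith [(abs_nonneg _).trans hδa]) ?_)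
  rw [sub_sub_sub_comm]
  refine (abs_sub _ _).trans ?_
  have m1 := abs_min_sub_min_le_max (1 + ((i : ℝ) + 1) / 2 ^ n) ((1 + ((i' : ℝ) + 1) / 2 ^ n - b) / a)
    (1 + ((i : ℝ) + 1) / 2 ^ n) ((1 + ((i' : ℝ) + 1) / 2 ^ n - b') / a')
  have m2 := abs_max_sub_max_le_max (1 + (i : ℝ) / 2 ^ n) ((1 + (i' : ℝ) / 2 ^ n - b) / a)
    (1 + (i : ℝ) / 2 ^ n) ((1 + (i' : ℝ) / 2 ^ n - b') / a')
  rw [sub_self, abs_zero, max_eq_right (a := (0 : ℝ)) (abs_nonneg _)] at m1 m2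
  linarith

lemma corr_self_eq_zero {n i : ℕ} {a b : ℝ} (h : ∀ y ∈ cell n i, 1 / 2 ^ n < |(a - 1) * y + b|) :
    corr n i i a b = 0 := by
  unfold corr
  rw [← integral_zero ℝ ℝ]
  congr 1; ext y
  by_cases hy : y ∈ cell n i
  · by_cases hy' : a * y + b ∈ cell n i
    · exfalso
      have h1 := h y hy
      rw [cell, mem_Ico, add_div] at hy hy'
      refine absurd h1 (not_lt.2 (abs_le.2 ⟨by linarith, by linarith⟩))
    · simp [cellInd_of_notMem hy']
  · simp [cellInd_of_notMem hy]

/-- The number of dyadic intervals of length `2⁻ⁿ` in the construction. -/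
noncomputable def numCells (s : ℝ) (n : ℕ) : ℕ := 2 ^ ⌊(n : ℝ) * s⌋₊

lemma numCells_pos (s : ℝ) (n : ℕ) : 0 < numCells s n := by unfold numCells; positivity

lemma numCells_le {s : ℝ} (hs : 0 ≤ s) (n : ℕ) : (numCells s n : ℝ) ≤ 2 ^ ((n : ℝ) * s) := by
  unfold numCells
  push_cast
  rw [← Real.rpow_natCast]
  exact Real.rpow_le_rpow_of_exponent_le one_le_two (Nat.floor_le (by positivity))

lemma le_two_mul_numCells (s : ℝ) (n : ℕ) : (2 : ℝ) ^ ((n : ℝ) * s) ≤ 2 * numCells s n := by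
  unfold numCells
  push_cast
  rw [← pow_succ', ← Real.rpow_natCast]
  refine Real.rpow_le_rpow_of_exponent_le one_le_two ?_
  push_cast
  exact (Nat.lt_floor_add_one _).le

lemma numCells_le_two_pow {s : ℝ} (hs : 0 ≤ s) (hs1 : s ≤ 1) (n : ℕ) : (numCells s n : ℝ) ≤ 2 ^ n := by
  refine (numCells_le hs n).trans ?_
  rw [← Real.rpow_natCast]
  exact Real.rpow_le_rpow_of_exponent_le one_le_two (mul_le_of_le_one_right (by positivity) hs1)

/-- The combinatorial properties of the enumeration `x` of the dyadic intervals of length `2⁻ⁿ`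
in the construction. -/
structure IsStage (s : ℝ) (n : ℕ) (x : ℕ → ℕ) : Prop where
  lt : ∀ j < numCells s n, x j < 2 ^ n
  inj : ∀ j < numCells s n, ∀ k < numCells s n, x j = x k → j = k
  reg : ∀ k ≤ n, ∀ i, numCells s k * ((Finset.range (numCells s n)).filter
    fun j => x j / 2 ^ (n - k) = i).card ≤ numCells s n

lemma card_near_fixed_point_le {s : ℝ} (hs : 0 ≤ s) (hs1 : s ≤ 1) {n : ℕ} {x : ℕ → ℕ}
    (hx : IsStage s n x) {a b : ℝ} (hb0 : b ≠ 0) (hb : |b| ≤ 4) (J : Finset ℕ)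
    (hJ : J ⊆ Finset.range (numCells s n))
    (hJ' : ∀ j ∈ J, ∃ y ∈ cell n (x j), |(a - 1) * y + b| ≤ 1 / 2 ^ n) :
    (J.card : ℝ) * |b| ^ s ≤ 96 := by
  have hbp : 0 < |b| := abs_pos.2 hb0
  have hn : (0 : ℝ) < 2 ^ n := by positivity
  obtain ⟨q, hq1, hq2⟩ := exists_nat_pow_near (x := 8 / |b|) (y := 2)
    (by rw [le_div_iff₀ hbp]; linarith) one_lt_two
  have hq3 : (2 : ℝ) ^ (q + 1) * |b| ≤ 16 := by
    rw [le_div_iff₀ hbp] at hq1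
    rw [pow_succ]; linarith
  have hpow : ((2 : ℝ) ^ (((q + 1 : ℕ) : ℝ) * s)) * |b| ^ s ≤ 16 := by
    rw [Real.rpow_mul zero_le_two, Real.rpow_natCast, ← Real.mul_rpow (by positivity) hbp.le]
    calc ((2 : ℝ) ^ (q + 1) * |b|) ^ s ≤ 16 ^ s := Real.rpow_le_rpow (by positivity) hq3 hs
      _ ≤ 16 ^ (1 : ℝ) := Real.rpow_le_rpow_of_exponent_le (by norm_num) hs1
      _ = 16 := Real.rpow_one _
  have hbs : 0 ≤ |b| ^ s := by positivity
  rcases le_or_gt (q + 1) n with hqn | hqn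
  · rcases J.eq_empty_or_nonempty with rfl | ⟨j0, hj0⟩
    · simp
    obtain ⟨y0, hy0, hy0'⟩ := hJ' j0 hj0
    have hcell : ∀ j ∈ J, ∀ y ∈ cell n (x j), 1 ≤ y ∧ y ≤ 2 := by
      intro j hj y hy
      have h1 := hx.lt j (Finset.mem_range.1 (hJ hj))
      have h2 : (x j : ℝ) + 1 ≤ 2 ^ n := by exact_mod_cast h1
      rw [cell, mem_Ico] at hy
      have h3 : ((x j : ℝ) + 1) / 2 ^ n ≤ 1 := by rwa [div_le_one hn]
      have h4 : 0 ≤ (x j : ℝ) / 2 ^ n := by positivity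
      constructor <;> linarith
    have hdist : ∀ j ∈ J, ∀ y ∈ cell n (x j), |(a - 1) * y + b| ≤ 1 / 2 ^ n →
        |y - y0| * 2 ^ n < 2 ^ (q + 1) := by
      intro j hj y hy hy'
      refine lt_of_le_of_lt ?_ hq2
      rw [le_div_iff₀ hbp]
      have b1 := hcell j hj y hy
      have b0 := hcell j0 hj0 y0 hy0
      rw [le_div_iff₀ hn] at hy' hy0'
      rcases le_or_gt (|b| / 4) |a - 1| with hcase | hcase
      · have : |a - 1| * |y - y0| * 2 ^ n ≤ 2 := by
          rw [← abs_mul]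
          have : (a - 1) * (y - y0) = ((a - 1) * y + b) - ((a - 1) * y0 + b) := by ring
          rw [this]
          have := abs_sub ((a - 1) * y + b) ((a - 1) * y0 + b)
          nlinarith
        have h0 : 0 ≤ |y - y0| * 2 ^ n := by positivity
        nlinarith
      · have h1 : |b| ≤ |(a - 1) * y + b| + |a - 1| * |y| := by
          rw [← abs_mul]
          calc |b| = |((a - 1) * y + b) - (a - 1) * y| := by ring_nf
            _ ≤ _ := abs_sub _ _
        rw [abs_of_nonneg (by linarith : 0 ≤ y)] at h1
        have h2 : |b| / 2 ≤ |(a - 1) * y + b| := by nlinarith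
        have h3 : |y - y0| ≤ 1 := abs_le.2 ⟨by linarith, by linarith⟩
        have h4 : |b| * 2 ^ n ≤ 2 := by nlinarith
        have h5 : |y - y0| * (|b| * 2 ^ n) ≤ 1 * 2 := by gcongr
        linarith
    set k := n - (q + 1) with hk
    have hnk : n - k = q + 1 := by omega
    set i0 := x j0 / 2 ^ (q + 1) with hi0
    have himg : ∀ j ∈ J, x j / 2 ^ (q + 1) ∈ Finset.Icc (i0 - 1) (i0 + 1) := by
      intro j hj
      obtain ⟨y, hy, hy'⟩ := hJ' j hj
      have hd := hdist j hj y hy hy'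
      rw [← abs_of_pos hn, ← abs_mul, abs_lt] at hd
      rw [mem_cell_iff] at hy hy0
      have l1 : (x j : ℝ) < x j0 + 2 ^ (q + 1) + 1 := by nlinarith
      have l2 : (x j0 : ℝ) < x j + 2 ^ (q + 1) + 1 := by nlinarith
      have l1' : x j ≤ x j0 + 2 ^ (q + 1) := by
        have : x j < x j0 + 2 ^ (q + 1) + 1 := by exact_mod_cast l1
        omega
      have l2' : x j0 ≤ x j + 2 ^ (q + 1) := by
        have : x j0 < x j + 2 ^ (q + 1) + 1 := by exact_mod_cast l2
        omega
      have p : 0 < 2 ^ (q + 1) := by positivity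
      have d1 := Nat.div_le_div_right (c := 2 ^ (q + 1)) l1'
      have d2 := Nat.div_le_div_right (c := 2 ^ (q + 1)) l2'
      rw [Nat.add_div_right _ p] at d1 d2
      rw [Finset.mem_Icc]
      generalize x j / 2 ^ (q + 1) = u at d1 d2 ⊢
      generalize x j0 / 2 ^ (q + 1) = v at d1 d2 hi0
      omega
    have hfib : numCells s k * J.card ≤ 3 * numCells s n := by
      have h1 := Finset.card_eq_sum_card_fiberwise (f := fun j => x j / 2 ^ (q + 1)) (s := J)
        (t := Finset.Icc (i0 - 1) (i0 + 1)) himg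
      rw [h1, Finset.mul_sum]
      calc _ ≤ ∑ i ∈ Finset.Icc (i0 - 1) (i0 + 1), numCells s n := by
            refine Finset.sum_le_sum fun i _ => ?_
            refine le_trans ?_ (hx.reg k (by omega) i)
            rw [hnk]
            gcongr
        _ ≤ 3 * numCells s n := by
            rw [Finset.sum_const, smul_eq_mul, Nat.card_Icc]
            gcongr
            omega
    have hfib' : (numCells s k : ℝ) * J.card ≤ 3 * numCells s n := by exact_mod_cast hfib
    have hexp : (2 : ℝ) ^ ((n : ℝ) * s) = 2 ^ ((k : ℝ) * s) * 2 ^ (((q + 1 : ℕ) : ℝ) * s) := by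
      rw [← Real.rpow_add two_pos, ← add_mul]
      congr 2
      have : n = k + (q + 1) := by omega
      exact_mod_cast this
    have h1 := le_two_mul_numCells s k
    have h2 := numCells_le hs n
    have hkp : (0 : ℝ) < numCells s k := by exact_mod_cast numCells_pos s k
    have h3 : (J.card : ℝ) ≤ 6 * 2 ^ (((q + 1 : ℕ) : ℝ) * s) := by
      have : (numCells s k : ℝ) * J.card ≤ numCells s k * (6 * 2 ^ (((q + 1 : ℕ) : ℝ) * s)) := by
        calc (numCells s k : ℝ) * J.card ≤ 3 * numCells s n := hfib'
          _ ≤ 3 * (2 ^ ((k : ℝ) * s) * 2 ^ (((q + 1 : ℕ) : ℝ) * s)) := by rw [← hexp]; gcongr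
          _ ≤ 3 * ((2 * numCells s k) * 2 ^ (((q + 1 : ℕ) : ℝ) * s)) := by gcongr
          _ = _ := by ring
      exact le_of_mul_le_mul_left this hkp
    nlinarith
  · have h1 : (J.card : ℝ) ≤ numCells s n := by
      exact_mod_cast (Finset.card_le_card hJ).trans (by simp)
    have h2 := numCells_le hs n
    have h3 : (2 : ℝ) ^ ((n : ℝ) * s) ≤ 2 ^ (((q + 1 : ℕ) : ℝ) * s) := by
      refine Real.rpow_le_rpow_of_exponent_le one_le_two ?_
      gcongr
    nlinarith

/-- The correlation of the uniform density on the intervals enumerated by `x` with its image under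
an affine map. -/
noncomputable def stageCorr (n P : ℕ) (x : ℕ → ℕ) (a b : ℝ) : ℝ :=
  (2 ^ n / P) ^ 2 * ∑ j : Fin P, ∑ k : Fin P, corr n (x j) (x k) a b

lemma abs_stageCorr_sub_le {n P : ℕ} (hP : 0 < P) {x : ℕ → ℕ} (hx : ∀ j < P, x j < 2 ^ n) {a b a' b' δ : ℝ}
    (ha : 1 / 2 ≤ a) (ha' : 1 / 2 ≤ a') (hb : |b| ≤ 4) (hδa : |a - a'| ≤ δ) (hδb : |b - b'| ≤ δ) :
    |stageCorr n P x a b - stageCorr n P x a' b'| ≤ 4 ^ n * (52 * δ) := by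
  have hP' : (0 : ℝ) < P := by exact_mod_cast hP
  unfold stageCorr
  rw [← mul_sub, ← Finset.sum_sub_distrib, abs_mul, abs_of_nonneg (by positivity)]
  simp only [← Finset.sum_sub_distrib]
  calc _ ≤ (2 ^ n / (P : ℝ)) ^ 2 * ∑ j : Fin P, ∑ k : Fin P, 52 * δ := by
        gcongr
        refine (Finset.abs_sum_le_sum_abs _ _).trans (Finset.sum_le_sum fun j _ =>
          (Finset.abs_sum_le_sum_abs _ _).trans (Finset.sum_le_sum fun k _ => ?_))
        exact abs_corr_sub_le (hx k k.2) ha ha' hb hδa hδb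
    _ = _ := by
        simp only [Finset.sum_const, Finset.card_univ, Fintype.card_fin, nsmul_eq_mul]
        rw [show (4 : ℝ) = 2 ^ 2 by norm_num, ← pow_mul, mul_comm 2 n, pow_mul]
        field_simp

lemma injOn_comp_val {P : ℕ} {x : ℕ → ℕ} (hx : ∀ j < P, ∀ k < P, x j = x k → j = k) :
    InjOn (fun j : Fin P => x j) (Finset.univ : Finset (Fin P)) :=
  fun j _ k _ h => Fin.ext (hx j j.2 k k.2 h)

lemma stageCorr_le {n P : ℕ} (hP : 0 < P) {x : ℕ → ℕ} (hx : ∀ j < P, ∀ k < P, x j = x k → j = k)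
    (a b : ℝ) : stageCorr n P x a b ≤ 2 ^ n := by
  have hP' : (1 : ℝ) ≤ P := by exact_mod_cast hP
  unfold stageCorr
  calc _ ≤ (2 ^ n / (P : ℝ)) ^ 2 * ∑ j : Fin P, (1 / 2 ^ n : ℝ) := by
        gcongr
        exact sum_corr_right_le _ n _ (injOn_comp_val hx) a b
    _ = 2 ^ n / P := by
        simp only [Finset.sum_const, Finset.card_univ, Fintype.card_fin, nsmul_eq_mul]
        field_simp
    _ ≤ 2 ^ n := div_le_self (by positivity) hP'

/-- The enumeration at the next level when the `j`-th interval is replaced with its left half or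
with its right half, according to `e j`. -/
def halve (x : ℕ → ℕ) (e : ℕ → Bool) (j : ℕ) : ℕ := 2 * x j + (e j).toNat

/-- The sign attached to a choice of half. -/
def boolSign (e : Bool) : ℝ := if e then -1 else 1

lemma bilinear_sum_eq {P : ℕ} (W : Fin P → Fin P → Bool → Bool → ℝ) (ε : Fin P → Bool) :
    ∑ j, ∑ k, W j k (ε j) (ε k) = offDiagForm W ε + ∑ j, W j j (ε j) (ε j) := by
  unfold offDiagForm
  rw [← Finset.sum_add_distrib]
  refine Finset.sum_congr rfl fun j _ => ?_
  have h1 : ∀ k, W j k (ε j) (ε k) =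
      (if j = k then 0 else W j k (ε j) (ε k)) + if j = k then W j k (ε j) (ε k) else 0 := by
    intro k; split_ifs <;> simp
  rw [Finset.sum_congr rfl fun k _ => h1 k, Finset.sum_add_distrib]
  simp

/-- The correlations between the halves of the intervals. -/
noncomputable def halfCorr (n P : ℕ) (x : ℕ → ℕ) (a b : ℝ) (j k : Fin P) (e e' : Bool) : ℝ :=
  corr (n + 1) (2 * x j + e.toNat) (2 * x k + e'.toNat) a b

lemma sum_halfCorr {n P : ℕ} {x : ℕ → ℕ} {a b : ℝ} (j k : Fin P) :
    ∑ e, ∑ e', halfCorr n P x a b j k e e' = corr n (x j) (x k) a b := by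
  simp [halfCorr, corr_split n (x j) (x k)]

lemma halfCorr_nonneg (n P : ℕ) (x : ℕ → ℕ) (a b : ℝ) (j k : Fin P) (e e' : Bool) :
    0 ≤ halfCorr n P x a b j k e e' := corr_nonneg ..

lemma halfCorr_le {n P : ℕ} {x : ℕ → ℕ} {a b : ℝ} (j k : Fin P) (e e' : Bool) :
    halfCorr n P x a b j k e e' ≤ corr n (x j) (x k) a b := by
  rw [corr_split]
  have := corr_nonneg (n + 1) (2 * x j + 1) (2 * x k + 1) a b
  have := corr_nonneg (n + 1) (2 * x j) (2 * x k + 1) a b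
  have := corr_nonneg (n + 1) (2 * x j + 1) (2 * x k) a b
  have := corr_nonneg (n + 1) (2 * x j) (2 * x k) a b
  cases e <;> cases e' <;> simp [halfCorr] <;> linarith

lemma sum_corr_diag_le {s : ℝ} (hs : 0 ≤ s) (hs1 : s ≤ 1) {n : ℕ} {x : ℕ → ℕ}
    (hx : IsStage s n x) {a b : ℝ} (hb0 : b ≠ 0) (hb : |b| ≤ 4) :
    (∑ j : Fin (numCells s n), corr n (x j) (x j) a b) * |b| ^ s ≤ 96 / 2 ^ n := by
  classical
  rw [← Finset.sum_range (fun j => corr n (x j) (x j) a b)]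
  set J := (Finset.range (numCells s n)).filter
    (fun j => ∃ y ∈ cell n (x j), |(a - 1) * y + b| ≤ 1 / 2 ^ n) with hJ
  have h1 := card_near_fixed_point_le hs hs1 hx (a := a) hb0 hb J (Finset.filter_subset _ _)
    (fun j hj => (Finset.mem_filter.1 hj).2)
  have h2 : ∑ j ∈ Finset.range (numCells s n), corr n (x j) (x j) a b ≤ J.card * (1 / 2 ^ n) := by
    rw [← nsmul_eq_mul, ← Finset.sum_const, hJ, Finset.sum_filter]
    refine Finset.sum_le_sum fun j _ => ?_
    split_ifs with h
    · simpa using sum_corr_right_le {x j} n (x j) (x := id) (by simp) a b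
    · push Not at h
      rw [corr_self_eq_zero h]
  calc _ ≤ (J.card * (1 / 2 ^ n : ℝ)) * |b| ^ s := by gcongr
    _ = (J.card * |b| ^ s) / 2 ^ n := by ring
    _ ≤ _ := by gcongr

lemma sum_sq_le_of_le {P : ℕ} {c : Fin P → ℝ} {M S : ℝ} (h0 : ∀ i, 0 ≤ c i) (hM : ∀ i, c i ≤ M)
    (hS : ∑ i, c i ≤ S) (hM0 : 0 ≤ M) : ∑ i, c i ^ 2 ≤ M * S := by
  calc ∑ i, c i ^ 2 ≤ ∑ i, M * c i := Finset.sum_le_sum fun i _ => by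
        rw [sq]; exact mul_le_mul_of_nonneg_right (hM i) (h0 i)
    _ = M * ∑ i, c i := by rw [Finset.mul_sum]
    _ ≤ M * S := by gcongr

/-- Bounds on the correlation at a single pair of parameters, from a bound on the off-diagonal
form. -/
lemma stageCorr_halve_le {s : ℝ} (hs : 0 ≤ s) (hs1 : s ≤ 1) {n : ℕ} {x : ℕ → ℕ}
    (hx : IsStage s n x) {a b : ℝ} (hb0 : b ≠ 0) (hb : |b| ≤ 4) {e : ℕ → Bool} {D : ℝ}
    (hD : offDiagForm (halfCorr n (numCells s n) x a b) (fun j => e j) ≤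
      (∑ j : Fin (numCells s n), ∑ k : Fin (numCells s n), corr n (x j) (x k) a b) / 4 +
        D / (4 * (2 ^ n / (numCells s n : ℝ)) ^ 2)) :
    stageCorr (n + 1) (numCells s n) (halve x e) a b * |b| ^ s ≤
      stageCorr n (numCells s n) x a b * |b| ^ s + D * |b| ^ s +
        384 * (2 ^ n / (numCells s n : ℝ) ^ 2) := by
  have hP : (0 : ℝ) < numCells s n := by exact_mod_cast numCells_pos s n
  set P := numCells s n with hPdef
  have h1 : stageCorr (n + 1) P (halve x e) a b = 4 * (2 ^ n / (P : ℝ)) ^ 2 *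
      (offDiagForm (halfCorr n P x a b) (fun j => e j) +
        ∑ j : Fin P, halfCorr n P x a b j j (e j) (e j)) := by
    rw [← bilinear_sum_eq]
    unfold stageCorr halfCorr halve
    rw [pow_succ]; ring
  have h2 : ∑ j : Fin P, halfCorr n P x a b j j (e j) (e j) ≤ ∑ j : Fin P, corr n (x j) (x j) a b :=
    Finset.sum_le_sum fun j _ => halfCorr_le ..
  have h3 := sum_corr_diag_le hs hs1 hx (a := a) hb0 hb
  rw [← hPdef] at h3
  have hbs : 0 ≤ |b| ^ s := by positivity
  set κ : ℝ := (2 ^ n / (P : ℝ)) ^ 2 with hκ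
  have hκp : 0 < κ := by positivity
  rw [h1]
  have h4 : stageCorr n P x a b = κ * ∑ j : Fin P, ∑ k : Fin P, corr n (x j) (x k) a b := rfl
  rw [h4]
  set S := ∑ j : Fin P, ∑ k : Fin P, corr n (x j) (x k) a b
  set T := ∑ j : Fin P, corr n (x j) (x j) a b
  calc _ ≤ 4 * κ * ((S / 4 + D / (4 * κ)) + T) * |b| ^ s := by gcongr
    _ = κ * S * |b| ^ s + D * |b| ^ s + 4 * κ * (T * |b| ^ s) := by field_simp
    _ ≤ κ * S * |b| ^ s + D * |b| ^ s + 4 * κ * (96 / 2 ^ n) := by gcongr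
    _ = _ := by rw [hκ]; field_simp; ring

lemma offDiagForm_halfCorr_sq_le {P n : ℕ} {x : ℕ → ℕ}
    (hx : ∀ j < P, ∀ k < P, x j = x k → j = k) {a b : ℝ} (ha : 1 / 2 ≤ a) :
    ∑ i : Fin P, (∑ k, ((∑ e, ∑ e', halfCorr n P x a b i k e e') +
      ∑ e, ∑ e', halfCorr n P x a b k i e e')) ^ 2 ≤
      3 / 2 ^ n * (2 * ∑ j : Fin P, ∑ k : Fin P, corr n (x j) (x k) a b) := by
  simp only [sum_halfCorr]
  refine sum_sq_le_of_le (fun i => Finset.sum_nonneg fun k _ => add_nonneg (corr_nonneg ..) (corr_nonneg ..))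
    (fun i => ?_) ?_ (by positivity)
  · rw [Finset.sum_add_distrib]
    have h1 := sum_corr_right_le Finset.univ n (x i) (injOn_comp_val hx) a b
    have h2 := sum_corr_left_le Finset.univ n (x i) (injOn_comp_val hx) ha b
    calc _ ≤ 1 / 2 ^ n + 2 / 2 ^ n := add_le_add h1 h2
      _ = (3 / 2 ^ n : ℝ) := by ring
  · simp only [Finset.sum_add_distrib]
    rw [Finset.sum_comm (f := fun (i k : Fin P) => corr n (x k) (x i) a b)]
    linarith

lemma rpow_le_two_mul {s u v : ℝ} (hs : 0 ≤ s) (hs1 : s ≤ 1) (hu : 0 ≤ u) (hv : 0 ≤ v) (h : u ≤ 2 * v) :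
    u ^ s ≤ 2 * v ^ s := by
  calc u ^ s ≤ (2 * v) ^ s := Real.rpow_le_rpow hu h hs
    _ = 2 ^ s * v ^ s := Real.mul_rpow zero_le_two hv
    _ ≤ 2 ^ (1 : ℝ) * v ^ s := by
        gcongr
        exact one_le_two
    _ = _ := by rw [Real.rpow_one]

/-- The trigonometric sums controlling the Fourier transform of the construction. -/
noncomputable def signedSum (P : ℕ) (x : ℕ → ℕ) (ε : Fin P → Bool) (θ φ : ℝ) : ℝ :=
  ∑ j : Fin P, boolSign (ε j) * Real.cos (2 * Real.pi * θ * x j + φ)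

lemma signedSum_diff {P : ℕ} (x : ℕ → ℕ) (θ φ : ℝ) (i : Fin P) (ε : Fin P → Bool) :
    |signedSum P x (Function.update ε i true) θ φ - signedSum P x (Function.update ε i false) θ φ| ≤ 2 := by
  unfold signedSum
  rw [← Finset.sum_sub_distrib, Finset.sum_eq_single i]
  · simp only [Function.update_self, boolSign]
    have := Real.abs_cos_le_one (2 * Real.pi * θ * x i + φ)
    rw [abs_le] at this ⊢
    constructor <;> norm_num <;> linarith
  · intro j _ hj
    simp [Function.update_of_ne hj]
  · simp

lemma sum_signedSum {P : ℕ} (x : ℕ → ℕ) (θ φ : ℝ) : ∑ ε, signedSum P x ε θ φ = 0 := by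
  unfold signedSum
  rw [Finset.sum_comm]
  refine Finset.sum_eq_zero fun j _ => ?_
  rw [← Finset.sum_mul]
  have := sum_flip (fun ε : Fin P → Bool => boolSign (ε j)) j
  simp only [Function.update_self] at this
  have h2 : ∀ ε : Fin P → Bool, boolSign (!ε j) = - boolSign (ε j) := fun ε => by
    cases ε j <;> simp [boolSign]
  simp only [h2, Finset.sum_neg_distrib] at this
  have : ∑ ε : Fin P → Bool, boolSign (ε j) = 0 := by linarith
  rw [this, zero_mul]

lemma abs_boolSign (e : Bool) : |boolSign e| = 1 := by cases e <;> simp [boolSign]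

lemma signedSum_le_of_near {P : ℕ} {x : ℕ → ℕ} {N : ℝ} (hx : ∀ j < P, (x j : ℝ) ≤ N) (ε : Fin P → Bool)
    (θ θ' φ : ℝ) : signedSum P x ε θ φ ≤ signedSum P x ε θ' φ + P * (2 * Real.pi * |θ - θ'| * N) := by
  rw [← sub_le_iff_le_add']
  unfold signedSum
  rw [← Finset.sum_sub_distrib]
  calc _ ≤ ∑ j : Fin P, 2 * Real.pi * |θ - θ'| * N := Finset.sum_le_sum fun j _ => ?_
    _ = _ := by simp
  rw [← mul_sub]
  refine (le_abs_self _).trans ?_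
  rw [abs_mul, abs_boolSign, one_mul]
  refine (Real.abs_cos_sub_cos_le _ _).trans ?_
  rw [show 2 * Real.pi * θ * x j + φ - (2 * Real.pi * θ' * x j + φ) = 2 * Real.pi * (θ - θ') * x j by ring,
    abs_mul, abs_mul, abs_of_pos Real.two_pi_pos, Nat.abs_cast]
  have := hx j j.2
  gcongr

lemma signedSum_fract {P : ℕ} (x : ℕ → ℕ) (ε : Fin P → Bool) (θ φ : ℝ) :
    signedSum P x ε θ φ = signedSum P x ε (Int.fract θ) φ := by
  unfold signedSum
  refine Finset.sum_congr rfl fun j _ => ?_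
  congr 1
  rw [← Real.cos_add_int_mul_two_pi (2 * Real.pi * Int.fract θ * x j + φ) (⌊θ⌋ * x j)]
  congr 1
  nth_rw 1 [← Int.fract_add_floor θ]
  push_cast; ring

lemma exists_grid_near {N : ℕ} (hN : 0 < N) (hN2 : 2 ∣ N) {a b : ℝ} (ha : 1 / 2 ≤ a) (ha2 : a ≤ 2)
    (hb : |b| ≤ 4) (hbN : 2 / (N : ℝ) ≤ |b|) :
    ∃ i ≤ 2 * N, ∃ j ≤ 8 * N, 1 / 2 ≤ (i : ℝ) / N ∧ (i : ℝ) / N ≤ 2 ∧ (j : ℝ) / N - 4 ≠ 0 ∧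
      |(j : ℝ) / N - 4| ≤ 4 ∧ |a - i / N| ≤ 1 / N ∧ |b - ((j : ℝ) / N - 4)| ≤ 1 / N ∧
      |(j : ℝ) / N - 4| ≤ 2 * |b| ∧ |b| ≤ 2 * |(j : ℝ) / N - 4| := by
  have hNr : (0 : ℝ) < N := by exact_mod_cast hN
  obtain ⟨M, rfl⟩ := hN2
  have hb' := abs_le.1 hb
  have near : ∀ u : ℝ, 0 ≤ u → (⌊u * (2 * M : ℕ)⌋₊ : ℝ) / (2 * M : ℕ) ≤ u ∧
      u - 1 / (2 * M : ℕ) ≤ (⌊u * (2 * M : ℕ)⌋₊ : ℝ) / (2 * M : ℕ) := by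
    intro u hu
    have h1 := Nat.floor_le (mul_nonneg hu hNr.le)
    have h2 := Nat.lt_floor_add_one (u * (2 * M : ℕ))
    constructor
    · rwa [div_le_iff₀ hNr]
    · rw [le_div_iff₀ hNr, sub_mul, one_div, inv_mul_cancel₀ hNr.ne']; linarith
  obtain ⟨h1, h2⟩ := near a (by linarith)
  obtain ⟨h3, h4⟩ := near (b + 4) (by linarith)
  have h5 : 1 / 2 ≤ (⌊a * (2 * M : ℕ)⌋₊ : ℝ) / (2 * M : ℕ) := by
    rw [le_div_iff₀ hNr]
    have : M ≤ ⌊a * (2 * M : ℕ)⌋₊ := Nat.le_floor (by push_cast; push_cast at hNr; nlinarith)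
    have : (M : ℝ) ≤ ⌊a * (2 * M : ℕ)⌋₊ := by exact_mod_cast this
    push_cast at this ⊢; linarith
  have h6 : 0 ≤ (⌊(b + 4) * (2 * M : ℕ)⌋₊ : ℝ) / (2 * M : ℕ) := by positivity
  have hup : ∀ (u : ℝ) (K : ℕ), 0 ≤ u → u ≤ K → ⌊u * (2 * M : ℕ)⌋₊ ≤ K * (2 * M) := by
    intro u K h0 hu
    refine Nat.floor_le_of_le ?_
    push_cast
    push_cast at hNr
    exact mul_le_mul_of_nonneg_right hu hNr.le
  refine ⟨⌊a * (2 * M : ℕ)⌋₊, hup a 2 (by linarith) (by exact_mod_cast ha2), ⌊(b + 4) * (2 * M : ℕ)⌋₊,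
    hup (b + 4) 8 (by linarith) (by push_cast; linarith), h5, h1.trans ha2, ?_⟩
  set b' := (⌊(b + 4) * (2 * M : ℕ)⌋₊ : ℝ) / (2 * M : ℕ) - 4
  set a' := (⌊a * (2 * M : ℕ)⌋₊ : ℝ) / (2 * M : ℕ)
  have hd : |b - b'| ≤ 1 / (2 * M : ℕ) := by
    rw [abs_of_nonneg (by linarith)]; linarith
  have hd2 : 1 / ((2 * M : ℕ) : ℝ) ≤ |b| / 2 := by
    rw [show 1 / ((2 * M : ℕ) : ℝ) = 2 / ((2 * M : ℕ) : ℝ) / 2 by ring]; linarith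
  have ht1 := abs_sub_abs_le_abs_sub b b'
  have ht2 := abs_sub_abs_le_abs_sub b' b
  rw [abs_sub_comm b' b] at ht2
  have hpos : 0 < 1 / ((2 * M : ℕ) : ℝ) := by positivity
  refine ⟨?_, ?_, ?_, hd, by linarith, by linarith⟩
  · intro h
    rw [h] at ht1
    simp at ht1
    rw [h] at hd
    simp only [sub_zero] at hd
    linarith
  · rw [abs_le]; constructor <;> linarith
  · rw [abs_of_nonneg (by linarith)]; linarith

lemma stageCorr_le_of_grid {s : ℝ} (hs : 0 ≤ s) (hs1 : s ≤ 1) {n P : ℕ} (hP : 0 < P)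
    {x x' : ℕ → ℕ} (hx : ∀ j < P, x j < 2 ^ n) (hx' : ∀ j < P, x' j < 2 ^ (n + 1))
    {a b a' b' δ B E : ℝ} (ha : 1 / 2 ≤ a) (ha' : 1 / 2 ≤ a') (hb : |b| ≤ 4)
    (hb0 : b' ≠ 0) (hδa : |a - a'| ≤ δ) (hδb : |b - b'| ≤ δ) (hbb : |b| ≤ 2 * |b'|) (hE : 0 ≤ E)
    (h : stageCorr (n + 1) P x' a' b' * |b'| ^ s ≤ stageCorr n P x a' b' * |b'| ^ s + E)
    (hB : stageCorr n P x a b * |b| ^ s ≤ B) :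
    stageCorr (n + 1) P x' a b * |b| ^ s ≤ B + 2 * E + 4 ^ (n + 1) * (416 * δ) := by
  have h1 := (abs_le.1 (abs_stageCorr_sub_le hP hx' ha ha' hb hδa hδb)).2
  have h2 := (abs_le.1 (abs_stageCorr_sub_le hP hx ha ha' hb hδa hδb)).1
  have hδ : 0 ≤ δ := (abs_nonneg _).trans hδa
  have h2' : -((4 : ℝ) ^ (n + 1) * (52 * δ)) ≤ -(4 ^ n * (52 * δ)) := by
    rw [neg_le_neg_iff]
    gcongr
    · norm_num
    · omega
  have hρ : |b| ^ s ≤ 2 * |b'| ^ s := rpow_le_two_mul hs hs1 (abs_nonneg _) (abs_nonneg _) hbb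
  have hb4 : |b| ^ s ≤ 4 := by
    have := rpow_le_two_mul (v := 2) hs hs1 (abs_nonneg _) (by norm_num) (u := |b|) (by linarith)
    have h3 : (2 : ℝ) ^ s ≤ 2 ^ (1 : ℝ) := Real.rpow_le_rpow_of_exponent_le one_le_two hs1
    rw [Real.rpow_one] at h3
    linarith
  have hbp : 0 < |b'| ^ s := Real.rpow_pos_of_pos (abs_pos.2 hb0) s
  have hb0' : 0 ≤ |b| ^ s := by positivity
  have h3 : stageCorr (n + 1) P x' a' b' ≤ stageCorr n P x a' b' + E / |b'| ^ s := by
    rw [← mul_le_mul_iff_left₀ hbp, add_mul, div_mul_cancel₀ _ hbp.ne']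
    exact h
  have h4 : E / |b'| ^ s * |b| ^ s ≤ 2 * E := by
    rw [div_mul_eq_mul_div, div_le_iff₀ hbp]
    nlinarith
  calc _ ≤ (stageCorr n P x a b + E / |b'| ^ s + 2 * (4 ^ (n + 1) * (52 * δ))) * |b| ^ s := by
        gcongr; linarith
    _ = stageCorr n P x a b * |b| ^ s + E / |b'| ^ s * |b| ^ s + 2 * (4 ^ (n + 1) * (52 * δ)) * |b| ^ s := by
        ring
    _ ≤ B + 2 * E + 2 * (4 ^ (n + 1) * (52 * δ)) * 4 := by gcongr
    _ = _ := by ring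

lemma two_pow_div_sq_numCells_le (s : ℝ) (n : ℕ) :
    2 ^ n / (numCells s n : ℝ) ^ 2 ≤ 4 * ((2 : ℝ) ^ (-(n * (s - 1 / 2)))) ^ 2 := by
  have hP : (0 : ℝ) < numCells s n := by exact_mod_cast numCells_pos s n
  rw [div_le_iff₀ (by positivity)]
  have h := le_two_mul_numCells s n
  have h2 : ((2 : ℝ) ^ ((n : ℝ) * s)) ^ 2 ≤ (2 * numCells s n) ^ 2 := by gcongr
  have h3 : (2 : ℝ) ^ n = ((2 : ℝ) ^ (-(n * (s - 1 / 2)))) ^ 2 * ((2 : ℝ) ^ ((n : ℝ) * s)) ^ 2 := by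
    rw [← mul_pow, ← Real.rpow_add two_pos, ← Real.rpow_natCast, ← Real.rpow_natCast, ← Real.rpow_mul two_pos.le]
    congr 1
    push_cast; ring
  rw [h3]
  calc _ ≤ ((2 : ℝ) ^ (-(n * (s - 1 / 2)))) ^ 2 * (2 * numCells s n) ^ 2 := by gcongr
    _ = _ := by ring

lemma deviation_le {n : ℕ} {P q B t w : ℝ} (hP : 0 < P) (hκ : 2 ^ n / P ^ 2 ≤ 4 * q ^ 2) (hq : 0 ≤ q)
    (hB : 1 ≤ B) (ht : 0 ≤ t) (hw : 0 < w) (hw4 : w ≤ 4) :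
    4 * (2 ^ n / P) ^ 2 * (t * √(6 / 2 ^ n * (B / ((2 ^ n / P) ^ 2 * w)))) * w ≤ 40 * t * q * B := by
  have h1 : (2 ^ n / P) ^ 2 * √(6 / 2 ^ n * (B / ((2 ^ n / P) ^ 2 * w))) * w ≤ 10 * q * B := by
    refine le_of_sq_le_sq ?_ (by positivity)
    rw [mul_pow, mul_pow, Real.sq_sqrt (by positivity)]
    calc _ = 6 * (2 ^ n / P ^ 2) * B * w := by field_simp
      _ ≤ 6 * (4 * q ^ 2) * B * 4 := by gcongr
      _ ≤ 6 * (4 * q ^ 2) * (B * B) * 4 := by gcongr; nlinarith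
      _ ≤ _ := by nlinarith [mul_nonneg (sq_nonneg q) (mul_self_nonneg B)]
  calc _ = 4 * t * ((2 ^ n / P) ^ 2 * √(6 / 2 ^ n * (B / ((2 ^ n / P) ^ 2 * w))) * w) := by ring
    _ ≤ 4 * t * (10 * q * B) := by gcongr
    _ = _ := by ring

lemma grid_card_lt {n N : ℕ} (hN : N = 2 ^ (4 * (n + 1) + 6)) :
    (((2 * N + 1) * (8 * N + 1) + N * 4 : ℕ) : ℝ) < Real.exp (2 * (4 * ((n : ℝ) + 1)) ^ 2) := by
  have hN1 : 1 ≤ N := hN ▸ Nat.one_le_two_pow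
  have h1 : (2 * N + 1) * (8 * N + 1) + N * 4 ≤ 2 ^ 5 * N ^ 2 := by nlinarith
  obtain ⟨k, hk⟩ : ∃ k, k = 25 * (n + 1) := ⟨_, rfl⟩
  have h2 : 2 ^ 5 * N ^ 2 ≤ 2 ^ k := by
    rw [hN, ← pow_mul, ← pow_add]
    exact Nat.pow_le_pow_right two_pos (by omega)
  have hk' : (k : ℝ) = 25 * ((n : ℝ) + 1) := by rw [hk]; push_cast; ring
  calc (((2 * N + 1) * (8 * N + 1) + N * 4 : ℕ) : ℝ) ≤ ((2 ^ k : ℕ) : ℝ) := Nat.cast_le.2 (h1.trans h2)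
    _ = 2 ^ k := by push_cast; rfl
    _ ≤ Real.exp 1 ^ k := by
        gcongr
        have := Real.add_one_le_exp 1; linarith
    _ = Real.exp k := Real.exp_one_pow k
    _ < _ := by
        rw [Real.exp_lt_exp, hk']
        have : (0 : ℝ) ≤ n := by positivity
        nlinarith

/-- A choice of halves that is good on a finite grid of parameters. -/
lemma exists_halves_grid {s : ℝ} {n : ℕ} {x : ℕ → ℕ} (hx : IsStage s n x) {B : ℝ} (hB1 : 1 ≤ B)
    (hB : ∀ a b : ℝ, 1 / 2 ≤ a → a ≤ 2 → b ≠ 0 → |b| ≤ 4 →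
      stageCorr n (numCells s n) x a b * |b| ^ s ≤ B) :
    ∃ e : ℕ → Bool, ∀ N : ℕ, N = 2 ^ (4 * (n + 1) + 6) →
      (∀ i ≤ 2 * N, ∀ j ≤ 8 * N, ∀ a b : ℝ, a = i / N → b = j / N - 4 → 1 / 2 ≤ a → a ≤ 2 → b ≠ 0 →
        |b| ≤ 4 → offDiagForm (halfCorr n (numCells s n) x a b) (fun j => e j) ≤
        (∑ j : Fin (numCells s n), ∑ k : Fin (numCells s n), corr n (x j) (x k) a b) / 4 +
        4 * ((n : ℝ) + 1) * √(6 / 2 ^ n * (B / ((2 ^ n / numCells s n) ^ 2 * |b| ^ s)))) ∧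
      ∀ i < N, ∀ l < 4, signedSum (numCells s n) x (fun j => e j) ((i : ℝ) / N) ((l : ℕ) * (Real.pi / 2)) ≤
        4 * ((n : ℝ) + 1) * (2 * √(numCells s n)) := by
  classical
  have hP : (0 : ℝ) < numCells s n := by exact_mod_cast numCells_pos s n
  set P := numCells s n with hPdef
  obtain ⟨N, hN⟩ : ∃ N : ℕ, N = 2 ^ (4 * (n + 1) + 6) := ⟨_, rfl⟩
  let A : ℕ × ℕ → ℝ := fun p => p.1 / N
  let Bb : ℕ × ℕ → ℝ := fun p => p.2 / N - 4
  let G₁ : Finset (ℕ × ℕ) := (Finset.range (2 * N + 1) ×ˢ Finset.range (8 * N + 1)).filter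
    fun p => 1 / 2 ≤ A p ∧ A p ≤ 2 ∧ Bb p ≠ 0 ∧ |Bb p| ≤ 4
  let G₂ : Finset (ℕ × ℕ) := Finset.range N ×ˢ Finset.range 4
  let G := G₁.disjSum G₂
  have hG : (G.card : ℝ) < Real.exp (2 * (4 * ((n : ℝ) + 1)) ^ 2) := by
    refine lt_of_le_of_lt ?_ (grid_card_lt hN)
    have : G.card ≤ (2 * N + 1) * (8 * N + 1) + N * 4 := by
      rw [Finset.card_disjSum]
      refine add_le_add ((Finset.card_filter_le _ _).trans ?_) ?_ <;> simp [G₂]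
    exact_mod_cast this
  refine Exists.elim (exists_signs_forall_le G
    (Sum.elim (fun p ε => offDiagForm (halfCorr n P x (A p) (Bb p)) ε)
      (fun p ε => signedSum P x ε ((p.1 : ℝ) / N) (p.2 * (Real.pi / 2))))
    (Sum.elim (fun p i => ∑ k, ((∑ e, ∑ e', halfCorr n P x (A p) (Bb p) i k e e') +
      ∑ e, ∑ e', halfCorr n P x (A p) (Bb p) k i e e')) (fun _ _ => 2))
    (Sum.elim (fun p => (∑ j : Fin P, ∑ k : Fin P, corr n (x j) (x k) (A p) (Bb p)) / 4) (fun _ => 0))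
    (Sum.elim (fun p => √(6 / 2 ^ n * (B / ((2 ^ n / P) ^ 2 * |Bb p| ^ s)))) (fun _ => 2 * √P))
    (t := 4 * ((n : ℝ) + 1)) ?_ ?_ ?_ ?_ (by positivity) hG) fun ε hε => ?_
  · rintro (p | p) hp i ε
    · exact offDiagForm_diff (halfCorr n P x (A p) (Bb p)) (halfCorr_nonneg n P x _ _) i ε
    · exact signedSum_diff ..
  · rintro (p | p) hp
    · have h3 := (Finset.mem_filter.1 (Finset.inl_mem_disjSum.1 hp)).2
      have hb : 0 < |Bb p| ^ s := Real.rpow_pos_of_pos (abs_pos.2 h3.2.2.1) s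
      simp only [Sum.elim_inl]
      positivity
    · simp only [Sum.elim_inr]; positivity
  · rintro (p | p) hp
    · have h3 := (Finset.mem_filter.1 (Finset.inl_mem_disjSum.1 hp)).2
      have hb : 0 < |Bb p| ^ s := Real.rpow_pos_of_pos (abs_pos.2 h3.2.2.1) s
      simp only [Sum.elim_inl]
      rw [Real.sq_sqrt (by positivity)]
      refine (offDiagForm_halfCorr_sq_le hx.inj h3.1).trans ?_
      have h4 := hB _ _ h3.1 h3.2.1 h3.2.2.1 h3.2.2.2
      unfold stageCorr at h4
      have h5 : ∑ j : Fin P, ∑ k : Fin P, corr n (x j) (x k) (A p) (Bb p) ≤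
          B / ((2 ^ n / P) ^ 2 * |Bb p| ^ s) := by
        rw [le_div_iff₀ (by positivity)]
        calc _ = _ := by ring
          _ ≤ _ := h4
      calc _ ≤ 3 / 2 ^ n * (2 * (B / ((2 ^ n / P) ^ 2 * |Bb p| ^ s))) := by gcongr
        _ = _ := by ring
    · simp only [Sum.elim_inr, Finset.sum_const, Finset.card_univ, Fintype.card_fin, nsmul_eq_mul]
      rw [mul_pow, Real.sq_sqrt hP.le]; linarith
  · rintro (p | p) hp
    · simp only [Sum.elim_inl]
      refine (offDiagForm_mean _ (halfCorr_nonneg n P x _ _)).trans ?_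
      simp only [sum_halfCorr]
      exact le_rfl
    · simp only [Sum.elim_inr, sum_signedSum, mul_zero, le_refl]
  · refine ⟨fun j => if h : j < P then ε ⟨j, h⟩ else false, fun N' hN' => ?_⟩
    obtain rfl : N' = N := hN'.trans hN.symm
    have he : (fun j : Fin P => if h : (j : ℕ) < P then ε ⟨j, h⟩ else false) = ε := by
      funext j; simp
    rw [he]
    constructor
    · rintro i hi j hj a b rfl rfl h1 h2 h3 h4
      exact hε (Sum.inl (i, j)) (by
        simp only [G, Finset.inl_mem_disjSum, G₁, Finset.mem_filter, Finset.mem_product, Finset.mem_range]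
        exact ⟨⟨by omega, by omega⟩, h1, h2, h3, h4⟩)
    · intro i hi l hl
      have := hε (Sum.inr (i, l)) (by simp [G, G₂, hi, hl])
      simpa using this

lemma halve_div_two (x : ℕ → ℕ) (e : ℕ → Bool) (j : ℕ) : halve x e j / 2 = x j := by
  unfold halve
  cases e j <;> simp
  omega

lemma lt_two_pow_succ_of_div {x' : ℕ} {n x : ℕ} (h : x' / 2 = x) (hx : x < 2 ^ n) : x' < 2 ^ (n + 1) := by
  rw [pow_succ]; omega

lemma signedSum_le_of_grid {P n N : ℕ} {x : ℕ → ℕ} (hP : 0 < P) (hx : ∀ j < P, x j < 2 ^ n)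
    (hP2 : (P : ℝ) ≤ 2 ^ n) (hNr : (N : ℝ) = 64 * 4 ^ (n + 1) * 4 ^ (n + 1)) {ε : Fin P → Bool} {φ : ℝ}
    (h : ∀ i < N, signedSum P x ε ((i : ℝ) / N) φ ≤ 4 * ((n : ℝ) + 1) * (2 * √P)) (θ : ℝ) :
    signedSum P x ε θ φ ≤ 9 * ((n : ℝ) + 1) * √P := by
  have hPr : (1 : ℝ) ≤ P := by exact_mod_cast hP
  have hn0 : (0 : ℝ) ≤ n := by positivity
  have hN0r : (0 : ℝ) < N := hNr ▸ by positivity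
  rw [signedSum_fract]
  set u := Int.fract θ
  have hu0 : 0 ≤ u := Int.fract_nonneg θ
  have hu1 : u < 1 := Int.fract_lt_one θ
  have f1 := Nat.floor_le (mul_nonneg hu0 hN0r.le)
  have f2 := Nat.lt_floor_add_one (u * N)
  have hi : ⌊u * N⌋₊ < N := by
    rw [Nat.floor_lt (by positivity)]
    nlinarith
  have h3 := h _ hi
  have h4 := signedSum_le_of_near (N := 2 ^ n) (x := x) (fun j hj => by exact_mod_cast (hx j hj).le)
    ε u ((⌊u * N⌋₊ : ℝ) / N) φ
  have h5 : |u - (⌊u * N⌋₊ : ℝ) / N| ≤ 1 / N := by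
    have e1 : (⌊u * N⌋₊ : ℝ) / N ≤ u := by rwa [div_le_iff₀ hN0r]
    have e2 : u - 1 / N ≤ (⌊u * N⌋₊ : ℝ) / N := by
      rw [le_div_iff₀ hN0r, sub_mul, one_div, inv_mul_cancel₀ hN0r.ne']; linarith
    rw [abs_le]; constructor <;> linarith [show 0 ≤ 1 / (N : ℝ) by positivity]
  have h6 : (P : ℝ) * (2 * Real.pi * |u - (⌊u * N⌋₊ : ℝ) / N| * 2 ^ n) ≤ 1 := by
    calc (P : ℝ) * (2 * Real.pi * |u - (⌊u * N⌋₊ : ℝ) / N| * 2 ^ n) ≤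
          2 ^ n * (2 * 4 * (1 / N) * 2 ^ n) := by
            have := Real.pi_le_four
            gcongr
      _ = 8 * 4 ^ n / N := by
          rw [show (4 : ℝ) = 2 * 2 by norm_num, mul_pow]; ring
      _ ≤ 1 := by
          rw [div_le_one hN0r, hNr]
          have : (1 : ℝ) ≤ 4 ^ n := one_le_pow₀ (by norm_num)
          rw [pow_succ]
          nlinarith [mul_nonneg (sub_nonneg.2 this) (sub_nonneg.2 this)]
  have h7 : 1 ≤ √(P : ℝ) := by rwa [Real.one_le_sqrt]
  calc _ ≤ 4 * ((n : ℝ) + 1) * (2 * √P) + 1 := h4.trans (add_le_add h3 h6)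
    _ ≤ _ := by nlinarith

/-- The probabilistic step of the construction: halves can be selected so that the correlations
barely grow and all trigonometric sums enjoy square root cancellation. -/
lemma exists_halves {s : ℝ} (hs : 1 / 2 ≤ s) (hs1 : s ≤ 1) {n : ℕ} {x : ℕ → ℕ} (hx : IsStage s n x)
    {B : ℝ} (hB1 : 1 ≤ B)
    (hB : ∀ a b : ℝ, 1 / 2 ≤ a → a ≤ 2 → b ≠ 0 → |b| ≤ 4 →
      stageCorr n (numCells s n) x a b * |b| ^ s ≤ B) :
    ∃ e : ℕ → Bool, (∀ a b : ℝ, 1 / 2 ≤ a → a ≤ 2 → b ≠ 0 → |b| ≤ 4 →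
      stageCorr (n + 1) (numCells s n) (halve x e) a b * |b| ^ s ≤
        B * (1 + 4000 * ((n : ℝ) + 1) * 2 ^ (-(n * (s - 1 / 2))))) ∧
      ∀ θ : ℝ, ∀ l < 4, signedSum (numCells s n) x (fun j => e j) θ ((l : ℕ) * (Real.pi / 2)) ≤
        9 * ((n : ℝ) + 1) * √(numCells s n) := by
  have hs0 : 0 ≤ s := by linarith
  obtain ⟨e, he⟩ := exists_halves_grid hx hB1 hB
  obtain ⟨N, hN⟩ : ∃ N : ℕ, N = 2 ^ (4 * (n + 1) + 6) := ⟨_, rfl⟩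
  obtain ⟨h1, h2⟩ := he N hN
  have hP : 0 < numCells s n := numCells_pos s n
  have hPr : (1 : ℝ) ≤ numCells s n := by exact_mod_cast hP
  have hκ := two_pow_div_sq_numCells_le s n
  have hP2 := numCells_le_two_pow hs0 hs1 n
  set P := numCells s n with hPdef
  set q : ℝ := 2 ^ (-(n * (s - 1 / 2))) with hq
  have hq0 : 0 < q := by positivity
  have hn0 : (0 : ℝ) ≤ n := by positivity
  have hq1 : q ≤ 1 := Real.rpow_le_one_of_one_le_of_nonpos one_le_two (by
    rw [neg_nonpos]; exact mul_nonneg hn0 (by linarith))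
  have h4q : (1 / 4 : ℝ) ^ (n + 1) ≤ q := by
    calc (1 / 4 : ℝ) ^ (n + 1) = 2 ^ (-(2 * ((n : ℝ) + 1))) := by
          rw [Real.rpow_neg two_pos.le, Real.rpow_mul two_pos.le, ← Nat.cast_succ, Real.rpow_natCast]
          rw [one_div, inv_pow]; norm_num
      _ ≤ q := Real.rpow_le_rpow_of_exponent_le one_le_two (by nlinarith)
  have hNr : (N : ℝ) = 64 * 4 ^ (n + 1) * 4 ^ (n + 1) := by
    rw [hN]
    push_cast
    rw [pow_add, pow_mul, show (2 : ℝ) ^ 4 = 4 * 4 by norm_num, mul_pow]; ring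
  have hN0 : 0 < N := hN ▸ by positivity
  have hN0r : (0 : ℝ) < N := by exact_mod_cast hN0
  have h4pos : (1 : ℝ) ≤ 4 ^ (n + 1) := one_le_pow₀ (by norm_num)
  refine ⟨e, fun a b ha ha2 hb0 hb => ?_, fun θ l hl => ?_⟩
  · have hlt : ∀ j < P, halve x e j < 2 ^ (n + 1) := fun j hj =>
      lt_two_pow_succ_of_div (halve_div_two x e j) (hx.lt j hj)
    have hinj : ∀ j < P, ∀ k < P, halve x e j = halve x e k → j = k := fun j hj k hk h =>
      hx.inj j hj k hk (by rw [← halve_div_two x e j, h, halve_div_two])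
    rcases le_or_gt |b| ((1 / 4 : ℝ) ^ (n + 1)) with hsm | hbig
    · have h3 : |b| ^ s ≤ 1 / 2 ^ (n + 1) := by
        calc |b| ^ s ≤ |b| ^ (1 / 2 : ℝ) :=
              Real.rpow_le_rpow_of_exponent_ge (abs_pos.2 hb0)
                (hsm.trans (pow_le_one₀ (by norm_num) (by norm_num))) hs
          _ ≤ ((1 / 4 : ℝ) ^ (n + 1)) ^ (1 / 2 : ℝ) := Real.rpow_le_rpow (abs_nonneg _) hsm (by norm_num)
          _ = 1 / 2 ^ (n + 1) := by
              rw [← Real.sqrt_eq_rpow, show (1 / 4 : ℝ) = (1 / 2) * (1 / 2) by norm_num, mul_pow,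
                Real.sqrt_mul_self (by positivity), one_div_pow]
      calc _ ≤ 2 ^ (n + 1) * (1 / 2 ^ (n + 1) : ℝ) := by
            gcongr
            exact stageCorr_le hP hinj a b
        _ = 1 := by field_simp
        _ ≤ B * 1 := by linarith
        _ ≤ _ := by gcongr; linarith [show 0 ≤ 4000 * ((n : ℝ) + 1) * q by positivity]
    · have hbN : 2 / (N : ℝ) ≤ |b| := by
        refine le_trans ?_ hbig.le
        rw [hNr, one_div_pow, div_le_div_iff₀ (by positivity) (by positivity)]
        nlinarith
      obtain ⟨i, hi, j, hj, g1, g2, g3, g4, g5, g6, g7, g8⟩ :=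
        exists_grid_near hN0 (hN ▸ dvd_pow_self 2 (by omega)) ha ha2 hb hbN
      have h3 := h1 i hi j hj _ _ rfl rfl g1 g2 g3 g4
      set a' := (i : ℝ) / N
      set b' := (j : ℝ) / N - 4
      have hb'p : 0 < |b'| ^ s := Real.rpow_pos_of_pos (abs_pos.2 g3) s
      have hb4 : |b'| ^ s ≤ 4 := by
        have h3 := rpow_le_two_mul (v := 2) hs0 hs1 (abs_nonneg _) (by norm_num) (u := |b'|) (by linarith)
        have h4 : (2 : ℝ) ^ s ≤ 2 ^ (1 : ℝ) := Real.rpow_le_rpow_of_exponent_le one_le_two hs1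
        rw [Real.rpow_one] at h4
        linarith
      have hdev := deviation_le (P := P) (q := q) (t := 4 * ((n : ℝ) + 1)) (by positivity) hκ hq0.le hB1
        (by positivity) hb'p hb4
      set T := 4 * ((n : ℝ) + 1) * √(6 / 2 ^ n * (B / ((2 ^ n / P) ^ 2 * |b'| ^ s)))
      have h5 := stageCorr_halve_le (a := a') (e := e) (D := 4 * (2 ^ n / (P : ℝ)) ^ 2 * T) hs0 hs1 hx g3 g4
        (by
          rw [mul_div_cancel_left₀ _ (by positivity)]
          exact h3)
      rw [add_assoc] at h5
      have h6 : 4 * (2 ^ n / (P : ℝ)) ^ 2 * T * |b'| ^ s + 384 * (2 ^ n / (P : ℝ) ^ 2) ≤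
          1696 * ((n : ℝ) + 1) * q * B := by
        have h7 : 2 ^ n / (P : ℝ) ^ 2 ≤ 4 * (((n : ℝ) + 1) * q * B) := by
          refine hκ.trans ?_
          gcongr
          calc q ^ 2 = 1 * q * q := by ring
            _ ≤ ((n : ℝ) + 1) * q * B := by gcongr <;> linarith
        linarith
      have h8 := stageCorr_le_of_grid (x' := halve x e) hs0 hs1 hP hx.lt hlt ha g1 hb g3 g5 g6 g8 (by positivity)
        (h5.trans (add_le_add_right h6 _)) (hB a b ha ha2 hb0 hb)
      refine h8.trans ?_
      have h9 : (4 : ℝ) ^ (n + 1) * (416 * (1 / N)) ≤ 7 * (((n : ℝ) + 1) * q * B) := by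
        calc (4 : ℝ) ^ (n + 1) * (416 * (1 / N)) = 6.5 * (1 / 4) ^ (n + 1) := by
              rw [hNr, one_div_pow]; field_simp; norm_num
          _ ≤ 7 * q := by gcongr; norm_num
          _ = 7 * (1 * q * 1) := by ring
          _ ≤ _ := by gcongr; linarith
      have h10 : 0 ≤ ((n : ℝ) + 1) * q * B := by positivity
      calc _ ≤ B + 2 * (1696 * ((n : ℝ) + 1) * q * B) + 7 * (((n : ℝ) + 1) * q * B) := by gcongr
        _ ≤ B + 4000 * (((n : ℝ) + 1) * q * B) := by linarith
        _ = _ := by ring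
  · exact signedSum_le_of_grid hP hx.lt (by exact_mod_cast hP2) hNr (fun i hi => h2 i hi l hl) θ

lemma sum_range_mul_eq {M : Type*} [AddCommMonoid M] (m P : ℕ) (f : ℕ → M) :
    ∑ j ∈ Finset.range (m * P), f j = ∑ i ∈ Finset.range P, ∑ r ∈ Finset.range m, f (m * i + r) := by
  induction P with
  | zero => simp
  | succ P ih => rw [Nat.mul_succ, Finset.sum_range_add, ih, Finset.sum_range_succ]

lemma sum_range_mul_div {M : Type*} [AddCommMonoid M] {m : ℕ} (hm : 0 < m) (P : ℕ) (f : ℕ → M) :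
    ∑ j ∈ Finset.range (m * P), f (j / m) = m • ∑ i ∈ Finset.range P, f i := by
  rw [sum_range_mul_eq, Finset.smul_sum]
  refine Finset.sum_congr rfl fun i _ => ?_
  rw [Finset.sum_congr rfl (g := fun _ => f i)]
  · simp
  · intro r hr
    rw [Nat.mul_add_div hm, Nat.div_eq_of_lt (Finset.mem_range.1 hr), add_zero]

lemma numCells_succ_eq {s : ℝ} (hs : 0 ≤ s) (hs1 : s ≤ 1) (n : ℕ) :
    numCells s (n + 1) = 1 * numCells s n ∨ numCells s (n + 1) = 2 * numCells s n := by
  unfold numCells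
  have h0 : 0 ≤ (n : ℝ) * s := by positivity
  have h1 : ⌊(n : ℝ) * s⌋₊ ≤ ⌊((n + 1 : ℕ) : ℝ) * s⌋₊ := Nat.floor_mono (by push_cast; nlinarith)
  have h2 : ⌊((n + 1 : ℕ) : ℝ) * s⌋₊ ≤ ⌊(n : ℝ) * s⌋₊ + 1 := by
    rw [← Nat.floor_add_one h0]
    exact Nat.floor_mono (by push_cast; nlinarith)
  rcases Nat.le_or_eq_of_le_succ h2 with h | h
  · left; rw [le_antisymm h h1, one_mul]
  · right; rw [h, pow_succ']

lemma numCells_zero (s : ℝ) : numCells s 0 = 1 := by simp [numCells]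

lemma IsStage.succ {s : ℝ} {n m : ℕ} {x x' : ℕ → ℕ} (hx : IsStage s n x) (hm : 0 < m)
    (hP : numCells s (n + 1) = m * numCells s n) (h : ∀ j, x' j / 2 = x (j / m))
    (hinj : ∀ j < numCells s (n + 1), ∀ k < numCells s (n + 1), x' j = x' k → j = k) :
    IsStage s (n + 1) x' where
  lt j hj := lt_two_pow_succ_of_div (h j) (hx.lt _ (by
    rw [Nat.div_lt_iff_lt_mul hm, mul_comm]; exact hP ▸ hj))
  inj := hinj
  reg k hk i := by
    rcases Nat.le_or_eq_of_le_succ hk with hk | rfl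
    · have h1 := hx.reg k hk i
      have h2 : ((Finset.range (numCells s (n + 1))).filter fun j => x' j / 2 ^ (n + 1 - k) = i).card =
          m * ((Finset.range (numCells s n)).filter fun j => x j / 2 ^ (n - k) = i).card := by
        simp only [Finset.card_filter]
        have h3 := sum_range_mul_div hm (numCells s n) (fun j => if x j / 2 ^ (n - k) = i then 1 else 0)
        rw [smul_eq_mul] at h3
        rw [hP, ← h3]
        refine Finset.sum_congr rfl fun j _ => ?_
        rw [Nat.sub_add_comm hk, pow_succ', ← Nat.div_div_eq_div_mul, h]
      rw [h2, hP, mul_left_comm]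
      exact Nat.mul_le_mul_left m h1
    · refine mul_le_of_le_one_right (Nat.zero_le _) (Finset.card_le_one.2 fun j hj k hk => ?_)
      simp only [Finset.mem_filter, Finset.mem_range, Nat.sub_self, pow_zero, Nat.div_one] at hj hk
      exact hinj j hj.1 k hk.1 (hj.2.trans hk.2.symm)

/-- The enumeration at the next level when every interval is replaced with both of its halves. -/
def keepBoth (x : ℕ → ℕ) (j : ℕ) : ℕ := 2 * x (j / 2) + j % 2

lemma keepBoth_two_mul (x : ℕ → ℕ) (j : ℕ) : keepBoth x (2 * j) = 2 * x j := by
  simp [keepBoth]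

lemma keepBoth_two_mul_add_one (x : ℕ → ℕ) (j : ℕ) : keepBoth x (2 * j + 1) = 2 * x j + 1 := by
  unfold keepBoth
  rw [show (2 * j + 1) / 2 = j by omega]; omega

lemma keepBoth_div_two (x : ℕ → ℕ) (j : ℕ) : keepBoth x j / 2 = x (j / 2) := by
  unfold keepBoth; omega

lemma stageCorr_eq_sum_range (n P : ℕ) (x : ℕ → ℕ) (a b : ℝ) : stageCorr n P x a b =
    (2 ^ n / P) ^ 2 * ∑ j ∈ Finset.range P, ∑ k ∈ Finset.range P, corr n (x j) (x k) a b := by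
  unfold stageCorr
  rw [Finset.sum_range]
  simp only [Finset.sum_range]

lemma stageCorr_keepBoth (n P : ℕ) (x : ℕ → ℕ) (a b : ℝ) :
    stageCorr (n + 1) (2 * P) (keepBoth x) a b = stageCorr n P x a b := by
  rw [stageCorr_eq_sum_range, stageCorr_eq_sum_range]
  simp only [sum_range_mul_eq, Finset.sum_range_succ, Finset.sum_range_zero, zero_add, add_zero,
    keepBoth_two_mul, keepBoth_two_mul_add_one]
  congr 1
  · push_cast; rw [pow_succ' (2 : ℝ) n, mul_div_mul_left _ _ (two_ne_zero (α := ℝ))]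
  · simp only [← Finset.sum_add_distrib]
    refine Finset.sum_congr rfl fun j _ => Finset.sum_congr rfl fun k _ => ?_
    rw [corr_split n (x j) (x k)]; ring

/-- The signed trigonometric sums, in terms of the parities of the next enumeration. -/
noncomputable def paritySum (P : ℕ) (x : ℕ → ℕ) (θ φ : ℝ) : ℝ :=
  ∑ j ∈ Finset.range P, (-1) ^ x j * Real.cos (2 * Real.pi * θ * (x j / 2 : ℕ) + φ)

lemma paritySum_keepBoth (P : ℕ) (x : ℕ → ℕ) (θ φ : ℝ) : paritySum (2 * P) (keepBoth x) θ φ = 0 := by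
  unfold paritySum
  rw [sum_range_mul_eq]
  refine Finset.sum_eq_zero fun j _ => ?_
  simp only [Finset.sum_range_succ, Finset.sum_range_zero, zero_add, add_zero, keepBoth_div_two]
  rw [keepBoth_two_mul, keepBoth_two_mul_add_one, show (2 * j + 1) / 2 = j by omega,
    show 2 * j / 2 = j by omega, pow_succ, pow_mul]
  ring

lemma paritySum_halve (P : ℕ) (x : ℕ → ℕ) (e : ℕ → Bool) (θ φ : ℝ) :
    paritySum P (halve x e) θ φ = signedSum P x (fun j => e j) θ φ := by
  unfold paritySum signedSum
  rw [Finset.sum_range]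
  refine Finset.sum_congr rfl fun j _ => ?_
  rw [halve_div_two]
  congr 1
  unfold halve
  rw [pow_add, pow_mul]
  cases h : e j <;> simp [boolSign, h]

/-- One step of the construction. -/
lemma exists_next_stage {s : ℝ} (hs : 1 / 2 ≤ s) (hs1 : s ≤ 1) {n : ℕ} {x : ℕ → ℕ} (hx : IsStage s n x)
    {B : ℝ} (hB1 : 1 ≤ B)
    (hB : ∀ a b : ℝ, 1 / 2 ≤ a → a ≤ 2 → b ≠ 0 → |b| ≤ 4 →
      stageCorr n (numCells s n) x a b * |b| ^ s ≤ B) :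
    ∃ x' : ℕ → ℕ, IsStage s (n + 1) x' ∧ (∀ a b : ℝ, 1 / 2 ≤ a → a ≤ 2 → b ≠ 0 → |b| ≤ 4 →
      stageCorr (n + 1) (numCells s (n + 1)) x' a b * |b| ^ s ≤
        B * (1 + 4000 * ((n : ℝ) + 1) * 2 ^ (-(n * (s - 1 / 2))))) ∧
      (∀ j, x' j / 2 = x (j / (numCells s (n + 1) / numCells s n))) ∧
      ∀ θ : ℝ, ∀ l < 4, paritySum (numCells s (n + 1)) x' θ ((l : ℕ) * (Real.pi / 2)) ≤
        9 * ((n : ℝ) + 1) * √(numCells s n) := by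
  have hP := numCells_pos s n
  rcases numCells_succ_eq (by linarith) hs1 n with h | h
  · obtain ⟨e, he1, he2⟩ := exists_halves hs hs1 hx hB1 hB
    have h' := h
    rw [one_mul] at h'
    refine ⟨halve x e, hx.succ one_pos h (fun j => by rw [halve_div_two, Nat.div_one]) ?_, ?_, ?_, ?_⟩
    · rw [h']
      exact fun j hj k hk h => hx.inj j hj k hk (by rw [← halve_div_two x e j, h, halve_div_two])
    · rw [h']; exact he1
    · intro j
      rw [h', Nat.div_self hP, Nat.div_one, halve_div_two]
    · rw [h']
      intro θ l hl
      rw [paritySum_halve]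
      exact he2 θ l hl
  · refine ⟨keepBoth x, hx.succ two_pos h (keepBoth_div_two x) ?_, ?_, ?_, ?_⟩
    · rw [h]
      intro j hj k hk hjk
      have h1 := hx.inj (j / 2) (by omega) (k / 2) (by omega)
        (by rw [← keepBoth_div_two x, hjk, keepBoth_div_two])
      unfold keepBoth at hjk
      rw [h1] at hjk
      omega
    · intro a b h1 h2 h3 h4
      rw [h, stageCorr_keepBoth]
      refine (hB a b h1 h2 h3 h4).trans (le_mul_of_one_le_right (by linarith) ?_)
      have : (0 : ℝ) ≤ 4000 * ((n : ℝ) + 1) * 2 ^ (-(n * (s - 1 / 2))) := by positivity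
      linarith
    · intro j
      rw [h, Nat.mul_div_cancel _ hP, keepBoth_div_two]
    · intro θ l _
      rw [h, paritySum_keepBoth]
      positivity

lemma rpow_neg_mul_eq_pow (η : ℝ) (n : ℕ) : (2 : ℝ) ^ (-(n * η)) = ((2 : ℝ) ^ (-η)) ^ n := by
  rw [← Real.rpow_natCast, ← Real.rpow_mul two_pos.le]
  congr 1; ring

lemma summable_succ_mul_rpow {η : ℝ} (hη : 0 < η) :
    Summable fun n : ℕ => ((n : ℝ) + 1) * 2 ^ (-(n * η)) := by
  have hr : ‖(2 : ℝ) ^ (-η)‖ < 1 := by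
    rw [Real.norm_of_nonneg (by positivity)]
    exact Real.rpow_lt_one_of_one_lt_of_neg one_lt_two (by linarith)
  have h1 := summable_pow_mul_geometric_of_norm_lt_one 1 hr
  have h2 := summable_geometric_of_norm_lt_one hr
  refine (h1.add h2).congr fun n => ?_
  rw [rpow_neg_mul_eq_pow]; ring

/-- The data of the whole construction. -/
structure IsConstruction (s : ℝ) (B : ℝ) (x : ℕ → ℕ → ℕ) : Prop where
  stage : ∀ n, IsStage s n (x n)
  corr_le : ∀ n, ∀ a b : ℝ, 1 / 2 ≤ a → a ≤ 2 → b ≠ 0 → |b| ≤ 4 →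
      stageCorr n (numCells s n) (x n) a b * |b| ^ s ≤ B
  div_two : ∀ n j, x (n + 1) j / 2 = x n (j / (numCells s (n + 1) / numCells s n))
  parity_le : ∀ n, ∀ θ : ℝ, ∀ l < 4, paritySum (numCells s (n + 1)) (x (n + 1)) θ ((l : ℕ) * (Real.pi / 2)) ≤
        9 * ((n : ℝ) + 1) * √(numCells s n)

lemma exists_isConstruction {s : ℝ} (hs : 1 / 2 < s) (hs1 : s ≤ 1) :
    ∃ B x, 0 ≤ B ∧ IsConstruction s B x := by
  let u : ℕ → ℝ := fun n => 4000 * ((n : ℝ) + 1) * 2 ^ (-(n * (s - 1 / 2)))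
  have hu0 : ∀ n, 0 ≤ u n := fun n => by positivity
  have hus : Summable u := by
    refine ((summable_succ_mul_rpow (η := s - 1 / 2) (by linarith)).mul_left 4000).congr fun n => ?_
    simp only [u]; ring
  let Bn : ℕ → ℝ := fun n => 4 * ∏ k ∈ Finset.range n, (1 + u k)
  have hB1 : ∀ n, 1 ≤ Bn n := fun n => by
    have : (1 : ℝ) ≤ ∏ k ∈ Finset.range n, (1 + u k) :=
      Finset.one_le_prod fun k _ => by linarith [hu0 k]
    simp only [Bn]; linarith
  have hB : ∀ n, Bn n ≤ 4 * Real.exp (∑' k, u k) := fun n => by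
    simp only [Bn]
    gcongr
    calc ∏ k ∈ Finset.range n, (1 + u k) ≤ ∏ k ∈ Finset.range n, Real.exp (u k) :=
          Finset.prod_le_prod (fun k _ => by linarith [hu0 k]) fun k _ => by
            rw [add_comm]; exact Real.add_one_le_exp _
      _ = Real.exp (∑ k ∈ Finset.range n, u k) := (Real.exp_sum _ _).symm
      _ ≤ _ := Real.exp_le_exp.2 (hus.sum_le_tsum _ fun k _ => hu0 k)
  let T : ℕ → Type := fun n => {x : ℕ → ℕ // IsStage s n x ∧ ∀ a b : ℝ, 1 / 2 ≤ a → a ≤ 2 → b ≠ 0 →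
    |b| ≤ 4 → stageCorr n (numCells s n) x a b * |b| ^ s ≤ Bn n}
  have H : ∀ n (p : T n), ∃ p' : T (n + 1),
      (∀ j, p'.1 j / 2 = p.1 (j / (numCells s (n + 1) / numCells s n))) ∧
      ∀ θ : ℝ, ∀ l < 4, paritySum (numCells s (n + 1)) p'.1 θ ((l : ℕ) * (Real.pi / 2)) ≤
        9 * ((n : ℝ) + 1) * √(numCells s n) := by
    intro n p
    obtain ⟨x', h1, h2, h3, h4⟩ := exists_next_stage hs.le hs1 p.2.1 (hB1 n) p.2.2
    refine ⟨⟨x', h1, ?_⟩, h3, h4⟩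
    have : Bn (n + 1) = Bn n * (1 + u n) := by
      simp only [Bn]; rw [Finset.prod_range_succ]; ring
    rw [this]
    exact h2
  choose F hF using H
  have h0 : IsStage s 0 (fun _ => 0) := by
    refine ⟨?_, ?_, ?_⟩
    · simp
    · simp [numCells_zero]
    · intro k hk i
      obtain rfl : k = 0 := by omega
      simp only [numCells_zero, one_mul]
      exact (Finset.card_filter_le _ _).trans (by simp)
  let p0 : T 0 := ⟨fun _ => 0, h0, fun a b _ _ hb0 hb => by
    have h1 : stageCorr 0 (numCells s 0) (fun _ => 0) a b ≤ 2 ^ 0 := stageCorr_le (numCells_pos s 0) h0.inj a b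
    have h2 := rpow_le_two_mul (v := 2) (s := s) (by linarith) hs1 (abs_nonneg _) (by norm_num)
      (u := |b|) (by linarith)
    have h4 : (2 : ℝ) ^ s ≤ 2 ^ (1 : ℝ) := Real.rpow_le_rpow_of_exponent_le one_le_two hs1
    rw [Real.rpow_one] at h4
    have h5 : 0 ≤ |b| ^ s := by positivity
    simp only [Bn, Finset.range_zero, Finset.prod_empty]
    nlinarith⟩
  let f : ∀ n, T n := fun n => Nat.rec p0 F n
  refine ⟨4 * Real.exp (∑' k, u k), fun n => (f n).1, by positivity, fun n => (f n).2.1,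
    fun n a b h1 h2 h3 h4 => ((f n).2.2 a b h1 h2 h3 h4).trans (hB n), fun n => (hF n (f n)).1,
    fun n => (hF n (f n)).2⟩

/-- Lebesgue measure on the unit interval. -/
noncomputable def unitMeasure : Measure ℝ := volume.restrict (Ico 0 1)

instance : IsProbabilityMeasure unitMeasure := ⟨by simp [unitMeasure]⟩

lemma measurable_floor_mul (P : ℕ) : Measurable fun u : ℝ => ⌊u * P⌋₊ :=
  Nat.measurable_floor.comp (measurable_id.mul_const _)

lemma map_floor_mul {P : ℕ} (hP : 0 < P) : unitMeasure.map (fun u : ℝ => ⌊u * P⌋₊) =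
    (P : ENNReal)⁻¹ • ∑ j ∈ Finset.range P, Measure.dirac j := by
  have hPr : (0 : ℝ) < P := by exact_mod_cast hP
  refine Measure.ext_of_singleton fun j => ?_
  rw [Measure.map_apply (measurable_floor_mul P) (measurableSet_singleton j)]
  simp only [Measure.smul_apply, Measure.finsetSum_apply, smul_eq_mul,
    Measure.dirac_apply' _ (measurableSet_singleton j)]
  rw [unitMeasure, Measure.restrict_apply (measurable_floor_mul P (measurableSet_singleton j))]
  have h1 : ∀ k, ({j} : Set ℕ).indicator (1 : ℕ → ENNReal) k = if j = k then 1 else 0 := by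
    intro k; simp [indicator_apply, eq_comm]
  simp only [h1, Finset.sum_ite_eq, Finset.mem_range]
  split_ifs with hj
  · have h2 : (fun u : ℝ => ⌊u * P⌋₊) ⁻¹' {j} ∩ Ico 0 1 = Ico ((j : ℝ) / P) ((j + 1) / P) := by
      ext u
      have hj' : ((j : ℝ) + 1) ≤ P := by exact_mod_cast hj
      simp only [mem_inter_iff, mem_preimage, mem_singleton_iff, mem_Ico]
      rw [div_le_iff₀ hPr, lt_div_iff₀ hPr]
      constructor
      · rintro ⟨h, h0, -⟩
        exact (Nat.floor_eq_iff (by positivity)).1 h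
      · rintro ⟨h2, h3⟩
        have h0 : 0 ≤ u := by
          by_contra h
          have : u * P < 0 := mul_neg_of_neg_of_pos (not_le.1 h) hPr
          have : (0 : ℝ) ≤ j := by positivity
          linarith
        refine ⟨(Nat.floor_eq_iff (by positivity)).2 ⟨h2, h3⟩, h0, ?_⟩
        by_contra h
        nlinarith [not_lt.1 h]
    rw [h2, Real.volume_Ico, add_div, add_sub_cancel_left, mul_one, one_div,
      ENNReal.ofReal_inv_of_pos hPr, ENNReal.ofReal_natCast]
  · rw [mul_zero]
    convert measure_empty (μ := volume)
    ext u
    simp only [mem_inter_iff, mem_preimage, mem_singleton_iff, mem_Ico, mem_empty_iff_false, iff_false]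
    rintro ⟨h, h0, h1⟩
    apply hj
    rw [← h, Nat.floor_lt (by positivity)]
    nlinarith

lemma lintegral_floor_mul {P : ℕ} (hP : 0 < P) (g : ℕ → ENNReal) :
    ∫⁻ u, g ⌊u * P⌋₊ ∂unitMeasure = (P : ENNReal)⁻¹ * ∑ j ∈ Finset.range P, g j := by
  rw [← lintegral_map (measurable_of_countable g) (measurable_floor_mul P), map_floor_mul hP,
    lintegral_smul_measure, lintegral_finsetSum_measure]
  simp

lemma integral_floor_mul {P : ℕ} (hP : 0 < P) (g : ℕ → ℂ) :
    ∫ u, g ⌊u * P⌋₊ ∂unitMeasure = (P : ℂ)⁻¹ * ∑ j ∈ Finset.range P, g j := by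
  rw [← integral_map (measurable_floor_mul P).aemeasurable (measurable_of_countable g).aestronglyMeasurable,
    map_floor_mul hP, integral_smul_measure, integral_finsetSum_measure]
  · simp
  · intro i _
    exact integrable_dirac (by simp)

lemma unitMeasure_floor_mem {P : ℕ} (hP : 0 < P) (J : Finset ℕ) (hJ : J ⊆ Finset.range P) :
    unitMeasure {u | ⌊u * P⌋₊ ∈ J} = (P : ENNReal)⁻¹ * J.card := by
  have h := lintegral_floor_mul hP ((J : Set ℕ).indicator 1)
  have h1 : (fun u : ℝ => (J : Set ℕ).indicator (1 : ℕ → ENNReal) ⌊u * P⌋₊) =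
      indicator {u : ℝ | ⌊u * P⌋₊ ∈ J} 1 := by
    funext u; simp [indicator_apply]
  have h2 : MeasurableSet {u : ℝ | ⌊u * P⌋₊ ∈ J} := measurable_floor_mul P J.measurableSet
  rw [h1, lintegral_indicator_one h2] at h
  rw [h]
  congr 1
  rw [← Finset.sum_subset hJ (fun j _ hj => by simp [hj]),
    Finset.sum_congr rfl (g := fun _ => 1) (fun j hj => by simp [hj])]
  simp

/-- The left end points of the intervals, listed in the order of the parameter `u`. -/
noncomputable def approxParam (s : ℝ) (x : ℕ → ℕ → ℕ) (n : ℕ) (u : ℝ) : ℝ :=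
  1 + x n ⌊u * numCells s n⌋₊ / 2 ^ n

/-- The parametrization of the limit set. -/
noncomputable def limitParam (s : ℝ) (x : ℕ → ℕ → ℕ) (u : ℝ) : ℝ := ⨆ n, approxParam s x n u

/-- The limit measure of the construction. -/
noncomputable def limitMeasure (s : ℝ) (x : ℕ → ℕ → ℕ) : Measure ℝ := unitMeasure.map (limitParam s x)

lemma measurable_approxParam (s : ℝ) (x : ℕ → ℕ → ℕ) (n : ℕ) : Measurable (approxParam s x n) := by
  have h : Measurable fun j : ℕ => (1 + x n j / 2 ^ n : ℝ) := measurable_of_countable _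
  exact h.comp (measurable_floor_mul (numCells s n))

lemma measurable_limitParam (s : ℝ) (x : ℕ → ℕ → ℕ) : Measurable (limitParam s x) :=
  Measurable.iSup fun n => measurable_approxParam s x n

instance (s : ℝ) (x : ℕ → ℕ → ℕ) : IsProbabilityMeasure (limitMeasure s x) :=
  Measure.isProbabilityMeasure_map (measurable_limitParam s x).aemeasurable

namespace IsConstruction

variable {s B : ℝ} {x : ℕ → ℕ → ℕ}

lemma numCells_succ_eq_mul (hs0 : 0 ≤ s) (hs1 : s ≤ 1) (n : ℕ) : 0 < numCells s (n + 1) / numCells s n ∧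
    numCells s (n + 1) = (numCells s (n + 1) / numCells s n) * numCells s n := by
  have hP := numCells_pos s n
  rcases numCells_succ_eq hs0 hs1 n with h | h <;> rw [h, Nat.mul_div_cancel _ hP] <;> simp

lemma next_floor (hx : IsConstruction s B x) (hs0 : 0 ≤ s) (hs1 : s ≤ 1) (n : ℕ) (u : ℝ) :
    x (n + 1) ⌊u * numCells s (n + 1)⌋₊ / 2 = x n ⌊u * numCells s n⌋₊ := by
  rw [hx.div_two, ← Nat.floor_div_natCast]
  obtain ⟨h1, h2⟩ := numCells_succ_eq_mul hs0 hs1 n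
  have h3 : ((numCells s (n + 1) / numCells s n : ℕ) : ℝ) ≠ 0 := by exact_mod_cast h1.ne'
  congr 2
  have h4 : (numCells s (n + 1) : ℝ) = ((numCells s (n + 1) / numCells s n : ℕ) : ℝ) * numCells s n := by
    exact_mod_cast h2
  rw [h4]
  field_simp

lemma approxParam_succ (hx : IsConstruction s B x) (hs0 : 0 ≤ s) (hs1 : s ≤ 1) (n : ℕ) (u : ℝ) :
    approxParam s x n u ≤ approxParam s x (n + 1) u ∧
      approxParam s x (n + 1) u ≤ approxParam s x n u + 1 / 2 ^ (n + 1) := by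
  have h := hx.next_floor hs0 hs1 n u
  unfold approxParam
  set i := x (n + 1) ⌊u * numCells s (n + 1)⌋₊
  set j := x n ⌊u * numCells s n⌋₊
  have h1 : 2 * j ≤ i := by omega
  have h2 : i ≤ 2 * j + 1 := by omega
  have h1' : (2 * j : ℝ) ≤ i := by exact_mod_cast h1
  have h2' : (i : ℝ) ≤ 2 * j + 1 := by exact_mod_cast h2
  have e : (j : ℝ) / 2 ^ n = 2 * j / 2 ^ (n + 1) := by rw [pow_succ]; field_simp
  rw [e]
  constructor
  · gcongr
  · rw [add_assoc, ← add_div]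
    gcongr

lemma approxParam_add_le (hx : IsConstruction s B x) (hs0 : 0 ≤ s) (hs1 : s ≤ 1) (n k : ℕ) (u : ℝ) :
    approxParam s x (n + k) u ≤ approxParam s x n u + 1 / 2 ^ n - 1 / 2 ^ (n + k) := by
  induction k with
  | zero => simp
  | succ k ih =>
    have h := (hx.approxParam_succ hs0 hs1 (n + k) u).2
    rw [← add_assoc]
    have : (1 : ℝ) / 2 ^ (n + k) = 2 * (1 / 2 ^ (n + k + 1)) := by rw [pow_succ]; field_simp
    linarith

lemma approxParam_mono (hx : IsConstruction s B x) (hs0 : 0 ≤ s) (hs1 : s ≤ 1) (u : ℝ) :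
    Monotone fun n => approxParam s x n u :=
  monotone_nat_of_le_succ fun n => (hx.approxParam_succ hs0 hs1 n u).1

lemma approxParam_le (hx : IsConstruction s B x) (hs0 : 0 ≤ s) (hs1 : s ≤ 1) (n m : ℕ) (u : ℝ) :
    approxParam s x m u ≤ approxParam s x n u + 1 / 2 ^ n := by
  have h2 : (0 : ℝ) < 1 / 2 ^ n := by positivity
  rcases le_total m n with h | h
  · have := hx.approxParam_mono hs0 hs1 u h
    simp only at this
    linarith
  · obtain ⟨k, rfl⟩ := Nat.exists_eq_add_of_le h
    have h1 := hx.approxParam_add_le hs0 hs1 n k u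
    have : (0 : ℝ) < 1 / 2 ^ (n + k) := by positivity
    linarith

lemma bddAbove_approxParam (hx : IsConstruction s B x) (hs0 : 0 ≤ s) (hs1 : s ≤ 1) (u : ℝ) :
    BddAbove (range fun n => approxParam s x n u) :=
  ⟨approxParam s x 0 u + 1 / 2 ^ 0, by rintro _ ⟨m, rfl⟩; exact hx.approxParam_le hs0 hs1 0 m u⟩

lemma approxParam_le_limitParam (hx : IsConstruction s B x) (hs0 : 0 ≤ s) (hs1 : s ≤ 1) (n : ℕ) (u : ℝ) :
    approxParam s x n u ≤ limitParam s x u := le_ciSup (hx.bddAbove_approxParam hs0 hs1 u) n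

lemma limitParam_le (hx : IsConstruction s B x) (hs0 : 0 ≤ s) (hs1 : s ≤ 1) (n : ℕ) (u : ℝ) :
    limitParam s x u ≤ approxParam s x n u + 1 / 2 ^ n :=
  ciSup_le fun m => hx.approxParam_le hs0 hs1 n m u

lemma limitParam_mem (hx : IsConstruction s B x) (hs0 : 0 ≤ s) (hs1 : s ≤ 1) {u : ℝ} (hu : u ∈ Ico (0 : ℝ) 1) :
    limitParam s x u ∈ Icc (1 : ℝ) 2 := by
  have h1 := hx.approxParam_le_limitParam hs0 hs1 0 u
  have h2 := hx.limitParam_le hs0 hs1 0 u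
  have h3 := (hx.stage 0).lt 0 (numCells_pos s 0)
  have h4 : ⌊u * (numCells s 0 : ℝ)⌋₊ = 0 := by
    rw [numCells_zero, Nat.cast_one, mul_one]; exact Nat.floor_eq_zero.2 hu.2
  have h5 : approxParam s x 0 u = 1 := by
    unfold approxParam
    rw [h4, show x 0 0 = 0 by simpa using h3]; simp
  rw [h5] at h1 h2
  refine ⟨h1, by norm_num at h2; exact h2⟩

lemma tendsto_approxParam (hx : IsConstruction s B x) (hs0 : 0 ≤ s) (hs1 : s ≤ 1) (u : ℝ) :
    Filter.Tendsto (fun n => approxParam s x n u) Filter.atTop (nhds (limitParam s x u)) :=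
  tendsto_atTop_ciSup (hx.approxParam_mono hs0 hs1 u) (hx.bddAbove_approxParam hs0 hs1 u)

end IsConstruction

lemma isClosed_msupport (ν : Measure ℝ) : IsClosed (msupport ν) := by
  rw [← isOpen_compl_iff, Metric.isOpen_iff]
  intro x hx
  simp only [msupport, mem_compl_iff, mem_ofPred_eq, not_forall, not_lt] at hx
  obtain ⟨ε, hε, h⟩ := hx
  refine ⟨ε / 2, by positivity, fun y hy => ?_⟩
  simp only [msupport, mem_compl_iff, mem_ofPred_eq, not_forall, not_lt]
  refine ⟨ε / 2, by positivity, (measure_mono (Metric.ball_subset_ball' ?_)).trans h⟩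
  rw [Metric.mem_ball] at hy; linarith

namespace IsConstruction

variable {s B : ℝ} {x : ℕ → ℕ → ℕ}

lemma limitMeasure_apply {S : Set ℝ} (hS : MeasurableSet S) :
    limitMeasure s x S = unitMeasure (limitParam s x ⁻¹' S) :=
  Measure.map_apply (measurable_limitParam s x) hS

lemma ae_unitMeasure_mem : ∀ᵐ u ∂unitMeasure, u ∈ Ico (0 : ℝ) 1 := ae_restrict_mem measurableSet_Ico

lemma msupport_limitMeasure_subset (hx : IsConstruction s B x) (hs0 : 0 ≤ s) (hs1 : s ≤ 1) :
    msupport (limitMeasure s x) ⊆ Icc 1 2 := by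
  intro y hy
  by_contra h
  obtain ⟨ε, hε, h2⟩ := Metric.isOpen_iff.1 isClosed_Icc.isOpen_compl y h
  refine (hy ε hε).ne' ?_
  rw [limitMeasure_apply Metric.isOpen_ball.measurableSet, measure_eq_zero_iff_ae_notMem]
  filter_upwards [ae_unitMeasure_mem] with u hu h3
  exact h2 h3 (hx.limitParam_mem hs0 hs1 hu)

lemma isCompact_msupport (hx : IsConstruction s B x) (hs0 : 0 ≤ s) (hs1 : s ≤ 1) :
    IsCompact (msupport (limitMeasure s x)) :=
  isCompact_Icc.of_isClosed_subset (isClosed_msupport _) (hx.msupport_limitMeasure_subset hs0 hs1)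

lemma le_limitMeasure_Icc (hx : IsConstruction s B x) (hs0 : 0 ≤ s) (hs1 : s ≤ 1) {y : ℝ}
    (hy : y ∈ msupport (limitMeasure s x)) {r : ℝ} (hr : 0 < r) {n : ℕ} (hn : 1 / 2 ^ n ≤ r / 2) :
    (numCells s n : ENNReal)⁻¹ ≤ limitMeasure s x (Icc (y - r) (y + r)) := by
  have h1 := hy (r / 2) (by positivity)
  rw [limitMeasure_apply Metric.isOpen_ball.measurableSet] at h1
  have h2 : (limitParam s x ⁻¹' Metric.ball y (r / 2) ∩ Ico 0 1).Nonempty := by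
    by_contra h
    rw [not_nonempty_iff_eq_empty] at h
    refine h1.ne' ?_
    rw [measure_eq_zero_iff_ae_notMem]
    filter_upwards [ae_unitMeasure_mem] with u hu h3
    have : u ∈ limitParam s x ⁻¹' Metric.ball y (r / 2) ∩ Ico 0 1 := ⟨h3, hu⟩
    rw [h] at this; exact this
  obtain ⟨u, hu, hu2⟩ := h2
  have hP := numCells_pos s n
  have hj : ⌊u * numCells s n⌋₊ ∈ Finset.range (numCells s n) := by
    have hPr : (0 : ℝ) < numCells s n := by exact_mod_cast hP
    rw [Finset.mem_range, Nat.floor_lt (mul_nonneg hu2.1 hPr.le)]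
    nlinarith [hu2.2]
  have h3 := unitMeasure_floor_mem hP {⌊u * numCells s n⌋₊} (Finset.singleton_subset_iff.2 hj)
  rw [Finset.card_singleton, Nat.cast_one, mul_one] at h3
  rw [← h3, limitMeasure_apply measurableSet_Icc]
  refine measure_mono fun v hv => ?_
  rw [mem_ofPred_eq, Finset.mem_singleton] at hv
  have e : approxParam s x n v = approxParam s x n u := by unfold approxParam; rw [hv]
  have a1 := hx.approxParam_le_limitParam hs0 hs1 n u
  have a2 := hx.approxParam_le_limitParam hs0 hs1 n v
  have a3 := hx.limitParam_le hs0 hs1 n u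
  have a4 := hx.limitParam_le hs0 hs1 n v
  rw [mem_preimage, Metric.mem_ball, Real.dist_eq, abs_lt] at hu
  rw [mem_preimage, mem_Icc]
  constructor <;> linarith

lemma limitMeasure_Icc_le (hx : IsConstruction s B x) (hs0 : 0 ≤ s) (hs1 : s ≤ 1) (y : ℝ)
    {r : ℝ} {n : ℕ} (hn : r * 2 ^ n ≤ 2) :
    limitMeasure s x (Icc (y - r) (y + r)) ≤ (numCells s n : ENNReal)⁻¹ * 6 := by
  have hP := numCells_pos s n
  have hn2 : (0 : ℝ) < 2 ^ n := by positivity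
  set J := (Finset.range (numCells s n)).filter
    fun j => (y - r - 1) * 2 ^ n - 1 ≤ (x n j : ℝ) ∧ (x n j : ℝ) ≤ (y + r - 1) * 2 ^ n with hJ
  have h1 := unitMeasure_floor_mem hP J (Finset.filter_subset _ _)
  have hcard : J.card ≤ 6 := by
    have h2 : (J.image fun j => (x n j : ℤ)) ⊆
        Finset.Icc ⌈(y - r - 1) * 2 ^ n - 1⌉ ⌊(y + r - 1) * 2 ^ n⌋ := by
      intro k hk
      obtain ⟨j, hj, rfl⟩ := Finset.mem_image.1 hk
      have := (Finset.mem_filter.1 hj).2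
      rw [Finset.mem_Icc, Int.ceil_le, Int.le_floor]
      exact_mod_cast this
    have h3 := Finset.card_le_card h2
    rw [Finset.card_image_of_injOn, Int.card_Icc] at h3
    · refine h3.trans ?_
      rw [Int.toNat_le]
      have e1 := Int.floor_le ((y + r - 1) * 2 ^ n)
      have e2 := Int.le_ceil ((y - r - 1) * 2 ^ n - 1)
      have e3 : ((⌊(y + r - 1) * 2 ^ n⌋ - ⌈(y - r - 1) * 2 ^ n - 1⌉ : ℤ) : ℝ) ≤ (5 : ℤ) := by
        push_cast; nlinarith
      have e4 := Int.cast_le.1 e3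
      push_cast
      linarith
    · intro j hj k hk h
      rw [Finset.mem_coe, hJ, Finset.mem_filter, Finset.mem_range] at hj hk
      exact (hx.stage n).inj j hj.1 k hk.1 (Nat.cast_injective (R := ℤ) h)
  rw [limitMeasure_apply measurableSet_Icc]
  calc unitMeasure (limitParam s x ⁻¹' Icc (y - r) (y + r)) ≤
        unitMeasure {u | ⌊u * numCells s n⌋₊ ∈ J} := by
        refine measure_mono_ae ?_
        filter_upwards [ae_unitMeasure_mem] with u hu hv
        have a1 := hx.approxParam_le_limitParam hs0 hs1 n u
        have a3 := hx.limitParam_le hs0 hs1 n u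
        have hv' : limitParam s x u ∈ Icc (y - r) (y + r) := hv
        change ⌊u * numCells s n⌋₊ ∈ J
        rw [hJ, Finset.mem_filter, Finset.mem_range]
        refine ⟨?_, ?_⟩
        · have hPr : (0 : ℝ) < numCells s n := by exact_mod_cast hP
          rw [Nat.floor_lt (mul_nonneg hu.1 hPr.le)]
          nlinarith [hu.2]
        · unfold approxParam at a1 a3
          set j := x n ⌊u * numCells s n⌋₊
          constructor
          · have : y - r - 1 - 1 / 2 ^ n ≤ j / 2 ^ n := by linarith [hv'.1]
            rw [le_div_iff₀ hn2, sub_mul _ (1 / 2 ^ n), one_div, inv_mul_cancel₀ hn2.ne'] at this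
            exact this
          · have : (j : ℝ) / 2 ^ n ≤ y + r - 1 := by linarith [hv'.2]
            rwa [div_le_iff₀ hn2] at this
    _ = (numCells s n : ENNReal)⁻¹ * J.card := h1
    _ ≤ _ := by
        gcongr
        exact_mod_cast hcard

lemma isAhlforsRegular (hx : IsConstruction s B x) (hs0 : 0 ≤ s) (hs1 : s ≤ 1) :
    IsAhlforsRegular (limitMeasure s x) s := by
  refine ⟨24, by norm_num, fun y hy r hr hr1 => ⟨?_, ?_⟩⟩
  · obtain ⟨n, hn1, hn2⟩ := exists_nat_pow_near (x := 4 / r) (y := 2) (by rw [le_div_iff₀ hr]; linarith)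
      one_lt_two
    rw [le_div_iff₀ hr] at hn1
    rw [div_lt_iff₀ hr] at hn2
    have hn : (0 : ℝ) < 2 ^ n := by positivity
    have hPr : (0 : ℝ) < numCells s n := by exact_mod_cast numCells_pos s n
    refine le_trans ?_ (hx.le_limitMeasure_Icc hs0 hs1 hy hr (n := n) ?_)
    · rw [← ENNReal.ofReal_natCast, ← ENNReal.ofReal_inv_of_pos hPr]
      refine ENNReal.ofReal_le_ofReal ?_
      have h1 := numCells_le hs0 n
      have h2 : (2 : ℝ) ^ ((n : ℝ) * s) * r ^ s ≤ 4 := by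
        rw [Real.rpow_mul two_pos.le, Real.rpow_natCast, ← Real.mul_rpow (by positivity) hr.le]
        calc (2 ^ n * r) ^ s ≤ (4 : ℝ) ^ s := Real.rpow_le_rpow (by positivity) hn1 hs0
          _ ≤ 4 ^ (1 : ℝ) := Real.rpow_le_rpow_of_exponent_le (by norm_num) hs1
          _ = 4 := Real.rpow_one 4
      have h3 : 0 < r ^ s := by positivity
      rw [inv_eq_one_div, inv_eq_one_div, div_mul_eq_mul_div, div_le_div_iff₀ (by norm_num) hPr]
      nlinarith
    · rw [div_le_div_iff₀ hn two_pos]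
      rw [pow_succ] at hn2
      linarith
  · obtain ⟨n, hn1, hn2⟩ := exists_nat_pow_near (x := 1 / r) (y := 2) (by rw [le_div_iff₀ hr]; linarith)
      one_lt_two
    rw [le_div_iff₀ hr] at hn1
    rw [div_lt_iff₀ hr] at hn2
    refine (hx.limitMeasure_Icc_le hs0 hs1 y (r := r) (n := n) (by linarith)).trans ?_
    have hPr : (0 : ℝ) < numCells s n := by exact_mod_cast numCells_pos s n
    rw [← ENNReal.ofReal_natCast, ← ENNReal.ofReal_inv_of_pos hPr,
      show (6 : ENNReal) = ENNReal.ofReal 6 by simp, ← ENNReal.ofReal_mul (by positivity)]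
    refine ENNReal.ofReal_le_ofReal ?_
    have h1 := le_two_mul_numCells s n
    have hn : (0 : ℝ) < 2 ^ n := by positivity
    have h2 : 1 ≤ 2 * ((2 : ℝ) ^ ((n : ℝ) * s) * r ^ s) := by
      rw [Real.rpow_mul two_pos.le, Real.rpow_natCast, ← Real.mul_rpow (by positivity) hr.le]
      refine le_trans ?_ (rpow_le_two_mul hs0 hs1 zero_le_one (by positivity) ?_)
      · rw [Real.one_rpow]
      · rw [pow_succ] at hn2; linarith
    have h3 : 0 < r ^ s := by positivity
    rw [← div_eq_inv_mul, div_le_iff₀ hPr]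
    nlinarith

end IsConstruction

/-- The Fourier transform of the uniform measure on the unit interval. -/
noncomputable def boxFourier (τ : ℝ) : ℂ := (Complex.exp (τ * Complex.I) - 1) / (τ * Complex.I)

lemma norm_ofReal_mul_I (τ : ℝ) : ‖(τ * Complex.I : ℂ)‖ = |τ| := by simp

lemma norm_boxFourier_le_one {τ : ℝ} (hτ : τ ≠ 0) : ‖boxFourier τ‖ ≤ 1 := by
  unfold boxFourier
  rw [norm_div, norm_ofReal_mul_I, div_le_one (abs_pos.2 hτ), mul_comm]
  exact Real.norm_exp_I_mul_ofReal_sub_one_le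

lemma norm_boxFourier_le_div (τ : ℝ) : ‖boxFourier τ‖ ≤ 2 / |τ| := by
  unfold boxFourier
  rw [norm_div, norm_ofReal_mul_I]
  gcongr
  refine (norm_sub_le _ _).trans ?_
  rw [Complex.norm_exp_ofReal_mul_I, norm_one]; norm_num

lemma norm_boxFourier_le_rpow {τ β : ℝ} (hτ : τ ≠ 0) (hβ : 0 ≤ β) (hβ1 : β ≤ 1) :
    ‖boxFourier τ‖ ≤ (2 / |τ|) ^ β := by
  have hp : 0 < 2 / |τ| := div_pos two_pos (abs_pos.2 hτ)
  rcases le_total (2 / |τ|) 1 with h | h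
  · refine (norm_boxFourier_le_div τ).trans ?_
    calc 2 / |τ| = (2 / |τ|) ^ (1 : ℝ) := (Real.rpow_one _).symm
      _ ≤ _ := Real.rpow_le_rpow_of_exponent_ge hp h hβ1
  · exact (norm_boxFourier_le_one hτ).trans (Real.one_le_rpow h hβ)

lemma boxFourier_two_mul {τ : ℝ} (hτ : τ ≠ 0) :
    boxFourier (2 * τ) = (1 + Complex.exp (τ * Complex.I)) / 2 * boxFourier τ := by
  unfold boxFourier
  have h : (τ : ℂ) ≠ 0 := by exact_mod_cast hτ
  have e : Complex.exp ((2 * τ : ℝ) * Complex.I) = Complex.exp (τ * Complex.I) ^ 2 := by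
    rw [← Complex.exp_nat_mul]; push_cast; ring_nf
  rw [e]
  push_cast
  field_simp
  ring

lemma tendsto_boxFourier {τ : ℝ} (hτ : τ ≠ 0) :
    Filter.Tendsto (fun n : ℕ => boxFourier (τ / 2 ^ n)) Filter.atTop (nhds 1) := by
  have h0 : Filter.Tendsto (fun n : ℕ => |τ / 2 ^ n|) Filter.atTop (nhds 0) := by
    have := (tendsto_pow_atTop_nhds_zero_of_lt_one (r := (1 / 2 : ℝ)) (by norm_num) (by norm_num)).const_mul |τ|
    rw [mul_zero] at this
    refine this.congr fun n => ?_
    rw [abs_div, abs_of_pos (by positivity : (0 : ℝ) < 2 ^ n), one_div_pow]; ring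
  rw [tendsto_iff_norm_sub_tendsto_zero]
  refine squeeze_zero' (Filter.Eventually.of_forall fun _ => norm_nonneg _) ?_ h0
  filter_upwards [h0.eventually_le_const zero_lt_one] with n hn
  have h1 : τ / 2 ^ n ≠ 0 := by positivity
  have h2 : ((τ / 2 ^ n : ℝ) : ℂ) ≠ 0 := by exact_mod_cast h1
  set t := τ / 2 ^ n
  have h3 : boxFourier t - 1 = (Complex.exp (t * Complex.I) - 1 - t * Complex.I) / (t * Complex.I) := by
    unfold boxFourier
    field_simp
  rw [h3, norm_div, norm_ofReal_mul_I, div_le_iff₀ (abs_pos.2 h1)]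
  have := Complex.norm_exp_sub_one_sub_id_le (x := t * Complex.I) (by rwa [norm_ofReal_mul_I])
  rw [norm_ofReal_mul_I] at this
  rwa [← sq]

lemma norm_sum_parity_le {P : ℕ} {x : ℕ → ℕ} {θ K : ℝ}
    (h : ∀ l < 4, paritySum P x θ ((l : ℕ) * (Real.pi / 2)) ≤ K) :
    ‖∑ j ∈ Finset.range P, (-1 : ℂ) ^ x j *
      Complex.exp ((2 * Real.pi * θ * (x j / 2 : ℕ) : ℝ) * Complex.I)‖ ≤ 2 * K := by
  have hre : ∀ j, ((-1 : ℂ) ^ x j * Complex.exp ((2 * Real.pi * θ * (x j / 2 : ℕ) : ℝ) * Complex.I)).re =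
      (-1) ^ x j * Real.cos (2 * Real.pi * θ * (x j / 2 : ℕ)) := by
    intro j
    rw [show (-1 : ℂ) ^ x j = (((-1) ^ x j : ℝ) : ℂ) by push_cast; rfl, Complex.re_ofReal_mul,
      Complex.exp_ofReal_mul_I_re]
  have him : ∀ j, ((-1 : ℂ) ^ x j * Complex.exp ((2 * Real.pi * θ * (x j / 2 : ℕ) : ℝ) * Complex.I)).im =
      (-1) ^ x j * Real.sin (2 * Real.pi * θ * (x j / 2 : ℕ)) := by
    intro j
    rw [show (-1 : ℂ) ^ x j = (((-1) ^ x j : ℝ) : ℂ) by push_cast; rfl, Complex.im_ofReal_mul,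
      Complex.exp_ofReal_mul_I_im]
  refine (Complex.norm_le_abs_re_add_abs_im _).trans ?_
  rw [two_mul K]
  rw [Complex.re_sum, Complex.im_sum, Finset.sum_congr rfl fun j _ => hre j,
    Finset.sum_congr rfl fun j _ => him j]
  have h0 := h 0 (by norm_num)
  have h1 := h 1 (by norm_num)
  have h2 := h 2 (by norm_num)
  have h3 := h 3 (by norm_num)
  unfold paritySum at h0 h1 h2 h3
  simp only [Nat.cast_zero, zero_mul, add_zero] at h0
  simp only [Nat.cast_one, one_mul, Real.cos_add_pi_div_two, mul_neg, Finset.sum_neg_distrib] at h1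
  simp only [show ((2 : ℕ) : ℝ) * (Real.pi / 2) = Real.pi by push_cast; ring, Real.cos_add_pi,
    mul_neg, Finset.sum_neg_distrib] at h2
  simp only [show ∀ t : ℝ, t + ((3 : ℕ) : ℝ) * (Real.pi / 2) = t + Real.pi + Real.pi / 2 by
    intro t; push_cast; ring, Real.cos_add_pi_div_two, Real.sin_add_pi, neg_neg] at h3
  have hc := abs_le.2 ⟨neg_le.2 h2, h0⟩
  have hd := abs_le.2 ⟨neg_le.2 h1, h3⟩
  exact add_le_add hc hd

namespace IsConstruction

variable {s B : ℝ} {x : ℕ → ℕ → ℕ}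

/-- The Fourier transform of the approximating measures. -/
noncomputable def approxFourier (s : ℝ) (x : ℕ → ℕ → ℕ) (n : ℕ) (τ : ℝ) : ℂ :=
  (numCells s n : ℂ)⁻¹ * (∑ j ∈ Finset.range (numCells s n),
    Complex.exp ((τ * (1 + x n j / 2 ^ n) : ℝ) * Complex.I)) * boxFourier (τ / 2 ^ n)

lemma approxFourier_succ_sub (hx : IsConstruction s B x) (hs0 : 0 ≤ s) (hs1 : s ≤ 1) (n : ℕ) {τ : ℝ}
    (hτ : τ ≠ 0) : approxFourier s x (n + 1) τ - approxFourier s x n τ =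
      (numCells s (n + 1) : ℂ)⁻¹ * boxFourier (τ / 2 ^ (n + 1)) *
      ((1 - Complex.exp ((τ / 2 ^ (n + 1) : ℝ) * Complex.I)) / 2) * Complex.exp (τ * Complex.I) *
      ∑ j ∈ Finset.range (numCells s (n + 1)), (-1 : ℂ) ^ x (n + 1) j *
      Complex.exp ((2 * Real.pi * (τ / 2 ^ n / (2 * Real.pi)) * (x (n + 1) j / 2 : ℕ) : ℝ) * Complex.I) := by
  obtain ⟨hm, hmP⟩ := numCells_succ_eq_mul hs0 hs1 n
  have hdiv := hx.div_two n
  set m := numCells s (n + 1) / numCells s n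
  have hm' : (m : ℂ) ≠ 0 := by exact_mod_cast hm.ne'
  have hP' : (numCells s n : ℂ) ≠ 0 := by exact_mod_cast (numCells_pos s n).ne'
  have h1 : (numCells s n : ℂ)⁻¹ * (∑ j ∈ Finset.range (numCells s n),
      Complex.exp ((τ * (1 + x n j / 2 ^ n) : ℝ) * Complex.I)) =
      (numCells s (n + 1) : ℂ)⁻¹ * (∑ j ∈ Finset.range (numCells s (n + 1)),
      Complex.exp ((τ * (1 + (x (n + 1) j / 2 : ℕ) / 2 ^ n) : ℝ) * Complex.I)) := by
    simp only [hdiv]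
    rw [hmP, sum_range_mul_div hm (numCells s n)
      (fun j => Complex.exp ((τ * (1 + x n j / 2 ^ n) : ℝ) * Complex.I))]
    generalize ∑ i ∈ Finset.range (numCells s n), Complex.exp ((τ * (1 + x n i / 2 ^ n) : ℝ) * Complex.I) = S
    rw [nsmul_eq_mul, Nat.cast_mul]
    field_simp
  have h2 : boxFourier (τ / 2 ^ n) = (1 + Complex.exp ((τ / 2 ^ (n + 1) : ℝ) * Complex.I)) / 2 *
      boxFourier (τ / 2 ^ (n + 1)) := by
    rw [← boxFourier_two_mul (by positivity)]
    congr 1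
    rw [pow_succ]; field_simp
  unfold approxFourier
  rw [h1, h2]
  set w := Complex.exp ((τ / 2 ^ (n + 1) : ℝ) * Complex.I) with hw
  set b := boxFourier (τ / 2 ^ (n + 1))
  set Q := (numCells s (n + 1) : ℂ)⁻¹
  have h3 : ∀ j, Complex.exp ((τ * (1 + x (n + 1) j / 2 ^ (n + 1)) : ℝ) * Complex.I) -
      Complex.exp ((τ * (1 + (x (n + 1) j / 2 : ℕ) / 2 ^ n) : ℝ) * Complex.I) * ((1 + w) / 2) =
      (1 - w) / 2 * Complex.exp (τ * Complex.I) * ((-1 : ℂ) ^ x (n + 1) j *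
      Complex.exp ((2 * Real.pi * (τ / 2 ^ n / (2 * Real.pi)) * (x (n + 1) j / 2 : ℕ) : ℝ) * Complex.I)) := by
    intro j
    set i := x (n + 1) j
    have e1 : Complex.exp ((τ * (1 + (i / 2 : ℕ) / 2 ^ n) : ℝ) * Complex.I) = Complex.exp (τ * Complex.I) *
        Complex.exp ((2 * Real.pi * (τ / 2 ^ n / (2 * Real.pi)) * (i / 2 : ℕ) : ℝ) * Complex.I) := by
      rw [← Complex.exp_add, ← add_mul, ← Complex.ofReal_add]
      congr 3
      have := Real.pi_ne_zero
      field_simp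
    have e2 : Complex.exp ((τ * (1 + i / 2 ^ (n + 1)) : ℝ) * Complex.I) =
        Complex.exp ((τ * (1 + (i / 2 : ℕ) / 2 ^ n) : ℝ) * Complex.I) * w ^ (i % 2) := by
      rw [hw, ← Complex.exp_nat_mul, ← Complex.exp_add]
      congr 1
      have h4 : (i : ℝ) = 2 * (i / 2 : ℕ) + (i % 2 : ℕ) := by exact_mod_cast (Nat.div_add_mod i 2).symm
      have h5 : τ * (1 + i / 2 ^ (n + 1)) =
          τ * (1 + (i / 2 : ℕ) / 2 ^ n) + (i % 2 : ℕ) * (τ / 2 ^ (n + 1)) := by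
        rw [pow_succ]; field_simp; linarith
      rw [h5]
      push_cast; ring
    have e3 : w ^ (i % 2) - (1 + w) / 2 = (-1) ^ i * ((1 - w) / 2) := by
      rcases Nat.even_or_odd i with h | h
      · rw [Nat.even_iff.1 h, h.neg_one_pow]; ring
      · rw [Nat.odd_iff.1 h, h.neg_one_pow]; ring
    rw [e2, ← mul_sub, e3, e1]; ring
  calc _ = Q * b * ∑ j ∈ Finset.range (numCells s (n + 1)),
        (Complex.exp ((τ * (1 + x (n + 1) j / 2 ^ (n + 1)) : ℝ) * Complex.I) -
        Complex.exp ((τ * (1 + (x (n + 1) j / 2 : ℕ) / 2 ^ n) : ℝ) * Complex.I) * ((1 + w) / 2)) := by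
        rw [Finset.sum_sub_distrib, ← Finset.sum_mul]; ring
    _ = _ := by
        rw [Finset.sum_congr rfl fun j _ => h3 j, ← Finset.mul_sum]; ring

lemma norm_approxFourier_succ_sub_le (hx : IsConstruction s B x) (hs0 : 0 ≤ s) (hs1 : s ≤ 1) (n : ℕ)
    {τ : ℝ} (hτ : τ ≠ 0) : ‖approxFourier s x (n + 1) τ - approxFourier s x n τ‖ ≤
      18 * ((n : ℝ) + 1) / √(numCells s n) * ‖boxFourier (τ / 2 ^ (n + 1))‖ := by
  have hP : (0 : ℝ) < numCells s n := by exact_mod_cast numCells_pos s n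
  have hPP : (numCells s n : ℝ) ≤ numCells s (n + 1) := by
    obtain ⟨hm, hmP⟩ := numCells_succ_eq_mul hs0 hs1 n
    rw [hmP]
    exact_mod_cast Nat.le_mul_of_pos_left _ hm
  rw [hx.approxFourier_succ_sub hs0 hs1 n hτ]
  have h1 := norm_sum_parity_le (hx.parity_le n (τ / 2 ^ n / (2 * Real.pi)))
  have h2 : ‖(1 - Complex.exp ((τ / 2 ^ (n + 1) : ℝ) * Complex.I)) / 2‖ ≤ 1 := by
    rw [norm_div, Complex.norm_ofNat, div_le_one two_pos]
    refine (norm_sub_le _ _).trans ?_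
    rw [Complex.norm_exp_ofReal_mul_I, norm_one]; norm_num
  rw [norm_mul, norm_mul, norm_mul, norm_mul, Complex.norm_exp_ofReal_mul_I, norm_inv, Complex.norm_natCast,
    mul_one]
  calc _ ≤ (numCells s n : ℝ)⁻¹ * ‖boxFourier (τ / 2 ^ (n + 1))‖ * 1 *
        (2 * (9 * ((n : ℝ) + 1) * √(numCells s n))) := by gcongr
    _ = _ := by
        have : (numCells s n : ℝ)⁻¹ = (√(numCells s n))⁻¹ * (√(numCells s n))⁻¹ := by
          rw [← mul_inv, Real.mul_self_sqrt hP.le]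
        rw [this]
        have h3 : √(numCells s n : ℝ) ≠ 0 := (Real.sqrt_pos.2 hP).ne'
        field_simp
        ring

end IsConstruction

namespace IsConstruction

variable {s B : ℝ} {x : ℕ → ℕ → ℕ}

lemma approxFourier_eq_integral (s : ℝ) (x : ℕ → ℕ → ℕ) (n : ℕ) (τ : ℝ) :
    approxFourier s x n τ =
      (∫ u, Complex.exp ((τ * approxParam s x n u : ℝ) * Complex.I) ∂unitMeasure) * boxFourier (τ / 2 ^ n) := by
  rw [approxFourier, ← integral_floor_mul (numCells_pos s n)
    (fun j => Complex.exp ((τ * (1 + x n j / 2 ^ n) : ℝ) * Complex.I))]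
  rfl

lemma tendsto_approxFourier (hx : IsConstruction s B x) (hs0 : 0 ≤ s) (hs1 : s ≤ 1) {τ : ℝ} (hτ : τ ≠ 0) :
    Filter.Tendsto (fun n => approxFourier s x n τ) Filter.atTop
      (nhds (∫ y, Complex.exp ((τ * y : ℝ) * Complex.I) ∂limitMeasure s x)) := by
  have hc : Continuous fun y : ℝ => Complex.exp ((τ * y : ℝ) * Complex.I) := by fun_prop
  have h : Filter.Tendsto
      (fun n => ∫ u, Complex.exp ((τ * approxParam s x n u : ℝ) * Complex.I) ∂unitMeasure) Filter.atTop
      (nhds (∫ u, Complex.exp ((τ * limitParam s x u : ℝ) * Complex.I) ∂unitMeasure)) := by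
    refine tendsto_integral_of_dominated_convergence (fun _ => 1)
      (fun n => (hc.measurable.comp (measurable_approxParam s x n)).aestronglyMeasurable)
      (integrable_const 1) (fun n => ?_) ?_
    · exact Filter.Eventually.of_forall fun u => (Complex.norm_exp_ofReal_mul_I _).le
    · exact Filter.Eventually.of_forall fun u =>
        (hc.tendsto _).comp (hx.tendsto_approxParam hs0 hs1 u)
  have h2 := h.mul (tendsto_boxFourier hτ)
  rw [mul_one] at h2
  rw [limitMeasure, integral_map (measurable_limitParam s x).aemeasurable hc.measurable.aestronglyMeasurable]
  exact h2.congr fun n => (approxFourier_eq_integral s x n τ).symm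

lemma norm_approxFourier_zero_le (s : ℝ) (x : ℕ → ℕ → ℕ) (τ : ℝ) :
    ‖approxFourier s x 0 τ‖ ≤ ‖boxFourier τ‖ := by
  rw [approxFourier_eq_integral, norm_mul, pow_zero, div_one]
  refine mul_le_of_le_one_left (norm_nonneg _) ?_
  refine (norm_integral_le_of_norm_le_const (C := 1)
    (Filter.Eventually.of_forall fun u => (Complex.norm_exp_ofReal_mul_I _).le)).trans ?_
  simp

lemma inv_sqrt_numCells_le (s : ℝ) (n : ℕ) : (√(numCells s n : ℝ))⁻¹ ≤ 2 * 2 ^ (-(n * (s / 2))) := by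
  have hp : (0 : ℝ) < 2 ^ ((n : ℝ) * (s / 2)) := by positivity
  have h1 : (2 : ℝ) ^ ((n : ℝ) * (s / 2)) / 2 ≤ √(numCells s n : ℝ) := by
    refine Real.le_sqrt_of_sq_le ?_
    have e : ((2 : ℝ) ^ ((n : ℝ) * (s / 2))) ^ 2 = 2 ^ ((n : ℝ) * s) := by
      rw [← Real.rpow_natCast, ← Real.rpow_mul two_pos.le]; congr 1; push_cast; ring
    rw [div_pow, e]
    have := le_two_mul_numCells s n
    have : (0 : ℝ) < numCells s n := by exact_mod_cast numCells_pos s n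
    linarith
  calc _ ≤ ((2 : ℝ) ^ ((n : ℝ) * (s / 2)) / 2)⁻¹ := by gcongr
    _ = _ := by rw [Real.rpow_neg two_pos.le, inv_div, div_eq_mul_inv]

lemma norm_approxFourier_succ_sub_le_rpow (hx : IsConstruction s B x) (hs0 : 0 ≤ s) (hs1 : s ≤ 1)
    {β : ℝ} (hβ : 0 ≤ β) (hβ1 : β ≤ 1) (n : ℕ) {τ : ℝ} (hτ : τ ≠ 0) :
    ‖approxFourier s x (n + 1) τ - approxFourier s x n τ‖ ≤
      72 * (((n : ℝ) + 1) * 2 ^ (-(n * (s / 2 - β)))) * (2 / |τ|) ^ β := by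
  refine (hx.norm_approxFourier_succ_sub_le hs0 hs1 n hτ).trans ?_
  have hτ' : 0 < |τ| := abs_pos.2 hτ
  have h1 := norm_boxFourier_le_rpow (τ := τ / 2 ^ (n + 1)) (by positivity) hβ hβ1
  have h2 : (2 / |τ / 2 ^ (n + 1)|) ^ β ≤ 2 ^ (n * β) * 2 * (2 / |τ|) ^ β := by
    have e : 2 / |τ / 2 ^ (n + 1)| = 2 ^ n * 2 * (2 / |τ|) := by
      rw [abs_div, abs_of_pos (by positivity : (0 : ℝ) < 2 ^ (n + 1)), pow_succ]; field_simp
    rw [e, Real.mul_rpow (by positivity) (by positivity), Real.mul_rpow (by positivity) (by positivity),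
      ← Real.rpow_natCast, ← Real.rpow_mul two_pos.le]
    gcongr
    calc (2 : ℝ) ^ β ≤ 2 ^ (1 : ℝ) := Real.rpow_le_rpow_of_exponent_le one_le_two hβ1
      _ = 2 := Real.rpow_one 2
  calc _ = 18 * ((n : ℝ) + 1) * (√(numCells s n : ℝ))⁻¹ * ‖boxFourier (τ / 2 ^ (n + 1))‖ := by
        rw [div_eq_mul_inv]
    _ ≤ 18 * ((n : ℝ) + 1) * (2 * 2 ^ (-(n * (s / 2)))) * (2 ^ (n * β) * 2 * (2 / |τ|) ^ β) := by
        gcongr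
        · exact inv_sqrt_numCells_le s n
        · exact h1.trans h2
    _ = _ := by
        have e : (2 : ℝ) ^ (-(n * (s / 2 - β))) = 2 ^ (-(n * (s / 2))) * 2 ^ (n * β) := by
          rw [← Real.rpow_add two_pos]; congr 1; ring
        rw [e]; ring

lemma norm_fourier_le (hx : IsConstruction s B x) (hs0 : 0 ≤ s) (hs1 : s ≤ 1)
    {β : ℝ} (hβ : 0 ≤ β) (hβs : β < s / 2) {τ : ℝ} (hτ : τ ≠ 0) :
    ‖∫ y, Complex.exp ((τ * y : ℝ) * Complex.I) ∂limitMeasure s x‖ ≤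
      (1 + 72 * ∑' n : ℕ, ((n : ℝ) + 1) * 2 ^ (-(n * (s / 2 - β)))) * (2 / |τ|) ^ β := by
  have hsum := summable_succ_mul_rpow (η := s / 2 - β) (by linarith)
  have hb : ∀ n, ‖approxFourier s x n τ‖ ≤
      (1 + 72 * ∑ k ∈ Finset.range n, ((k : ℝ) + 1) * 2 ^ (-(k * (s / 2 - β)))) * (2 / |τ|) ^ β := by
    intro n
    induction n with
    | zero =>
      simpa using (norm_approxFourier_zero_le s x τ).trans
        (norm_boxFourier_le_rpow hτ hβ (by linarith))
    | succ n ih =>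
      have h1 := hx.norm_approxFourier_succ_sub_le_rpow hs0 hs1 hβ (by linarith) n hτ
      have h2 := norm_sub_norm_le (approxFourier s x (n + 1) τ) (approxFourier s x n τ)
      rw [Finset.sum_range_succ]
      linarith
  refine le_of_tendsto (hx.tendsto_approxFourier hs0 hs1 hτ).norm (Filter.Eventually.of_forall fun n => ?_)
  refine (hb n).trans ?_
  gcongr
  exact hsum.sum_le_tsum _ fun k _ => by positivity

lemma isSalem (hx : IsConstruction s B x) (hs0 : 0 ≤ s) (hs1 : s ≤ 1) :
    IsSalem (limitMeasure s x) s := by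
  intro ε hε
  have key : ∀ ξ : ℝ, ‖∫ y, Complex.exp (-(2 * Real.pi * ξ * y) * Complex.I) ∂limitMeasure s x‖ =
      ‖∫ y, Complex.exp ((-(2 * Real.pi * ξ) * y : ℝ) * Complex.I) ∂limitMeasure s x‖ := by
    intro ξ
    congr 2; funext y; congr 2; push_cast; ring
  have triv : ∀ ξ : ℝ,
      ‖∫ y, Complex.exp (-(2 * Real.pi * ξ * y) * Complex.I) ∂limitMeasure s x‖ ≤ 1 := by
    intro ξ
    rw [key]
    refine (norm_integral_le_of_norm_le_const (C := 1)
      (Filter.Eventually.of_forall fun u => (Complex.norm_exp_ofReal_mul_I _).le)).trans ?_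
    simp
  rcases le_total s ε with h | h
  · refine ⟨1, zero_le_one, fun ξ => (triv ξ).trans ?_⟩
    rw [one_mul]
    exact Real.one_le_rpow (by linarith [abs_nonneg ξ]) (by linarith)
  set β := (s - ε) / 2 with hβ
  have hβ0 : 0 ≤ β := by rw [hβ]; linarith
  have hβs : β < s / 2 := by rw [hβ]; linarith
  set K := 1 + 72 * ∑' n : ℕ, ((n : ℝ) + 1) * 2 ^ (-(n * (s / 2 - β))) with hK
  have hK1 : 1 ≤ K := by
    have : 0 ≤ ∑' n : ℕ, ((n : ℝ) + 1) * 2 ^ (-(n * (s / 2 - β))) := tsum_nonneg fun n => by positivity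
    linarith
  refine ⟨K * 2 ^ β, by positivity, fun ξ => ?_⟩
  have hξ := abs_nonneg ξ
  rw [show -(s - ε) / 2 = -β by rw [hβ]; ring, Real.rpow_neg (by positivity), mul_assoc K, ← div_eq_mul_inv,
    ← Real.div_rpow two_pos.le (by positivity)]
  rcases le_total |ξ| 1 with h1 | h1
  · refine (triv ξ).trans ?_
    refine one_le_mul_of_one_le_of_one_le hK1 (Real.one_le_rpow ?_ hβ0)
    rw [one_le_div (by positivity)]; linarith
  · rw [key]
    have hτ : -(2 * Real.pi * ξ) ≠ 0 := by
      have : ξ ≠ 0 := abs_pos.1 (by linarith)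
      have := Real.pi_ne_zero
      simp [*]
    refine (hx.norm_fourier_le hs0 hs1 hβ0 hβs hτ).trans ?_
    rw [← hK]
    gcongr
    rw [abs_neg, abs_mul, abs_of_pos (by positivity : 0 < 2 * Real.pi)]
    nlinarith [Real.pi_gt_three]

end IsConstruction

lemma sq_lintegral_mul_le {α : Type*} [MeasurableSpace α] (μ : Measure α) {f g : α → ENNReal}
    (hf : AEMeasurable f μ) (hg : AEMeasurable g μ) :
    (∫⁻ a, f a * g a ∂μ) ^ 2 ≤ (∫⁻ a, f a ^ 2 ∂μ) * ∫⁻ a, g a ^ 2 ∂μ := by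
  have h := ENNReal.lintegral_mul_le_Lp_mul_Lq μ Real.HolderConjugate.two_two hf hg
  simp only [Pi.mul_apply, ENNReal.rpow_ofNat] at h
  have e : ∀ t : ENNReal, (t ^ (1 / 2 : ℝ)) ^ 2 = t := fun t => by
    rw [← ENNReal.rpow_natCast, ← ENNReal.rpow_mul]; norm_num
  calc _ ≤ _ := pow_le_pow_left' h 2
    _ = _ := by rw [mul_pow, e, e]

lemma ENNReal.mul_le_sq_add_sq (a b : ENNReal) : a * b ≤ a ^ 2 + b ^ 2 := by
  rcases le_total a b with h | h
  · exact (mul_le_mul_left h b).trans (by rw [sq b]; exact le_add_self)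
  · exact (mul_le_mul_right h a).trans (by rw [sq a]; exact le_self_add)

/-- The dual form of an `L²` bound whose kernel satisfies a convolution estimate after composition
with its adjoint. -/
lemma sq_lintegral_sq_le_of_kernel {f g κ : ℝ → ENNReal} {w : ℝ → ℝ → ENNReal} (hf : Measurable f)
    (hκ : Measurable κ) (hg : Measurable g) (hw : Measurable (Function.uncurry w))
    (hgw : ∀ x, g x = ∫⁻ z, f z * w x z)
    (hK : ∀ x x', x ≠ x' → ∫⁻ z, w x z * w x' z ≤ κ (x - x')) :
    (∫⁻ x, g x ^ 2) ^ 2 ≤ (∫⁻ z, f z ^ 2) * (2 * (∫⁻ t, κ t) * ∫⁻ x, g x ^ 2) := by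
  have hw1 : ∀ x, Measurable (w x) := fun x => hw.of_uncurry_left
  have hw2 : ∀ z, Measurable fun x => w x z := fun z => hw.of_uncurry_right
  have hwsw : Measurable fun p : ℝ × ℝ => w p.2 p.1 := hw.comp measurable_swap
  let H : ℝ → ENNReal := fun z => ∫⁻ x, g x * w x z
  have hH : Measurable H := by
    have : Measurable fun p : ℝ × ℝ => g p.2 * w p.2 p.1 := (hg.comp measurable_snd).mul hwsw
    exact this.lintegral_prod_right'
  have h1 : ∫⁻ x, g x ^ 2 = ∫⁻ z, f z * H z := by
    calc _ = ∫⁻ x, ∫⁻ z, g x * (f z * w x z) := by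
          refine lintegral_congr fun x => ?_
          rw [lintegral_const_mul _ (by fun_prop), ← hgw, sq]
      _ = ∫⁻ z, ∫⁻ x, g x * (f z * w x z) :=
          lintegral_lintegral_swap
            ((hg.comp measurable_fst).mul ((hf.comp measurable_snd).mul hw)).aemeasurable
      _ = _ := by
          refine lintegral_congr fun z => ?_
          rw [← lintegral_const_mul _ (by fun_prop)]
          exact lintegral_congr fun x => by ring
  have h2 : ∫⁻ z, H z ^ 2 ≤ 2 * (∫⁻ t, κ t) * ∫⁻ x, g x ^ 2 := by
    calc ∫⁻ z, H z ^ 2 = ∫⁻ z, ∫⁻ x, g x * w x z * H z := by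
          refine lintegral_congr fun z => ?_
          rw [lintegral_mul_const _ (by fun_prop), sq]
      _ = ∫⁻ x, ∫⁻ z, g x * w x z * H z :=
          lintegral_lintegral_swap
            (((hg.comp measurable_snd).mul hwsw).mul (hH.comp measurable_fst)).aemeasurable
      _ ≤ ∫⁻ x, ∫⁻ x', (g x ^ 2 + g x' ^ 2) * κ (x - x') := by
          refine lintegral_mono fun x => ?_
          calc ∫⁻ z, g x * w x z * H z = ∫⁻ z, ∫⁻ x', g x * g x' * (w x z * w x' z) := by
                refine lintegral_congr fun z => ?_
                rw [← lintegral_const_mul _ (by fun_prop)]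
                exact lintegral_congr fun x' => by ring
            _ = ∫⁻ x', ∫⁻ z, g x * g x' * (w x z * w x' z) :=
                lintegral_lintegral_swap (((hg.comp measurable_snd).const_mul _).mul
                  (((hw1 x).comp measurable_fst).mul hwsw)).aemeasurable
            _ ≤ _ := by
                refine lintegral_mono_ae ?_
                have hne : ∀ᵐ x' : ℝ, x' ≠ x := by
                  rw [ae_iff]; simp
                filter_upwards [hne] with x' hx'
                rw [lintegral_const_mul _ (by fun_prop)]
                exact mul_le_mul' (ENNReal.mul_le_sq_add_sq _ _) (hK x x' hx'.symm)
      _ = (∫⁻ x, ∫⁻ x', g x ^ 2 * κ (x - x')) + ∫⁻ x, ∫⁻ x', g x' ^ 2 * κ (x - x') := by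
          have hκ1 : ∀ x : ℝ, Measurable fun x' => κ (x - x') := fun x =>
            hκ.comp (measurable_const.sub measurable_id)
          have hκ2 : Measurable fun p : ℝ × ℝ => κ (p.1 - p.2) := hκ.comp (measurable_fst.sub measurable_snd)
          rw [← lintegral_add_left]
          · refine lintegral_congr fun x => ?_
            rw [← lintegral_add_left ((hκ1 x).const_mul _)]
            exact lintegral_congr fun x' => by ring
          · have : Measurable fun p : ℝ × ℝ => g p.1 ^ 2 * κ (p.1 - p.2) :=
              ((hg.comp measurable_fst).pow_const 2).mul hκ2
            exact this.lintegral_prod_right'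
      _ = _ := by
          have hκ2 : Measurable fun p : ℝ × ℝ => κ (p.1 - p.2) := hκ.comp (measurable_fst.sub measurable_snd)
          have e1 : ∫⁻ x, ∫⁻ x', g x ^ 2 * κ (x - x') = (∫⁻ t, κ t) * ∫⁻ x, g x ^ 2 := by
            rw [← lintegral_const_mul _ (hg.pow_const 2)]
            refine lintegral_congr fun x => ?_
            rw [lintegral_const_mul _ (by fun_prop),
              lintegral_sub_left_eq_self κ x, mul_comm]
          have e2 : ∫⁻ x, ∫⁻ x', g x' ^ 2 * κ (x - x') = (∫⁻ t, κ t) * ∫⁻ x, g x ^ 2 := by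
            rw [lintegral_lintegral_swap (((hg.comp measurable_snd).pow_const 2).mul hκ2).aemeasurable,
              ← lintegral_const_mul _ (hg.pow_const 2)]
            refine lintegral_congr fun x => ?_
            rw [lintegral_const_mul _ (by fun_prop),
              lintegral_sub_right_eq_self κ x, mul_comm]
          rw [e1, e2]; ring
  calc _ = (∫⁻ z, f z * H z) ^ 2 := by rw [h1]
    _ ≤ _ := sq_lintegral_mul_le volume hf.aemeasurable hH.aemeasurable
    _ ≤ _ := by gcongr

lemma lintegral_comp_add_mul {F : ℝ → ENNReal} (hF : Measurable F) (x : ℝ) {r : ℝ} (hr : 0 < r) :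
    ∫⁻ y, F (x + r * y) = ENNReal.ofReal r⁻¹ * ∫⁻ z, F z := by
  have h1 : ∫⁻ y, F (x + r * y) = ∫⁻ z, F (x + z) ∂(volume.map fun y => r * y) := by
    rw [lintegral_map (by fun_prop) (measurable_const_mul r)]
  rw [h1, Real.map_volume_mul_left hr.ne', lintegral_smul_measure, lintegral_add_left_eq_self,
    abs_of_pos (inv_pos.2 hr), smul_eq_mul]

/-- The average of `f` over the dilate by `r` and translate by `x` of the density `m`. -/
noncomputable def dilateAvg (m f : ℝ → ENNReal) (x r : ℝ) : ENNReal := ∫⁻ y, f (x + r * y) * m y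

lemma measurable_dilateAvg {m f : ℝ → ENNReal} (hm : Measurable m) (hf : Measurable f) :
    Measurable (Function.uncurry (dilateAvg m f)) := by
  have : Measurable fun p : (ℝ × ℝ) × ℝ => f (p.1.1 + p.1.2 * p.2) * m p.2 := by fun_prop
  exact this.lintegral_prod_right'

lemma exists_measurable_maximizer {G : ℝ → ℝ → ENNReal} (hG : Measurable (Function.uncurry G))
    {R : Finset ℝ} (hR : R.Nonempty) :
    ∃ ρ : ℝ → ℝ, Measurable ρ ∧ (∀ x, ρ x ∈ R) ∧ ∀ x, ∀ r ∈ R, G x r ≤ G x (ρ x) := by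
  induction hR using Finset.Nonempty.cons_induction with
  | singleton a => exact ⟨fun _ => a, measurable_const, by simp, by simp⟩
  | cons a R ha hR ih =>
    obtain ⟨ρ, hρ, hρR, hmax⟩ := ih
    classical
    have hs : MeasurableSet {x | G x (ρ x) ≤ G x a} :=
      measurableSet_le (hG.comp (measurable_id.prodMk hρ)) (hG.comp (measurable_id.prodMk measurable_const))
    refine ⟨fun x => if G x (ρ x) ≤ G x a then a else ρ x, Measurable.ite hs measurable_const hρ,
      fun x => ?_, fun x r hr => ?_⟩
    · dsimp only
      split_ifs
      · exact Finset.mem_cons_self a R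
      · exact Finset.mem_cons_of_mem (hρR x)
    · dsimp only
      rcases Finset.mem_cons.1 hr with rfl | hr
      · split_ifs with h
        · exact le_rfl
        · exact (not_le.1 h).le
      · split_ifs with h
        · exact (hmax x r hr).trans h
        · exact hmax x r hr

lemma lintegral_dilateAvg_sq_le {m f : ℝ → ENNReal} (hm : Measurable m) (hf : Measurable f)
    (hm1 : ∫⁻ y, m y ≤ 1) (r : ℝ) : ∫⁻ x, dilateAvg m f x r ^ 2 ≤ ∫⁻ x, f x ^ 2 := by
  have h1 : ∀ x, dilateAvg m f x r ^ 2 ≤ ∫⁻ y, f (x + r * y) ^ 2 * m y := by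
    intro x
    have hfx : Measurable fun y => f (x + r * y) := by fun_prop
    have h := sq_lintegral_mul_le (volume.withDensity m) hfx.aemeasurable
      (measurable_const (a := (1 : ENNReal))).aemeasurable
    simp only [mul_one, one_pow, lintegral_const, one_mul, withDensity_apply _ MeasurableSet.univ,
      Measure.restrict_univ] at h
    rw [lintegral_withDensity_eq_lintegral_mul _ hm hfx,
      lintegral_withDensity_eq_lintegral_mul _ hm (hfx.pow_const 2)] at h
    simp only [Pi.mul_apply, mul_comm (m _)] at h
    exact h.trans (mul_le_of_le_one_right' hm1)
  calc _ ≤ ∫⁻ x, ∫⁻ y, f (x + r * y) ^ 2 * m y := lintegral_mono h1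
    _ = ∫⁻ y, ∫⁻ x, f (x + r * y) ^ 2 * m y := lintegral_lintegral_swap (by fun_prop)
    _ = ∫⁻ y, (∫⁻ x, f x ^ 2) * m y := by
        refine lintegral_congr fun y => ?_
        rw [lintegral_mul_const _ (by fun_prop), lintegral_add_right_eq_self (fun x => f x ^ 2)]
    _ = (∫⁻ x, f x ^ 2) * ∫⁻ y, m y := lintegral_const_mul _ hm
    _ ≤ _ := mul_le_of_le_one_right' hm1

lemma lintegral_iSup_dilateAvg_sq_le {m f κ : ℝ → ENNReal} (hm : Measurable m) (hf : Measurable f)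
    (hκ : Measurable κ) (hm1 : ∫⁻ y, m y ≤ 1) (hf2 : ∫⁻ x, f x ^ 2 ≠ ⊤)
    (hK : ∀ r ∈ Icc (1 : ℝ) 2, ∀ r' ∈ Icc (1 : ℝ) 2, ∀ t ≠ 0,
      ∫⁻ y, m y * m ((t + r * y) / r') ≤ κ t)
    (R : Finset ℝ) (hR : ∀ r ∈ R, r ∈ Icc (1 : ℝ) 2) :
    ∫⁻ x, (⨆ r ∈ R, dilateAvg m f x r) ^ 2 ≤ 2 * (∫⁻ t, κ t) * ∫⁻ x, f x ^ 2 := by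
  rcases R.eq_empty_or_nonempty with rfl | hne
  · simp
  have hG := measurable_dilateAvg hm hf
  obtain ⟨ρ, hρ, hρR, hmax⟩ := exists_measurable_maximizer hG hne
  set g : ℝ → ENNReal := fun x => dilateAvg m f x (ρ x) with hg
  have hgm : Measurable g := hG.comp (measurable_id.prodMk hρ)
  have hle : ∀ x, (⨆ r ∈ R, dilateAvg m f x r) ≤ g x := fun x => iSup₂_le fun r hr => hmax x r hr
  have hfin : ∫⁻ x, g x ^ 2 ≠ ⊤ := by
    have h1 : ∫⁻ x, g x ^ 2 ≤ ∑ r ∈ R, ∫⁻ x, dilateAvg m f x r ^ 2 := by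
      rw [← lintegral_finsetSum]
      · refine lintegral_mono fun x => ?_
        exact Finset.single_le_sum (f := fun r => dilateAvg m f x r ^ 2) (fun _ _ => zero_le) (hρR x)
      · intro r _
        exact (hG.comp (measurable_id.prodMk measurable_const)).pow_const 2
    refine ne_top_of_le_ne_top ?_ h1
    exact ENNReal.sum_ne_top.2 fun r _ => ne_top_of_le_ne_top hf2 (lintegral_dilateAvg_sq_le hm hf hm1 r)
  have hρ0 : ∀ x, 0 < ρ x := fun x => lt_of_lt_of_le one_pos (hR _ (hρR x)).1
  have key := sq_lintegral_sq_le_of_kernel (f := f) (g := g) (κ := κ)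
    (w := fun x z => ENNReal.ofReal (ρ x)⁻¹ * m ((z - x) / ρ x)) hf hκ hgm (by unfold Function.uncurry; fun_prop)
    (fun x => by
      have h1 := lintegral_comp_add_mul (F := fun z => f z * m ((z - x) / ρ x)) (by fun_prop) x (hρ0 x)
      have h2 : ∀ y, (x + ρ x * y - x) / ρ x = y := fun y => by
        have := (hρ0 x).ne'
        field_simp; ring
      simp only [h2] at h1
      rw [hg]
      dsimp only
      rw [dilateAvg, h1, ← lintegral_const_mul _ (by fun_prop)]
      exact lintegral_congr fun z => by ring)
    (fun x x' hne => by
      have h1 := lintegral_comp_add_mul (F := fun z => m ((z - x) / ρ x) * m ((z - x') / ρ x'))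
        (by fun_prop) x (hρ0 x)
      have h2 : ∀ y, (x + ρ x * y - x) / ρ x = y := fun y => by
        have := (hρ0 x).ne'
        field_simp; ring
      have h3 : ∀ y, (x + ρ x * y - x') = (x - x') + ρ x * y := fun y => by ring
      simp only [h2, h3] at h1
      have h4 : ENNReal.ofReal (ρ x')⁻¹ ≤ 1 := by
        rw [← ENNReal.ofReal_one]
        exact ENNReal.ofReal_le_ofReal (inv_le_one_of_one_le₀ (hR _ (hρR x')).1)
      calc _ = ENNReal.ofReal (ρ x')⁻¹ * (ENNReal.ofReal (ρ x)⁻¹ *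
            ∫⁻ z, m ((z - x) / ρ x) * m ((z - x') / ρ x')) := by
            rw [← lintegral_const_mul _ (by fun_prop), ← lintegral_const_mul _ (by fun_prop)]
            exact lintegral_congr fun z => by ring
        _ ≤ 1 * κ (x - x') := by
            rw [← h1]
            exact mul_le_mul' h4 (hK _ (hR _ (hρR x)) _ (hR _ (hρR x')) _ (sub_ne_zero.2 hne))
        _ = _ := one_mul _)
  have h5 : ∫⁻ x, g x ^ 2 ≤ 2 * (∫⁻ t, κ t) * ∫⁻ x, f x ^ 2 := by
    by_cases h0 : ∫⁻ x, g x ^ 2 = 0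
    · rw [h0]; exact zero_le
    refine (ENNReal.mul_le_mul_iff_right h0 hfin).1 ?_
    calc _ = (∫⁻ x, g x ^ 2) ^ 2 := (sq _).symm
      _ ≤ _ := key
      _ = _ := by ring
  refine le_trans (lintegral_mono fun x => ?_) h5
  exact pow_le_pow_left' (hle x) 2

lemma lintegral_abs_rpow_ne_top {s : ℝ} (hs1 : s < 1) (K M : ℝ) (hM : 0 ≤ M) :
    ∫⁻ t, (Icc (-M) M).indicator (fun t => ENNReal.ofReal (K * |t| ^ (-s))) t ≠ ⊤ := by
  have h1 := intervalIntegral.intervalIntegrable_cpow' (a := -M) (b := M) (r := ((-s : ℝ) : ℂ))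
    (by rw [Complex.ofReal_re]; linarith)
  have h2 := h1.norm
  simp only [Complex.norm_cpow_real, Complex.norm_real, Real.norm_eq_abs] at h2
  rw [intervalIntegrable_iff_integrableOn_Icc_of_le (by linarith)] at h2
  rw [lintegral_indicator measurableSet_Icc]
  exact (h2.const_mul K).lintegral_lt_top.ne

/-- The density of the uniform measure on the intervals of the `n`-th stage. -/
noncomputable def stageDensity (s : ℝ) (x : ℕ → ℕ → ℕ) (n : ℕ) (y : ℝ) : ENNReal :=
  ENNReal.ofReal (2 ^ n / numCells s n * ∑ j ∈ Finset.range (numCells s n), cellInd n (x n j) y)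

lemma measurable_stageDensity (s : ℝ) (x : ℕ → ℕ → ℕ) (n : ℕ) : Measurable (stageDensity s x n) :=
  ((Finset.measurable_fun_sum _ fun _ _ => measurable_cellInd n _).const_mul _).ennreal_ofReal

lemma stageDensity_eq_sum (s : ℝ) (x : ℕ → ℕ → ℕ) (n : ℕ) (y : ℝ) : stageDensity s x n y =
    (numCells s n : ENNReal)⁻¹ * ∑ j ∈ Finset.range (numCells s n),
      ENNReal.ofReal (2 ^ n) * (cell n (x n j)).indicator 1 y := by
  have hP : (0 : ℝ) < numCells s n := by exact_mod_cast numCells_pos s n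
  have h0 : ∀ j, 0 ≤ cellInd n (x n j) y := fun j => cellInd_nonneg n (x n j) y
  rw [stageDensity, div_mul_eq_mul_div, ENNReal.ofReal_div_of_pos hP, ENNReal.ofReal_natCast, ENNReal.div_eq_inv_mul,
    Finset.mul_sum, ENNReal.ofReal_sum_of_nonneg fun j _ => mul_nonneg (by positivity) (h0 j)]
  congr 1
  refine Finset.sum_congr rfl fun j _ => ?_
  rw [ENNReal.ofReal_mul (by positivity)]
  congr 1
  by_cases h : y ∈ cell n (x n j)
  · rw [cellInd_of_mem h, indicator_of_mem h]; simp
  · rw [cellInd_of_notMem h, indicator_of_notMem h]; simp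

lemma setLIntegral_unit_comp {F : ℝ → ENNReal} (hF : Measurable F) (n i : ℕ) :
    ∫⁻ v, F (1 + i / 2 ^ n + v / 2 ^ n) ∂unitMeasure =
      ∫⁻ y, F y * (ENNReal.ofReal (2 ^ n) * (cell n i).indicator 1 y) := by
  have hc : Measurable ((cell n i).indicator (1 : ℝ → ENNReal)) := measurable_one.indicator measurableSet_Ico
  have h := lintegral_comp_add_mul (F := fun y => F y * (cell n i).indicator 1 y)
    (by fun_prop) (1 + i / 2 ^ n) (r := (2 ^ n)⁻¹) (by positivity)
  rw [inv_inv, ← lintegral_const_mul _ (by fun_prop)] at h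
  rw [unitMeasure, ← lintegral_indicator measurableSet_Ico]
  calc _ = ∫⁻ v, F (1 + i / 2 ^ n + (2 ^ n)⁻¹ * v) * (cell n i).indicator 1 (1 + i / 2 ^ n + (2 ^ n)⁻¹ * v) := by
        refine lintegral_congr fun v => ?_
        have hmem : (1 + i / 2 ^ n + (2 ^ n)⁻¹ * v : ℝ) ∈ cell n i ↔ v ∈ Ico (0 : ℝ) 1 := by
          rw [mem_cell_iff, mem_Ico]
          have e : (1 + i / 2 ^ n + (2 ^ n)⁻¹ * v - 1 : ℝ) * 2 ^ n = i + v := by field_simp; ring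
          rw [e]
          constructor <;> rintro ⟨h1, h2⟩ <;> constructor <;> linarith
        have e2 : (1 + i / 2 ^ n + v / 2 ^ n : ℝ) = 1 + i / 2 ^ n + (2 ^ n)⁻¹ * v := by ring
        by_cases hv : v ∈ Ico (0 : ℝ) 1
        · rw [indicator_of_mem hv, indicator_of_mem (hmem.2 hv), e2]; simp
        · rw [indicator_of_notMem hv, indicator_of_notMem (fun h => hv (hmem.1 h)), mul_zero]
    _ = _ := h
    _ = _ := lintegral_congr fun y => by ring

lemma lintegral_mul_stageDensity (s : ℝ) (x : ℕ → ℕ → ℕ) (n : ℕ) {F : ℝ → ENNReal} (hF : Measurable F) :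
    ∫⁻ y, F y * stageDensity s x n y =
      ∫⁻ p : ℝ × ℝ, F (approxParam s x n p.1 + p.2 / 2 ^ n) ∂(unitMeasure.prod unitMeasure) := by
  have hc : ∀ i, Measurable ((cell n i).indicator (1 : ℝ → ENNReal)) := fun i =>
    measurable_one.indicator measurableSet_Ico
  have hm : Measurable fun p : ℝ × ℝ => F (approxParam s x n p.1 + p.2 / 2 ^ n) :=
    hF.comp (((measurable_approxParam s x n).comp measurable_fst).add (measurable_snd.div_const _))
  rw [lintegral_prod _ hm.aemeasurable]
  have h1 := lintegral_floor_mul (numCells_pos s n)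
    (fun j => ∫⁻ v, F (1 + x n j / 2 ^ n + v / 2 ^ n) ∂unitMeasure)
  unfold approxParam
  rw [h1]
  simp only [setLIntegral_unit_comp hF, stageDensity_eq_sum]
  rw [← lintegral_finsetSum _ fun j _ => by fun_prop, ← lintegral_const_mul _ (by fun_prop)]
  refine lintegral_congr fun y => ?_
  simp only [Finset.mul_sum]
  exact Finset.sum_congr rfl fun j _ => by ring

lemma lintegral_stageDensity (s : ℝ) (x : ℕ → ℕ → ℕ) (n : ℕ) : ∫⁻ y, stageDensity s x n y = 1 := by
  have h := lintegral_mul_stageDensity s x n (F := fun _ => 1) measurable_const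
  simpa using h

namespace IsConstruction

variable {s B : ℝ} {x : ℕ → ℕ → ℕ}

lemma lintegral_limitMeasure_le_liminf (hx : IsConstruction s B x) (hs0 : 0 ≤ s) (hs1 : s ≤ 1)
    {F : ℝ → ENNReal} (hF : LowerSemicontinuous F) :
    ∫⁻ y, F y ∂limitMeasure s x ≤ Filter.liminf (fun n => ∫⁻ y, F y * stageDensity s x n y) Filter.atTop := by
  simp only [lintegral_mul_stageDensity s x _ hF.measurable]
  have hm : ∀ n, Measurable fun p : ℝ × ℝ => F (approxParam s x n p.1 + p.2 / 2 ^ n) := fun n =>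
    hF.measurable.comp (((measurable_approxParam s x n).comp measurable_fst).add (measurable_snd.div_const _))
  have h1 : ∫⁻ y, F y ∂limitMeasure s x =
      ∫⁻ p : ℝ × ℝ, F (limitParam s x p.1) ∂(unitMeasure.prod unitMeasure) := by
    have hl : Measurable fun u => F (limitParam s x u) := hF.measurable.comp (measurable_limitParam s x)
    have hl2 : Measurable fun p : ℝ × ℝ => F (limitParam s x p.1) := hl.comp measurable_fst
    rw [limitMeasure, lintegral_map hF.measurable (measurable_limitParam s x),
      lintegral_prod _ hl2.aemeasurable]
    simp
  rw [h1]
  refine le_trans (lintegral_mono fun p => ?_) (lintegral_liminf_le hm)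
  have ht : Filter.Tendsto (fun n => approxParam s x n p.1 + p.2 / 2 ^ n) Filter.atTop
      (nhds (limitParam s x p.1)) := by
    have h2 : Filter.Tendsto (fun n : ℕ => p.2 / 2 ^ n) Filter.atTop (nhds 0) :=
      tendsto_const_nhds.div_atTop (tendsto_pow_atTop_atTop_of_one_lt one_lt_two)
    simpa using (hx.tendsto_approxParam hs0 hs1 p.1).add h2
  refine (lowerSemicontinuousAt_iff_le_liminf.1 (hF _)).trans ?_
  exact Filter.liminf_le_liminf_of_le ht

lemma stageDensity_eq_zero (hx : IsConstruction s B x) (n : ℕ) {y : ℝ} (hy : y ∉ Ico (1 : ℝ) 2) :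
    stageDensity s x n y = 0 := by
  rw [stageDensity, Finset.sum_eq_zero, mul_zero, ENNReal.ofReal_zero]
  intro j hj
  refine cellInd_of_notMem fun h => hy ?_
  have hlt : ((x n j : ℕ) : ℝ) + 1 ≤ 2 ^ n := by exact_mod_cast (hx.stage n).lt j (Finset.mem_range.1 hj)
  obtain ⟨h1, h2⟩ := mem_cell_iff.1 h
  have hn : (0 : ℝ) < 2 ^ n := by positivity
  have h0 : (0 : ℝ) ≤ x n j := by positivity
  constructor
  · by_contra h3
    have : (y - 1) * 2 ^ n < 0 := mul_neg_of_neg_of_pos (by linarith) hn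
    linarith
  · by_contra h3
    have : 1 * 2 ^ n ≤ (y - 1) * 2 ^ n := by gcongr; linarith
    linarith

lemma lintegral_stageDensity_mul (s : ℝ) (x : ℕ → ℕ → ℕ) (n : ℕ) (a b : ℝ) :
    ∫⁻ y, stageDensity s x n y * stageDensity s x n (a * y + b) =
      ENNReal.ofReal (stageCorr n (numCells s n) (x n) a b) := by
  have h0 : ∀ y, 0 ≤ 2 ^ n / (numCells s n : ℝ) * ∑ j ∈ Finset.range (numCells s n), cellInd n (x n j) y :=
    fun y => mul_nonneg (by positivity) (Finset.sum_nonneg fun j _ => cellInd_nonneg ..)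
  have hi : ∀ j ∈ Finset.range (numCells s n), Integrable fun y => ∑ k ∈ Finset.range (numCells s n),
      cellInd n (x n j) y * cellInd n (x n k) (a * y + b) := fun j _ =>
    integrable_finsetSum _ fun k _ => integrable_corr ..
  have e : ∀ y, (2 ^ n / (numCells s n : ℝ) * ∑ j ∈ Finset.range (numCells s n), cellInd n (x n j) y) *
      (2 ^ n / (numCells s n : ℝ) * ∑ j ∈ Finset.range (numCells s n), cellInd n (x n j) (a * y + b)) =
      (2 ^ n / (numCells s n : ℝ)) ^ 2 * ∑ j ∈ Finset.range (numCells s n), ∑ k ∈ Finset.range (numCells s n),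
        cellInd n (x n j) y * cellInd n (x n k) (a * y + b) := by
    intro y
    rw [← Finset.sum_mul_sum]; ring
  unfold stageDensity
  simp only [← ENNReal.ofReal_mul (h0 _), e]
  rw [← ofReal_integral_eq_lintegral_ofReal ((integrable_finsetSum _ hi).const_mul _), stageCorr_eq_sum_range,
    integral_const_mul, integral_finsetSum _ hi]
  · congr 2
    exact Finset.sum_congr rfl fun j _ => integral_finsetSum _ fun k _ => integrable_corr ..
  · refine Filter.Eventually.of_forall fun y => ?_
    simp only [← e]
    exact mul_nonneg (h0 _) (h0 _)

lemma stageDensity_kernel_le (hx : IsConstruction s B x) (hs0 : 0 ≤ s) (hs1 : s ≤ 1) (hB : 0 ≤ B) (n : ℕ)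
    {r r' t : ℝ} (hr : r ∈ Icc (1 : ℝ) 2) (hr' : r' ∈ Icc (1 : ℝ) 2) (ht : t ≠ 0) :
    ∫⁻ y, stageDensity s x n y * stageDensity s x n ((t + r * y) / r') ≤
      (Icc (-8 : ℝ) 8).indicator (fun t => ENNReal.ofReal (2 * B * |t| ^ (-s))) t := by
  have hr'0 : 0 < r' := by linarith [hr'.1]
  have e : ∀ y, (t + r * y) / r' = r / r' * y + t / r' := fun y => by field_simp; ring
  have ha : 1 / 2 ≤ r / r' := by rw [le_div_iff₀ hr'0]; linarith [hr.1, hr'.2]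
  have ha2 : r / r' ≤ 2 := by rw [div_le_iff₀ hr'0]; linarith [hr.2, hr'.1]
  have htp : 0 < |t| := abs_pos.2 ht
  simp only [e]
  have hb0 : t / r' ≠ 0 := by positivity
  have hbabs : |t / r'| = |t| / r' := by rw [abs_div, abs_of_pos hr'0]
  by_cases hb : |t / r'| ≤ 4
  · have ht8 : t ∈ Icc (-8 : ℝ) 8 := by
      rw [mem_Icc, ← abs_le]
      rw [hbabs, div_le_iff₀ hr'0] at hb
      linarith [hr'.2]
    rw [indicator_of_mem ht8, lintegral_stageDensity_mul]
    refine ENNReal.ofReal_le_ofReal ?_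
    have h1 := hx.corr_le n (r / r') (t / r') ha ha2 hb0 hb
    have hbp : 0 < |t / r'| := abs_pos.2 hb0
    rw [← le_div_iff₀ (by positivity)] at h1
    refine h1.trans ?_
    have h2 : |t| ^ s ≤ 2 * |t / r'| ^ s := by
      calc |t| ^ s ≤ (2 * |t / r'|) ^ s := by
            refine Real.rpow_le_rpow htp.le ?_ hs0
            rw [hbabs, ← mul_div_assoc, le_div_iff₀ hr'0, mul_comm 2]
            gcongr
            exact hr'.2
        _ = 2 ^ s * |t / r'| ^ s := Real.mul_rpow two_pos.le (abs_nonneg _)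
        _ ≤ _ := by
            gcongr
            calc (2 : ℝ) ^ s ≤ 2 ^ (1 : ℝ) := Real.rpow_le_rpow_of_exponent_le one_le_two hs1
              _ = 2 := Real.rpow_one 2
    rw [Real.rpow_neg htp.le, ← div_eq_mul_inv, div_le_div_iff₀ (by positivity) (by positivity)]
    calc B * |t| ^ s ≤ B * (2 * |t / r'| ^ s) := by gcongr
      _ = _ := by ring
  · refine le_trans (le_of_eq ?_) zero_le
    refine (lintegral_congr fun y => ?_).trans lintegral_zero
    by_cases hy : y ∈ Ico (1 : ℝ) 2
    · have : r / r' * y + t / r' ∉ Ico (1 : ℝ) 2 := by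
        rintro ⟨h1, h2⟩
        refine hb (abs_le.2 ⟨?_, ?_⟩) <;> nlinarith [hy.1, hy.2]
      simp [hx.stageDensity_eq_zero n this]
    · simp [hx.stageDensity_eq_zero n hy]

end IsConstruction

lemma lintegral_sq_le_of_le_liminf {S : ℝ → ENNReal} {T : ℕ → ℝ → ENNReal} {K : ENNReal}
    (hT : ∀ n, Measurable (T n)) (hST : ∀ x, S x ≤ Filter.liminf (fun n => T n x) Filter.atTop)
    (hK : ∀ n, ∫⁻ x, T n x ^ 2 ≤ K) : ∫⁻ x, S x ^ 2 ≤ K := by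
  have hmono : Monotone fun t : ENNReal => t ^ 2 := fun a b h => pow_le_pow_left' h 2
  calc ∫⁻ x, S x ^ 2 ≤ ∫⁻ x, Filter.liminf (fun n => T n x ^ 2) Filter.atTop := by
        refine lintegral_mono fun x => ?_
        refine (pow_le_pow_left' (hST x) 2).trans (le_of_eq ?_)
        exact hmono.map_liminf_of_continuousAt (fun n => T n x) (ENNReal.continuous_pow 2).continuousAt
    _ ≤ Filter.liminf (fun n => ∫⁻ x, T n x ^ 2) Filter.atTop :=
        lintegral_liminf_le fun n => (hT n).pow_const 2
    _ ≤ Filter.liminf (fun _ : ℕ => K) Filter.atTop :=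
        Filter.liminf_le_liminf (Filter.Eventually.of_forall hK)
    _ = K := Filter.liminf_const K

lemma LowerSemicontinuous.lintegral_comp_le_liminf {f : ℝ → ENNReal} (hf : LowerSemicontinuous f)
    (ν : Measure ℝ) (x : ℝ) {r : ℝ} {q : ℕ → ℝ} (hq : Filter.Tendsto q Filter.atTop (nhds r)) :
    ∫⁻ y, f (x + r * y) ∂ν ≤ Filter.liminf (fun k => ∫⁻ y, f (x + q k * y) ∂ν) Filter.atTop := by
  have hm := hf.measurable
  refine le_trans (lintegral_mono fun y => ?_) (lintegral_liminf_le fun k => by fun_prop)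
  have ht : Filter.Tendsto (fun k => x + q k * y) Filter.atTop (nhds (x + r * y)) :=
    (hq.mul_const y).const_add x
  exact (lowerSemicontinuousAt_iff_le_liminf.1 (hf _)).trans (Filter.liminf_le_liminf_of_le ht)

lemma lintegral_iSup_Icc_sq_le {f : ℝ → ENNReal} (hf : LowerSemicontinuous f) (ν : Measure ℝ) [SFinite ν]
    {K : ENNReal} (hK : ∀ R : Finset ℝ, (∀ r ∈ R, r ∈ Icc (1 : ℝ) 2) →
      ∫⁻ x, (⨆ r ∈ R, ∫⁻ y, f (x + r * y) ∂ν) ^ 2 ≤ K) :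
    ∫⁻ x, (⨆ r : Icc (1 : ℝ) 2, ∫⁻ y, f (x + r * y) ∂ν) ^ 2 ≤ K := by
  have hm := hf.measurable
  have : Nonempty (Icc (1 : ℝ) 2) := ⟨⟨1, by norm_num⟩⟩
  let q : ℕ → Icc (1 : ℝ) 2 := TopologicalSpace.denseSeq _
  let R : ℕ → Finset ℝ := fun N => (Finset.range N).image fun k => (q k : ℝ)
  refine lintegral_sq_le_of_le_liminf (T := fun N x => ⨆ r ∈ R N, ∫⁻ y, f (x + r * y) ∂ν) (fun N => ?_)
    (fun x => ?_) fun N => hK (R N) ?_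
  · refine Measurable.biSup _ (R N).countable_toSet fun r _ => ?_
    have h : Measurable fun p : ℝ × ℝ => f (p.1 + r * p.2) := by fun_prop
    exact h.lintegral_prod_right'
  · refine iSup_le fun r => ?_
    obtain ⟨u, hu, hur⟩ := mem_closure_iff_seq_limit.1 ((TopologicalSpace.denseRange_denseSeq (Icc (1 : ℝ) 2)) r)
    have hur' : Filter.Tendsto (fun k => (u k : ℝ)) Filter.atTop (nhds (r : ℝ)) :=
      (continuous_subtype_val.tendsto r).comp hur
    refine (hf.lintegral_comp_le_liminf ν x hur').trans ?_
    refine (Filter.liminf_le_liminf (v := fun _ => _) (Filter.Eventually.of_forall fun k => ?_)).trans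
      (Filter.liminf_const _).le
    obtain ⟨j, hj⟩ := hu k
    refine Filter.le_liminf_of_le (by isBoundedDefault) ?_
    filter_upwards [Filter.eventually_gt_atTop j] with N hN
    have hmem : (u k : ℝ) ∈ R N := Finset.mem_image.2 ⟨j, Finset.mem_range.2 hN, by rw [← hj]⟩
    exact le_iSup₂ (f := fun (r : ℝ) (_ : r ∈ R N) => ∫⁻ y, f (x + r * y) ∂ν) (u k : ℝ) hmem
  · intro r hr
    obtain ⟨k, _, rfl⟩ := Finset.mem_image.1 hr
    exact (q k).2

lemma lintegral_iSup_Icc_sq_le_of_lowerSemicontinuous (ν : Measure ℝ) {K : ENNReal} (hK : K ≠ ⊤)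
    (h : ∀ f : ℝ → ENNReal, LowerSemicontinuous f → ∫⁻ x, f x ^ 2 ≠ ⊤ →
      ∫⁻ x, (⨆ r : Icc (1 : ℝ) 2, ∫⁻ y, f (x + r * y) ∂ν) ^ 2 ≤ K * ∫⁻ x, f x ^ 2)
    {f : ℝ → ENNReal} (hf : Measurable f) (hf2 : ∫⁻ x, f x ^ 2 ≠ ⊤) :
    ∫⁻ x, (⨆ r : Icc (1 : ℝ) 2, ∫⁻ y, f (x + r * y) ∂ν) ^ 2 ≤ K * ∫⁻ x, f x ^ 2 := by
  refine ENNReal.le_of_forall_pos_le_add fun ε hε _ => ?_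
  have hε' : (ε : ENNReal) / (K + 1) ≠ 0 :=
    (ENNReal.div_pos (by exact_mod_cast hε.ne') (by finiteness)).ne'
  obtain ⟨g, hfg, hg, hgi⟩ := exists_le_lowerSemicontinuous_lintegral_ge volume (fun x => f x ^ 2)
    (hf.pow_const 2) hε'
  have hsq : ∀ t : ENNReal, (t ^ (1 / 2 : ℝ)) ^ 2 = t := fun t => by
    rw [← ENNReal.rpow_natCast, ← ENNReal.rpow_mul]; norm_num
  have hg' : LowerSemicontinuous fun x => g x ^ (1 / 2 : ℝ) :=
    (ENNReal.continuous_rpow_const (y := 1 / 2)).comp_lowerSemicontinuous hg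
      (ENNReal.monotone_rpow_of_nonneg (by norm_num))
  have hfle : ∀ x, f x ≤ g x ^ (1 / 2 : ℝ) := fun x => by
    rw [← ENNReal.rpow_le_rpow_iff (z := 2) (by norm_num), ← ENNReal.rpow_mul]
    simpa using hfg x
  have h1 := h _ hg' (by simp only [hsq]; exact ne_top_of_le_ne_top (by finiteness) hgi)
  simp only [hsq] at h1
  calc _ ≤ ∫⁻ x, (⨆ r : Icc (1 : ℝ) 2, ∫⁻ y, g (x + r * y) ^ (1 / 2 : ℝ) ∂ν) ^ 2 := by
        gcongr
        exact hfle _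
    _ ≤ K * ((∫⁻ x, f x ^ 2) + ε / (K + 1)) := h1.trans (by gcongr)
    _ = K * (∫⁻ x, f x ^ 2) + K * (ε / (K + 1)) := mul_add _ _ _
    _ ≤ _ := by
        gcongr
        calc K * (ε / (K + 1)) ≤ (K + 1) * (ε / (K + 1)) := by gcongr; exact le_self_add
          _ ≤ ε := ENNReal.mul_div_le

lemma enorm_restrictedMax_le (ν : Measure ℝ) {f : ℝ → ℝ} (hf : Measurable f) (x : ℝ) :
    ‖restrictedMax ν f x‖ₑ ≤ ⨆ r : Icc (1 : ℝ) 2, ∫⁻ y, ‖f (x + r * y)‖ₑ ∂ν := by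
  set S := ⨆ r : Icc (1 : ℝ) 2, ∫⁻ y, ‖f (x + r * y)‖ₑ ∂ν with hS
  by_cases htop : S = ⊤
  · rw [htop]; exact le_top
  have : Nonempty (Icc (1 : ℝ) 2) := ⟨⟨1, by norm_num⟩⟩
  have h0 : 0 ≤ restrictedMax ν f x := Real.iSup_nonneg fun r => integral_nonneg fun y => abs_nonneg _
  rw [Real.enorm_of_nonneg h0]
  refine ENNReal.ofReal_le_of_le_toReal (ciSup_le fun r => ?_)
  have hmeas : Measurable fun y => |f (x + r * y)| :=
    (hf.comp (by fun_prop : Measurable fun y : ℝ => x + r * y)).norm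
  rw [integral_eq_lintegral_of_nonneg_ae (Filter.Eventually.of_forall fun y => abs_nonneg _)
    hmeas.aestronglyMeasurable]
  refine ENNReal.toReal_mono htop ?_
  simp only [← Real.enorm_eq_ofReal_abs]
  exact le_iSup (fun r : Icc (1 : ℝ) 2 => ∫⁻ y, ‖f (x + r * y)‖ₑ ∂ν) r

lemma eLpNorm_two_eq (f : ℝ → ℝ) : eLpNorm f 2 volume = (∫⁻ x, ‖f x‖ₑ ^ 2) ^ (1 / 2 : ℝ) := by
  rw [eLpNorm_eq_lintegral_rpow_enorm_toReal two_ne_zero ENNReal.ofNat_ne_top]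
  simp

lemma exists_eLpNorm_restrictedMax_le (ν : Measure ℝ) {K : ENNReal} (hK : K ≠ ⊤)
    (h : ∀ f : ℝ → ENNReal, Measurable f → ∫⁻ x, f x ^ 2 ≠ ⊤ →
      ∫⁻ x, (⨆ r : Icc (1 : ℝ) 2, ∫⁻ y, f (x + r * y) ∂ν) ^ 2 ≤ K * ∫⁻ x, f x ^ 2) :
    ∃ C : ℝ, 0 ≤ C ∧ ∀ f : ℝ → ℝ, Measurable f →
      eLpNorm (restrictedMax ν f) 2 volume ≤ ENNReal.ofReal C * eLpNorm f 2 volume := by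
  refine ⟨(K ^ (1 / 2 : ℝ)).toReal + 1, by positivity, fun f hf => ?_⟩
  have hC : K ^ (1 / 2 : ℝ) ≤ ENNReal.ofReal ((K ^ (1 / 2 : ℝ)).toReal + 1) := by
    have : K ^ (1 / 2 : ℝ) ≠ ⊤ := by finiteness
    rw [ENNReal.ofReal_add ENNReal.toReal_nonneg zero_le_one, ENNReal.ofReal_toReal this]
    exact le_self_add
  rw [eLpNorm_two_eq, eLpNorm_two_eq]
  by_cases hf2 : ∫⁻ x, ‖f x‖ₑ ^ 2 = ⊤
  · rw [hf2, ENNReal.top_rpow_of_pos (by norm_num), ENNReal.mul_top]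
    · exact le_top
    · rw [← pos_iff_ne_zero, ENNReal.ofReal_pos]; positivity
  calc _ ≤ (K * ∫⁻ x, ‖f x‖ₑ ^ 2) ^ (1 / 2 : ℝ) := by
        refine ENNReal.rpow_le_rpow ?_ (by norm_num)
        refine le_trans (lintegral_mono fun x => ?_) (h _ hf.enorm hf2)
        exact pow_le_pow_left' (enorm_restrictedMax_le ν hf x) 2
    _ = K ^ (1 / 2 : ℝ) * (∫⁻ x, ‖f x‖ₑ ^ 2) ^ (1 / 2 : ℝ) := ENNReal.mul_rpow_of_nonneg _ _ (by norm_num)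
    _ ≤ _ := by gcongr

namespace IsConstruction

variable {s B : ℝ} {x : ℕ → ℕ → ℕ}

lemma exists_eLpNorm_restrictedMax_le (hx : IsConstruction s B x) (hs0 : 0 ≤ s) (hs1 : s < 1) (hB : 0 ≤ B) :
    ∃ C : ℝ, 0 ≤ C ∧ ∀ f : ℝ → ℝ, Measurable f →
      eLpNorm (restrictedMax (limitMeasure s x) f) 2 volume ≤ ENNReal.ofReal C * eLpNorm f 2 volume := by
  set κ : ℝ → ENNReal := (Icc (-8 : ℝ) 8).indicator fun t => ENNReal.ofReal (2 * B * |t| ^ (-s))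
  have hκ : Measurable κ := by
    refine Measurable.indicator ?_ measurableSet_Icc
    fun_prop
  have hκi : ∫⁻ t, κ t ≠ ⊤ := lintegral_abs_rpow_ne_top hs1 (2 * B) 8 (by norm_num)
  have hK : 2 * ∫⁻ t, κ t ≠ ⊤ := ENNReal.mul_ne_top ENNReal.ofNat_ne_top hκi
  refine _root_.exists_eLpNorm_restrictedMax_le _ hK fun f hf hf2 => ?_
  refine lintegral_iSup_Icc_sq_le_of_lowerSemicontinuous _ hK (fun f hf hf2 => ?_) hf hf2
  have hm := hf.measurable
  refine lintegral_iSup_Icc_sq_le hf _ fun R hR => ?_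
  refine lintegral_sq_le_of_le_liminf (T := fun n x' => ⨆ r ∈ R, dilateAvg (stageDensity s x n) f x' r)
    (fun n => ?_) (fun x' => ?_) (fun n => ?_)
  · refine Measurable.biSup _ R.countable_toSet fun r _ => ?_
    exact (measurable_dilateAvg (measurable_stageDensity s x n) hm).comp
      (measurable_id.prodMk measurable_const)
  · refine iSup₂_le fun r hr => ?_
    have hlsc : LowerSemicontinuous fun y => f (x' + r * y) := hf.comp (by fun_prop)
    refine (hx.lintegral_limitMeasure_le_liminf hs0 hs1.le hlsc).trans ?_
    refine Filter.liminf_le_liminf (Filter.Eventually.of_forall fun n => ?_)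
    exact le_iSup₂ (f := fun (r : ℝ) (_ : r ∈ R) => dilateAvg (stageDensity s x n) f x' r) r hr
  · exact lintegral_iSup_dilateAvg_sq_le (measurable_stageDensity s x n) hm hκ
      (lintegral_stageDensity s x n).le hf2
      (fun r hr r' hr' t ht => hx.stageDensity_kernel_le hs0 hs1.le hB n hr hr' ht) R hR

end IsConstruction

theorem stmt2 (s : ℝ) (hs : s ∈ Ioo (1/2 : ℝ) 1) :
    ∃ (A : Set ℝ) (ν : Measure ℝ), IsCompact A ∧ A ⊆ Icc 1 2 ∧
      IsProbabilityMeasure ν ∧ msupport ν = A ∧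
      IsAhlforsRegular ν s ∧ IsSalem ν s ∧
      ∃ C : ℝ, 0 ≤ C ∧ ∀ f : ℝ → ℝ, Measurable f →
        eLpNorm (restrictedMax ν f) 2 volume ≤ ENNReal.ofReal C * eLpNorm f 2 volume := by
  have hs0 : 0 ≤ s := by linarith [hs.1]
  obtain ⟨B, x, hB, hx⟩ := exists_isConstruction hs.1 hs.2.le
  exact ⟨msupport (limitMeasure s x), limitMeasure s x, hx.isCompact_msupport hs0 hs.2.le,
    hx.msupport_limitMeasure_subset hs0 hs.2.le, inferInstance, rfl, hx.isAhlforsRegular hs0 hs.2.le,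
    hx.isSalem hs0 hs.2.le, hx.exists_eLpNorm_restrictedMax_le hs0 hs.2 hB⟩
end

section
/- Let t ∈ (0,1] and let ν be a finite Borel measure on ℝ with ν({0}) = 0. Suppose there exists a Borel set E ⊂ ℝ with Hausdorff dimension dim_H E < t and ν(E) > 0. Then for every p ∈ [1, 1/t] and every q ∈ [1,∞], the restricted maximal operator M_ν is not bounded from L^p(ℝ) to L^q(ℝ): there is no C < ∞ such that ‖M_ν f‖_{L^q(ℝ)} ≤ C‖f‖_{L^p(ℝ)} for all measurable f. -/
open MeasureTheory Set
open scoped ENNReal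

/-- Boundedness of the restricted maximal operator from `L^p(ℝ)` to `L^q(ℝ)`
(`q` is allowed to be `∞`). -/
def BoundedLpLq (ν : Measure ℝ) (p : ℝ) (q : ℝ≥0∞) : Prop :=
  ∃ C : ℝ, 0 ≤ C ∧ ∀ f : ℝ → ℝ, Measurable f →
    eLpNorm (restrictedMax ν f) q volume ≤
      ENNReal.ofReal C * eLpNorm f (ENNReal.ofReal p) volume

/-- A linear choice of the dilation parameter sends a neighbourhood of `y₀` near the origin, so
the maximal function of the indicator of `[-2δ, 2δ]` is at least `ν (closedBall y₀ δ)` on a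
set of measure `|y₀|`. -/
theorem measureReal_closedBall_le_restrictedMax (ν : Measure ℝ) [IsFiniteMeasure ν]
    {y₀ δ r : ℝ} (hr : r ∈ Icc (1 : ℝ) 2) :
    ν.real (Metric.closedBall y₀ δ) ≤
      restrictedMax ν ((Metric.closedBall (0 : ℝ) (2 * δ)).indicator 1) (-(r * y₀)) := by
  set A := Metric.closedBall (0 : ℝ) (2 * δ)
  have habs (z : ℝ) : |A.indicator (1 : ℝ → ℝ) z| = A.indicator (1 : ℝ → ℝ) z :=
    abs_of_nonneg (indicator_nonneg (fun _ _ => zero_le_one) z)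
  have hint (s x : ℝ) : ∫ y, |A.indicator (1 : ℝ → ℝ) (x + s * y)| ∂ν =
      ν.real ((fun y => x + s * y) ⁻¹' A) := by
    have hm : MeasurableSet ((fun y => x + s * y) ⁻¹' A) :=
      Metric.isClosed_closedBall.measurableSet.preimage (by fun_prop)
    simp only [habs]
    rw [← integral_indicator_one hm]
    rfl
  unfold restrictedMax
  simp only [hint]
  refine le_trans ?_ (le_ciSup (f := fun s : Icc (1 : ℝ) 2 =>
    ν.real ((fun y => -(r * y₀) + (s : ℝ) * y) ⁻¹' A)) ?_ ⟨r, hr⟩)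
  · refine measureReal_mono fun y hy => ?_
    rw [Metric.mem_closedBall, Real.dist_eq] at hy
    rw [mem_preimage, Metric.mem_closedBall, Real.dist_eq,
      show -(r * y₀) + r * y - 0 = r * (y - y₀) by ring, abs_mul,
      abs_of_nonneg (zero_le_one.trans hr.1)]
    exact mul_le_mul hr.2 hy (abs_nonneg _) zero_le_two
  · refine ⟨ν.real univ, ?_⟩
    rintro _ ⟨s, rfl⟩
    exact measureReal_mono (subset_univ _)

/-- Boundedness of the restricted maximal operator forces a Frostman-type bound on `ν` away from
the origin. -/
theorem BoundedLpLq.measure_closedBall_le {ν : Measure ℝ} [IsFiniteMeasure ν] {p : ℝ} {q : ℝ≥0∞}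
    (h : BoundedLpLq ν p q) (hp : 1 ≤ p) (hq : 1 ≤ q) {c : ℝ} (hc : 0 < c) :
    ∃ K : ℝ≥0∞, K ≠ 0 ∧ K ≠ ∞ ∧ ∀ y : ℝ, c ≤ |y| → ∀ δ : ℝ, 0 ≤ δ →
      ν (Metric.closedBall y δ) ≤ K * ENNReal.ofReal δ ^ (1 / p) := by
  obtain ⟨C, -, hC⟩ := h
  have hp0 : 0 < p := zero_lt_one.trans_le hp
  set a : ℝ≥0∞ := ENNReal.ofReal c ^ (1 / q.toReal)
  have ha0 : a ≠ 0 := (ENNReal.rpow_pos (by simpa using hc) ENNReal.ofReal_ne_top).ne'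
  have haT : a ≠ ∞ := ENNReal.rpow_ne_top_of_nonneg (by positivity) ENNReal.ofReal_ne_top
  have h4 : (4 : ℝ≥0∞) ^ (1 / p) ≠ ∞ := ENNReal.rpow_ne_top_of_nonneg (by positivity) (by simp)
  refine ⟨ENNReal.ofReal C * 4 ^ (1 / p) * a⁻¹ + 1, by simp, ?_, fun y hy δ hδ => ?_⟩
  · exact ENNReal.add_ne_top.2 ⟨ENNReal.mul_ne_top (ENNReal.mul_ne_top ENNReal.ofReal_ne_top h4)
      (ENNReal.inv_ne_top.2 ha0), ENNReal.one_ne_top⟩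
  have hy0 : y ≠ 0 := abs_pos.1 (hc.trans_le hy)
  set S : Set ℝ := (fun x => x * (-y)⁻¹) ⁻¹' Icc 1 2
  have hS : MeasurableSet S := measurableSet_Icc.preimage (by fun_prop)
  have hvol : volume S = ENNReal.ofReal |y| := by
    rw [Real.volume_preimage_mul_right (inv_ne_zero (neg_ne_zero.2 hy0)), Real.volume_Icc]
    norm_num
  have hlower : ν (Metric.closedBall y δ) * a ≤
      eLpNorm (restrictedMax ν ((Metric.closedBall (0 : ℝ) (2 * δ)).indicator 1)) q volume := by
    calc ν (Metric.closedBall y δ) * a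
        ≤ ν (Metric.closedBall y δ) * volume S ^ (1 / q.toReal) := by
          rw [hvol]
          gcongr
          exact ENNReal.rpow_le_rpow (ENNReal.ofReal_le_ofReal hy) (by positivity)
      _ = eLpNorm (S.indicator fun _ => ν.real (Metric.closedBall y δ)) q volume := by
          rw [eLpNorm_indicator_const' hS (by simpa [hvol] using hy0)
            (zero_lt_one.trans_le hq).ne', Real.enorm_of_nonneg measureReal_nonneg,
            ofReal_measureReal]
      _ ≤ _ := by
          refine eLpNorm_mono fun x => ?_
          by_cases hx : x ∈ S
          · have key := measureReal_closedBall_le_restrictedMax ν (y₀ := y) (δ := δ) hx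
            have hxe : -(x * (-y)⁻¹ * y) = x := by field_simp
            rw [hxe] at key
            rw [indicator_of_mem hx, Real.norm_of_nonneg measureReal_nonneg]
            exact key.trans (le_abs_self _)
          · simp [indicator_of_notMem hx]
  have hupper : eLpNorm ((Metric.closedBall (0 : ℝ) (2 * δ)).indicator (1 : ℝ → ℝ))
      (ENNReal.ofReal p) volume ≤ 4 ^ (1 / p) * ENNReal.ofReal δ ^ (1 / p) := by
    refine (eLpNorm_indicator_const_le (1 : ℝ) _).trans_eq ?_
    rw [Real.volume_closedBall, ENNReal.toReal_ofReal hp0.le,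
      ← ENNReal.mul_rpow_of_nonneg _ _ (by positivity),
      show 2 * (2 * δ) = 4 * δ by ring, ENNReal.ofReal_mul (by norm_num)]
    simp
  have hmain := (hlower.trans (hC _ (measurable_one.indicator
    Metric.isClosed_closedBall.measurableSet))).trans (mul_le_mul_right hupper _)
  calc ν (Metric.closedBall y δ)
      ≤ ENNReal.ofReal C * (4 ^ (1 / p) * ENNReal.ofReal δ ^ (1 / p)) / a :=
        (ENNReal.le_div_iff_mul_le (.inl ha0) (.inl haT)).2 hmain
    _ = ENNReal.ofReal C * 4 ^ (1 / p) * a⁻¹ * ENNReal.ofReal δ ^ (1 / p) := by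
        rw [div_eq_mul_inv]; ring
    _ ≤ _ := by gcongr; exact le_self_add

/-- The mass distribution principle: a Frostman-type bound on balls centred in `F` makes the
restriction of `ν` to `F` absolutely continuous with respect to Hausdorff measure. -/
theorem restrict_absolutelyContinuous_hausdorffMeasure {ν : Measure ℝ} {F : Set ℝ}
    (hF : MeasurableSet F) {K : ℝ≥0∞} (hK0 : K ≠ 0) (hKT : K ≠ ∞) {d : ℝ}
    (h : ∀ y ∈ F, ∀ δ : ℝ, 0 ≤ δ →
      ν (Metric.closedBall y δ) ≤ K * ENNReal.ofReal δ ^ d) :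
    ν.restrict F ≪ μH[d] := by
  have hle : K⁻¹ • ν.restrict F ≤ μH[d] := by
    refine Measure.le_hausdorffMeasure d _ 1 one_pos fun s hs => ?_
    rw [Measure.smul_apply, smul_eq_mul]
    by_cases hsF : (s ∩ F).Nonempty
    · obtain ⟨y, hys, hyF⟩ := hsF
      have hfin : Metric.ediam s ≠ ∞ := ne_top_of_le_ne_top ENNReal.one_ne_top hs
      have hsub : s ⊆ Metric.closedBall y (Metric.ediam s).toReal := fun z hz => by
        rw [Metric.mem_closedBall, dist_edist]
        exact ENNReal.toReal_mono hfin (Metric.edist_le_ediam_of_mem hz hys)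
      have hν := (Measure.restrict_apply_le F s).trans ((measure_mono hsub).trans
        (h y hyF _ ENNReal.toReal_nonneg))
      rw [ENNReal.ofReal_toReal hfin] at hν
      calc K⁻¹ * ν.restrict F s ≤ K⁻¹ * (K * Metric.ediam s ^ d) := by gcongr
        _ = Metric.ediam s ^ d := by
          rw [← mul_assoc, ENNReal.inv_mul_cancel hK0 hKT, one_mul]
    · rw [Measure.restrict_apply' hF, not_nonempty_iff_eq_empty.1 hsF]
      simp
  intro s hs
  have := hle s
  rw [hs, Measure.smul_apply, smul_eq_mul, nonpos_iff_eq_zero, mul_eq_zero] at this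
  exact this.resolve_left (ENNReal.inv_ne_zero.2 hKT)

theorem stmt4 (t : ℝ) (ht : t ∈ Ioc (0 : ℝ) 1)
    (ν : Measure ℝ) [IsFiniteMeasure ν] (h0 : ν {0} = 0)
    (E : Set ℝ) (hE : MeasurableSet E)
    (hdim : dimH E < ENNReal.ofReal t) (hpos : 0 < ν E) :
    ∀ p : ℝ, 1 ≤ p → p ≤ 1 / t → ∀ q : ℝ≥0∞, 1 ≤ q → ¬ BoundedLpLq ν p q := by
  intro p hp hpt q hq hB
  have hp0 : 0 < p := zero_lt_one.trans_le hp
  have htp : t ≤ 1 / p := (le_div_iff₀ hp0).2 (by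
    simpa [mul_comm] using (le_div_iff₀ ht.1).1 hpt)
  have hHE : μH[1 / p] E = 0 := by
    have := hausdorffMeasure_of_dimH_lt (s := E) (d := (1 / p).toNNReal)
      (hdim.trans_le (ENNReal.ofReal_le_ofReal htp))
    rwa [Real.coe_toNNReal _ (by positivity)] at this
  have hnull (n : ℕ) : ν (E ∩ {y | 1 / ((n : ℝ) + 1) ≤ |y|}) = 0 := by
    obtain ⟨K, hK0, hKT, hK⟩ := hB.measure_closedBall_le hp hq
      (Nat.one_div_pos_of_nat (α := ℝ) (n := n))
    rw [← Measure.restrict_apply hE]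
    exact restrict_absolutelyContinuous_hausdorffMeasure
      (F := {y | 1 / ((n : ℝ) + 1) ≤ |y|})
      (measurableSet_le measurable_const (by fun_prop)) hK0 hKT hK hHE
  refine hpos.ne' (measure_mono_null (fun y hy => ?_)
    (measure_union_null h0 (measure_iUnion_null hnull)))
  by_cases hy0 : y = 0
  · exact .inl hy0
  · obtain ⟨n, hn⟩ := exists_nat_one_div_lt (abs_pos.2 hy0)
    exact .inr (mem_iUnion.2 ⟨n, hy, hn.le⟩)
end
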